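/- Let 0 < R < T, let q₁, q₂ be C⁸ functions on ℝ³, and let u₁, u₂ be C² solutions of the Goursat problems for q₁ and q₂ respectively on the cone {(x,t) : t ≥ |x|}. Suppose u₁ = u₂ and ∂_r u₁ = ∂_r u₂ at every point of the cylinder C = {(x,t) : |x| = R, R ≤ t ≤ T}, and suppose q₁ − q₂ ∈ Q_γ(R,T) for some γ > 0. Then q₁ = q₂ on the annulus A = {x ∈ ℝ³ : R ≤ |x| ≤ (R+T)/2}. -/

import Mathlib

noncomputable section

open Real MeasureTheory Metric Set

/-- Euclidean 3-space. -/
abbrev E3 : Type := EuclideanSpace ℝ (Fin 3)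

/-- The `i`-th standard basis vector of `ℝ³`. -/
def basis3 (i : Fin 3) : E3 := EuclideanSpace.single i 1

/-- The partial derivative `∂ᵢ f` of a function on `ℝ³`. -/
def pd (i : Fin 3) (f : E3 → ℝ) (x : E3) : ℝ := fderiv ℝ f x (basis3 i)

/-- The Laplacian `Δf` on `ℝ³`. -/
def lap (f : E3 → ℝ) (x : E3) : ℝ := ∑ i, pd i (pd i f) x

/-- The radial derivative `∂_r f(x) = (x/|x|)·∇f(x)`. -/
def pdr (f : E3 → ℝ) (x : E3) : ℝ := ‖x‖⁻¹ * ∑ i, x i * pd i f x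

/-- The angular derivative `Ω_{ij} f = xᵢ ∂ⱼ f − xⱼ ∂ᵢ f`. -/
def ang (i j : Fin 3) (f : E3 → ℝ) (x : E3) : ℝ := x i * pd j f x - x j * pd i f x

/-- `Ω f = Σ_{i<j} Ω_{ij}(Ω_{ij} f)`. -/
def angLap (f : E3 → ℝ) (x : E3) : ℝ :=
  ∑ i, ∑ j, if i < j then ang i j (ang i j f) x else 0

/-- The squared length `|∇f(x)|²` of the gradient. -/
def gradsq (f : E3 → ℝ) (x : E3) : ℝ := ∑ i, (pd i f x) ^ 2

/-- `Σ_{i<j} (Ω_{ij} g)²`. -/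
def angsq (g : E3 → ℝ) (x : E3) : ℝ := ∑ i, ∑ j, if i < j then (ang i j g x) ^ 2 else 0

/-- `Σ_{i<j} Σ_{k<l} (Ω_{kl} Ω_{ij} g)²`. -/
def angsq2 (g : E3 → ℝ) (x : E3) : ℝ :=
  ∑ i, ∑ j, ∑ k, ∑ l, if i < j ∧ k < l then (ang k l (ang i j g) x) ^ 2 else 0

/-- The time derivative `∂_t u` of a space-time function. -/
def pdt (u : E3 × ℝ → ℝ) (p : E3 × ℝ) : ℝ := fderiv ℝ u p (0, 1)

/-- The spatial slice `x ↦ u(x,t)` of a space-time function, at fixed time `t`. -/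
def fixT (u : E3 × ℝ → ℝ) (t : ℝ) : E3 → ℝ := fun y => u (y, t)

/-- The spatial partial derivative `∂ᵢ u` of a space-time function (`t` fixed). -/
def pdx (i : Fin 3) (u : E3 × ℝ → ℝ) (p : E3 × ℝ) : ℝ := pd i (fixT u p.2) p.1

/-- The spatial radial derivative `∂_r u` of a space-time function (`t` fixed). -/
def pdrX (u : E3 × ℝ → ℝ) (p : E3 × ℝ) : ℝ := pdr (fixT u p.2) p.1

/-- The spatial angular derivative `Ω_{ij} u` of a space-time function (`t` fixed). -/
def angX (i j : Fin 3) (u : E3 × ℝ → ℝ) (p : E3 × ℝ) : ℝ := ang i j (fixT u p.2) p.1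

/-- The spatial operator `Ω u` of a space-time function (`t` fixed). -/
def angLapX (u : E3 × ℝ → ℝ) (p : E3 × ℝ) : ℝ := angLap (fixT u p.2) p.1

/-- The spatial Laplacian `Δu` of a space-time function (`t` fixed). -/
def lapX (u : E3 × ℝ → ℝ) (p : E3 × ℝ) : ℝ := lap (fixT u p.2) p.1

/-- The squared spatial gradient `|∇u|²` of a space-time function (`t` fixed). -/
def gradsqX (u : E3 × ℝ → ℝ) (p : E3 × ℝ) : ℝ := gradsq (fixT u p.2) p.1

/-- `Σ_{i<j} (Ω_{ij} w)²` for a space-time function (`t` fixed). -/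
def angsqX (w : E3 × ℝ → ℝ) (p : E3 × ℝ) : ℝ :=
  ∑ i, ∑ j, if i < j then (angX i j w p) ^ 2 else 0

/-- The solid light cone `t ≥ |x|`. -/
def cone : Set (E3 × ℝ) := {p | ‖p.1‖ ≤ p.2}

/-- `u` is a C² solution of the Goursat problem for `q` on the cone `t ≥ |x|`:
`∂_t²u − Δu − q u = 0` for `t > |x|` and `u(x,|x|) = ∫₀¹ q(σx) dσ`. -/
def GoursatSol (q : E3 → ℝ) (u : E3 × ℝ → ℝ) : Prop :=
  ContDiffOn ℝ 2 u cone ∧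
  (∀ p : E3 × ℝ, ‖p.1‖ < p.2 → pdt (pdt u) p - lapX u p - q p.1 * u p = 0) ∧
  (∀ x : E3, u (x, ‖x‖) = ∫ σ in (0:ℝ)..1, q (σ • x))

/-- `p(x) = ∫₀^{|x|} q(σ x/|x|) dσ`. -/
def pfun (q : E3 → ℝ) (x : E3) : ℝ := ∫ σ in (0:ℝ)..‖x‖, q ((σ / ‖x‖) • x)

/-- Integral over the sphere of radius `r` with respect to surface measure. -/
def sphInt (r : ℝ) (g : E3 → ℝ) : ℝ := ∫ x in sphere (0:E3) r, g x ∂μH[2]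

/-- Squared `L²` norm on the sphere of radius `r`. -/
def L2sq (g : E3 → ℝ) (r : ℝ) : ℝ := sphInt r (fun x => (g x) ^ 2)

/-- Squared `H¹` norm on the sphere of radius `r`. -/
def H1sq (g : E3 → ℝ) (r : ℝ) : ℝ := sphInt r (fun x => (g x) ^ 2 + (r ^ 2)⁻¹ * angsq g x)

/-- Squared `H²` norm on the sphere of radius `r`. -/
def H2sq (g : E3 → ℝ) (r : ℝ) : ℝ := H1sq g r + sphInt r (fun x => (r ^ 4)⁻¹ * angsq2 g x)

/-- The class `Q_γ(R,T)`. -/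
def memQ (R T γ : ℝ) (q : E3 → ℝ) : Prop :=
  ∀ r ∈ Icc R ((R + T) / 2),
    Real.sqrt (H2sq (pfun q) r) + Real.sqrt (H1sq (pdr (pfun q)) r) ≤
      γ * (Real.sqrt (H1sq (pfun q) r) + Real.sqrt (L2sq (pdr (pfun q)) r))

/-- The closed annulus `R ≤ |x| ≤ ρ` in `ℝ³`. -/
def Ann (R ρ : ℝ) : Set E3 := {x | R ≤ ‖x‖ ∧ ‖x‖ ≤ ρ}

/-- The space-time region `K_ρ = {R ≤ |x| ≤ ρ, |x| ≤ t ≤ R+T−|x|}`. -/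
def Kreg (R T ρ : ℝ) : Set (E3 × ℝ) :=
  {p | R ≤ ‖p.1‖ ∧ ‖p.1‖ ≤ ρ ∧ ‖p.1‖ ≤ p.2 ∧ p.2 ≤ R + T - ‖p.1‖}

/-- `F = ∂_t²w − ∂_r∂_r w − |x|^{-2} Ω w`. -/
def Fop (w : E3 × ℝ → ℝ) (p : E3 × ℝ) : ℝ :=
  pdt (pdt w) p - pdrX (pdrX w) p - (‖p.1‖ ^ 2)⁻¹ * angLapX w p

/-- The sideways energy `J(ρ)`. -/
def Jfun (R T : ℝ) (w : E3 × ℝ → ℝ) (ρ : ℝ) : ℝ :=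
  ∫ t in ρ..(R + T - ρ), sphInt ρ
    (fun x => (ρ ^ 2)⁻¹ * ((w (x, t)) ^ 2 + (pdt w (x, t)) ^ 2 + gradsqX w (x, t)))

open Filter Topology

/-- The unit sphere of `ℝ³`. -/
abbrev S2 : Type := sphere (0 : E3) 1

/-- The two-dimensional Hausdorff measure on the unit sphere. -/
abbrev sph : Measure S2 := μH[2]

/-- The point of `ℝ³` with coordinate `i` equal to `c` and the two others `a`, `b`,
in cyclic order. -/
def insertCoord (i : Fin 3) (c a b : ℝ) : E3 :=
  c • basis3 i + a • basis3 (i + 1) + b • basis3 (i + 2)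

lemma insertCoord_self (i : Fin 3) (x : E3) : insertCoord i (x i) (x (i + 1)) (x (i + 2)) = x := by
  ext l
  fin_cases i <;> fin_cases l <;> simp [insertCoord, basis3]

lemma norm_insertCoord_sq (i : Fin 3) (c a b : ℝ) :
    ‖insertCoord i c a b‖ ^ 2 = c ^ 2 + a ^ 2 + b ^ 2 := by
  rw [EuclideanSpace.norm_sq_eq, Fin.sum_univ_three]
  fin_cases i <;> simp [insertCoord, basis3] <;> ring

lemma contDiff_insertCoord (i : Fin 3) (c : ℝ) :
    ContDiff ℝ 1 (fun p : ℝ × ℝ => insertCoord i c p.1 p.2) := by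
  unfold insertCoord
  fun_prop

lemma norm_S2 (ω : S2) : ‖(ω : E3)‖ = 1 := by simp

lemma hausdorff_sphere_lt_top : μH[2] (sphere (0 : E3) 1) < ⊤ := by
  set Q : Set (ℝ × ℝ) := Icc (-1) 1 ×ˢ Icc (-1) 1 with hQ
  have hQc : IsCompact Q := isCompact_Icc.prod isCompact_Icc
  set φ : Fin 3 → ℝ → ℝ × ℝ → E3 := fun i c p =>
    (‖insertCoord i c p.1 p.2‖)⁻¹ • insertCoord i c p.1 p.2 with hφ
  have key : ∀ i : Fin 3, ∀ c : ℝ, c ≠ 0 → μH[2] (φ i c '' Q) < ⊤ := by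
    intro i c hc
    have hne : ∀ p : ℝ × ℝ, insertCoord i c p.1 p.2 ≠ 0 := by
      intro p hp
      have := norm_insertCoord_sq i c p.1 p.2
      rw [hp] at this
      simp at this
      nlinarith [sq_nonneg p.1, sq_nonneg p.2, sq_pos_of_ne_zero hc]
    have hcd : ContDiff ℝ 1 (φ i c) := by
      have h1 := contDiff_insertCoord i c
      exact ((h1.norm ℝ hne).inv (fun p => norm_ne_zero_iff.2 (hne p))).smul h1
    obtain ⟨K, hK⟩ :=
      (hcd.locallyLipschitz.locallyLipschitzOn (s := Q)).exists_lipschitzOnWith_of_compact hQc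
    refine (hK.hausdorffMeasure_image_le (by norm_num : (0:ℝ) ≤ 2)).trans_lt ?_
    rw [hausdorffMeasure_prod_real]
    exact ENNReal.mul_lt_top (by simp) hQc.measure_lt_top
  have hsub : sphere (0 : E3) 1 ⊆ ⋃ i : Fin 3, (φ i 1 '' Q ∪ φ i (-1) '' Q) := by
    intro x hx
    have hx1 : ‖x‖ = 1 := by simpa using hx
    obtain ⟨i, -, hi⟩ := Finset.exists_max_image Finset.univ (fun i => |x i|) ⟨0, Finset.mem_univ _⟩
    have hi0 : 0 < |x i| := by
      rcases (abs_nonneg (x i)).lt_or_eq with h | h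
      · exact h
      · exfalso
        have : x = 0 := by
          ext l
          have := hi l (Finset.mem_univ _)
          simp only [← h] at this
          simpa using this
        simp [this] at hx1
    have hle : ∀ l, x l / |x i| ∈ Icc (-1:ℝ) 1 := by
      intro l
      rw [mem_Icc, ← abs_le, abs_div, abs_abs, div_le_one hi0]
      exact hi l (Finset.mem_univ _)
    have hins : ∀ c, c = x i / |x i| →
        φ i c (x (i+1) / |x i|, x (i+2) / |x i|) = x := by
      intro c hc
      have h1 : insertCoord i c (x (i+1) / |x i|) (x (i+2) / |x i|) = |x i|⁻¹ • x := by
        have h2 := congrArg (fun y => |x i|⁻¹ • y) (insertCoord_self i x)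
        rw [← h2]
        simp only [insertCoord, smul_add, smul_smul, hc, div_eq_inv_mul]
      simp only [hφ, h1, norm_smul, hx1, smul_smul]
      simp [hi0.ne']
    refine mem_iUnion.2 ⟨i, ?_⟩
    rcases abs_choice (x i) with h | h
    · left
      exact ⟨_, ⟨hle _, hle _⟩, hins 1 (by rw [h, div_self]; rw [← h]; exact hi0.ne')⟩
    · right
      refine ⟨_, ⟨hle _, hle _⟩, hins (-1) ?_⟩
      have h0 : x i ≠ 0 := abs_pos.1 hi0
      rw [h]; field_simp
  refine (measure_mono hsub).trans_lt ((measure_iUnion_le _).trans_lt ?_)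
  rw [tsum_fintype]
  refine ENNReal.sum_lt_top.2 fun i _ => (measure_union_le _ _).trans_lt ?_
  exact ENNReal.add_lt_top.2 ⟨key i 1 one_ne_zero, key i (-1) (by norm_num)⟩

lemma sph_apply (s : Set S2) : sph s = μH[2] ((↑) '' s : Set E3) :=
  (isometry_subtype_coe.hausdorffMeasure_image (Or.inl zero_le_two) s).symm

instance : IsFiniteMeasure sph := ⟨by
  rw [sph_apply, image_univ, Subtype.range_coe]
  exact hausdorff_sphere_lt_top⟩

instance : sph.IsOpenPosMeasure := ⟨by
  rintro U hU ⟨ω, hω⟩ h0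
  obtain ⟨i, hi⟩ : ∃ i, (ω : E3) i ≠ 0 := by
    by_contra! h
    have : (ω : E3) = 0 := by ext l; simpa using h l
    have h1 := norm_S2 ω
    simp [this] at h1
  set x : E3 := (ω : E3) with hx
  have hx1 : x i ^ 2 + x (i+1) ^ 2 + x (i+2) ^ 2 = 1 := by
    rw [← norm_insertCoord_sq i, insertCoord_self, hx, norm_S2 ω, one_pow]
  obtain ⟨V, hV, rfl⟩ := isOpen_induced_iff.1 hU
  set s : ℝ := ((SignType.sign (x i) : SignType) : ℝ)
  have hs : s * |x i| = x i := by simp [s]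
  have hs2 : s ^ 2 = 1 := by
    rcases hi.lt_or_gt with h | h
    · simp [s, h]
    · simp [s, h]
  set ψ : ℝ × ℝ → E3 := fun p => insertCoord i (s * √(1 - p.1 ^ 2 - p.2 ^ 2)) p.1 p.2 with hψ
  have hψc : Continuous ψ := by
    simp only [hψ, insertCoord]
    fun_prop
  set W : Set (ℝ × ℝ) := ψ ⁻¹' V ∩ {p | 0 < 1 - p.1 ^ 2 - p.2 ^ 2}
  have hWo : IsOpen W := (hV.preimage hψc).inter (isOpen_lt continuous_const (by fun_prop))
  have hx2 : 1 - x (i+1) ^ 2 - x (i+2) ^ 2 = x i ^ 2 := by linarith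
  have hWne : W.Nonempty := by
    refine ⟨(x (i+1), x (i+2)), ?_, ?_⟩
    · have : ψ (x (i+1), x (i+2)) = x := by
        simp only [hψ, hx2, sqrt_sq_eq_abs, hs, insertCoord_self]
      simpa [this] using hω
    · simp only [mem_ofPred_eq, hx2]; positivity
  set π' : E3 → ℝ × ℝ := fun y => (y (i+1), y (i+2)) with hπ'
  have hπl : LipschitzWith 1 π' := by
    refine LipschitzWith.of_dist_le_mul fun y z => ?_
    simp only [NNReal.coe_one, one_mul, hπ', Prod.dist_eq, max_le_iff]
    exact ⟨by simpa [Real.dist_eq, dist_eq_norm] using PiLp.norm_apply_le (y - z) (i+1),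
      by simpa [Real.dist_eq, dist_eq_norm] using PiLp.norm_apply_le (y - z) (i+2)⟩
  have hsub : W ⊆ π' '' ((↑) '' ((↑) ⁻¹' V : Set S2)) := by
    rintro p ⟨hp1, hp2⟩
    have hn : ‖ψ p‖ = 1 := by
      rw [← sq_eq_sq₀ (norm_nonneg _) zero_le_one, hψ, norm_insertCoord_sq, mul_pow,
        sq_sqrt (le_of_lt hp2), hs2]
      ring
    refine ⟨ψ p, ⟨⟨ψ p, by simpa using hn⟩, hp1, rfl⟩, ?_⟩
    simp only [hπ', hψ, insertCoord]
    fin_cases i <;> simp [basis3]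
  have h1 := (hπl.hausdorffMeasure_image_le zero_le_two ((↑) '' ((↑) ⁻¹' V : Set S2)))
  rw [← sph_apply, h0, mul_zero] at h1
  have h2 : μH[2] W = 0 := le_antisymm ((measure_mono hsub).trans h1) bot_le
  rw [hausdorffMeasure_prod_real] at h2
  exact hWo.measure_ne_zero volume hWne h2⟩

/-- The action of a linear isometry on the unit sphere. -/
def sphMap (L : E3 ≃ₗᵢ[ℝ] E3) : S2 ≃ᵢ S2 where
  toFun ω := ⟨L ω, by simp⟩
  invFun ω := ⟨L.symm ω, by simp⟩
  left_inv ω := by simp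
  right_inv ω := by simp
  isometry_toFun := fun a b => by simp [Subtype.edist_eq]

lemma integral_sphMap (L : E3 ≃ₗᵢ[ℝ] E3) (f : S2 → ℝ) :
    ∫ ω, f (sphMap L ω) ∂sph = ∫ ω, f ω ∂sph :=
  ((sphMap L).measurePreserving_hausdorffMeasure 2).integral_comp
    (sphMap L).toHomeomorph.measurableEmbedding f

lemma restrict_hausdorff_sphere {r : ℝ} (hr : 0 < r) :
    (μH[2] : Measure E3).restrict (sphere 0 r) =
      (‖r‖₊ ^ (2:ℝ)) • Measure.map (fun ω : S2 => r • (ω : E3)) sph := by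
  have hm : Measurable (fun ω : S2 => r • (ω : E3)) := by fun_prop
  ext s hs
  rw [Measure.restrict_apply hs, Measure.smul_apply, Measure.map_apply hm hs, sph_apply,
    ← Measure.hausdorffMeasure_smul₀ zero_le_two hr.ne']
  congr 1
  ext y
  simp only [mem_inter_iff, mem_sphere_iff_norm, sub_zero, mem_smul_set, mem_image, mem_preimage]
  constructor
  · rintro ⟨h1, h2⟩
    have hy : r • (r⁻¹ • y) = y := by rw [smul_smul, mul_inv_cancel₀ hr.ne', one_smul]
    refine ⟨r⁻¹ • y, ⟨⟨r⁻¹ • y, ?_⟩, ?_, rfl⟩, hy⟩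
    · simp [norm_smul, h2, abs_of_pos hr, hr.ne']
    · simpa only [hy] using h1
  · rintro ⟨_, ⟨ω, hω, rfl⟩, rfl⟩
    exact ⟨hω, by simp [norm_smul, abs_of_pos hr, (norm_S2 ω)]⟩

lemma sphInt_eq {r : ℝ} (hr : 0 < r) (g : E3 → ℝ) :
    sphInt r g = r ^ 2 * ∫ ω : S2, g (r • (ω : E3)) ∂sph := by
  have he : MeasurableEmbedding (fun ω : S2 => r • (ω : E3)) := by
    have h1 : MeasurableEmbedding (fun x : E3 => r • x) :=
      (Homeomorph.smulOfNeZero r hr.ne').measurableEmbedding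
    exact h1.comp (MeasurableEmbedding.subtype_coe (isClosed_sphere.measurableSet))
  rw [sphInt, restrict_hausdorff_sphere hr, integral_smul_nnreal_measure, he.integral_map]
  simp [NNReal.smul_def, abs_of_pos hr]

/-- The smaller index of the `k`-th coordinate plane of `ℝ³`. -/
def planeFst : Fin 3 → Fin 3 := ![0, 0, 1]

/-- The larger index of the `k`-th coordinate plane of `ℝ³`. -/
def planeSnd : Fin 3 → Fin 3 := ![1, 2, 2]

/-- The infinitesimal generator of the rotations in the `k`-th coordinate plane. -/
def gen (k : Fin 3) : E3 →L[ℝ] E3 :=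
  (EuclideanSpace.proj (planeFst k)).smulRight (basis3 (planeSnd k)) -
    (EuclideanSpace.proj (planeSnd k)).smulRight (basis3 (planeFst k))

lemma gen_apply (k : Fin 3) (x : E3) :
    gen k x = x (planeFst k) • basis3 (planeSnd k) - x (planeSnd k) • basis3 (planeFst k) := rfl

lemma gen_cube (k : Fin 3) (x : E3) : gen k (gen k (gen k x)) = -gen k x := by
  ext l
  fin_cases k <;> fin_cases l <;> simp [gen_apply, basis3, planeFst, planeSnd]

lemma inner_gen_self (k : Fin 3) (x : E3) : inner ℝ x (gen k x) = 0 := by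
  simp only [PiLp.inner_apply, Fin.sum_univ_three]
  fin_cases k <;> simp [gen_apply, basis3, planeFst, planeSnd] <;> ring

lemma sum_gen_gen (x : E3) : ∑ k, gen k (gen k x) = (-2 : ℝ) • x := by
  rw [Fin.sum_univ_three]
  ext l
  fin_cases l <;> simp [gen_apply, basis3, planeFst, planeSnd] <;> ring

lemma basis3_apply (i j : Fin 3) : basis3 i j = if j = i then 1 else 0 := by
  simp [basis3]

lemma sum_basis3 (x : E3) : x = ∑ i, x i • basis3 i := by
  rw [Fin.sum_univ_three]
  ext l
  fin_cases l <;> simp [basis3]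

lemma sum_bilin_gen (B : E3 →L[ℝ] E3 →L[ℝ] ℝ) (x : E3) :
    ∑ k, B (gen k x) (gen k x) + B x x = ‖x‖ ^ 2 * ∑ i, B (basis3 i) (basis3 i) := by
  have hx : B x x = B (∑ i, x i • basis3 i) (∑ i, x i • basis3 i) := by rw [← sum_basis3]
  rw [hx, EuclideanSpace.norm_sq_eq]
  simp only [Fin.sum_univ_three, gen_apply, planeFst, planeSnd, map_add, map_sub, map_smul,
    add_apply, sub_apply, smul_apply, smul_eq_mul, Matrix.cons_val_zero,
    Matrix.cons_val_one, Matrix.cons_val, Real.norm_eq_abs, sq_abs]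
  ring

/-- The rotation of angle `θ` in the `k`-th coordinate plane. -/
def rot (k : Fin 3) (θ : ℝ) : E3 →L[ℝ] E3 :=
  ContinuousLinearMap.id ℝ E3 + sin θ • gen k + (1 - cos θ) • (gen k).comp (gen k)

lemma rot_apply (k : Fin 3) (θ : ℝ) (x : E3) :
    rot k θ x = x + sin θ • gen k x + (1 - cos θ) • gen k (gen k x) := rfl

lemma rot_zero (k : Fin 3) (x : E3) : rot k 0 x = x := by simp [rot_apply]

lemma rot_gen (k : Fin 3) (θ : ℝ) (x : E3) : rot k θ (gen k x) = gen k (rot k θ x) := by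
  simp [rot_apply]

lemma hasDerivAt_rot (k : Fin 3) (θ : ℝ) (x : E3) :
    HasDerivAt (fun θ => rot k θ x) (gen k (rot k θ x)) θ := by
  simp only [rot_apply]
  have h1 := ((hasDerivAt_sin θ).smul_const (gen k x)).const_add x
  have h2 := ((hasDerivAt_cos θ).const_sub 1).smul_const (gen k (gen k x))
  refine (h1.add h2).congr_deriv ?_
  simp only [map_add, map_smul, gen_cube]
  module

lemma norm_rot (k : Fin 3) (θ : ℝ) (x : E3) : ‖rot k θ x‖ = ‖x‖ := by
  rw [← sq_eq_sq₀ (norm_nonneg _) (norm_nonneg _)]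
  simp only [EuclideanSpace.norm_sq_eq, Fin.sum_univ_three, Real.norm_eq_abs, sq_abs]
  have h := sin_sq_add_cos_sq θ
  fin_cases k <;> simp [rot_apply, gen_apply, basis3, planeFst, planeSnd]
  · linear_combination (x 0 ^ 2 + x 1 ^ 2) * h
  · linear_combination (x 0 ^ 2 + x 2 ^ 2) * h
  · linear_combination (x 1 ^ 2 + x 2 ^ 2) * h

/-- The rotation of angle `θ` in the `k`-th coordinate plane as a linear isometry. -/
def rotIso (k : Fin 3) (θ : ℝ) : E3 ≃ₗᵢ[ℝ] E3 :=
  LinearIsometry.toLinearIsometryEquiv ⟨(rot k θ).toLinearMap, norm_rot k θ⟩ rfl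

lemma coe_sphMap_rotIso (k : Fin 3) (θ : ℝ) (ω : S2) :
    (sphMap (rotIso k θ) ω : E3) = rot k θ ω := rfl

lemma continuous_rot (k : Fin 3) : Continuous (fun p : ℝ × E3 => rot k p.1 p.2) := by
  simp only [rot_apply]
  fun_prop

lemma sum_bilin_rot (B : E3 →L[ℝ] E3 →L[ℝ] ℝ) (k : Fin 3) (θ : ℝ) :
    ∑ i, B (rot k θ (basis3 i)) (rot k θ (basis3 i)) = ∑ i, B (basis3 i) (basis3 i) := by
  have h := sin_sq_add_cos_sq θ
  simp only [Fin.sum_univ_three]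
  fin_cases k <;>
  simp only [rot_apply, gen_apply, planeFst, planeSnd, map_add, map_sub, map_smul,
    add_apply, sub_apply, smul_apply, smul_eq_mul, Matrix.cons_val_zero,
    Matrix.cons_val_one, Matrix.cons_val, Fin.zero_eta, Fin.mk_one, Fin.reduceFinMk] <;>
  simp [basis3_apply]
  · linear_combination (B (basis3 0) (basis3 0) + B (basis3 1) (basis3 1)) * h
  · linear_combination (B (basis3 0) (basis3 0) + B (basis3 2) (basis3 2)) * h
  · linear_combination (B (basis3 1) (basis3 1) + B (basis3 2) (basis3 2)) * h

lemma ang_plane (k : Fin 3) (f : E3 → ℝ) (x : E3) :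
    ang (planeFst k) (planeSnd k) f x = fderiv ℝ f x (gen k x) := by
  simp [ang, pd, gen_apply]

lemma angsq_eq (f : E3 → ℝ) (x : E3) :
    angsq f x = ∑ k, (ang (planeFst k) (planeSnd k) f x) ^ 2 := by
  simp [angsq, Fin.sum_univ_three, planeFst, planeSnd]

lemma angsq2_eq (f : E3 → ℝ) (x : E3) :
    angsq2 f x = ∑ k, ∑ l,
      (ang (planeFst l) (planeSnd l) (ang (planeFst k) (planeSnd k) f) x) ^ 2 := by
  simp [angsq2, Fin.sum_univ_three, planeFst, planeSnd]

/-- The triangle `R ≤ r ≤ a ≤ ρ` in the plane of pairs `(r, a)`. -/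
def tri (R ρ : ℝ) : Set (ℝ × ℝ) := {p | R ≤ p.1 ∧ p.1 ≤ p.2 ∧ p.2 ≤ ρ}

/-- A retraction of the plane onto the triangle `tri R ρ`. -/
def triRetract (R ρ : ℝ) (p : ℝ × ℝ) : ℝ × ℝ :=
  (max R (min p.1 (max R (min p.2 ρ))), max R (min p.2 ρ))

lemma continuous_triRetract (R ρ : ℝ) : Continuous (triRetract R ρ) := by
  unfold triRetract
  fun_prop

lemma triRetract_mem {R ρ : ℝ} (h : R ≤ ρ) (p : ℝ × ℝ) : triRetract R ρ p ∈ tri R ρ := by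
  simp only [tri, triRetract, mem_ofPred_eq]
  exact ⟨le_max_left _ _, max_le (le_max_left _ _) (min_le_right _ _), max_le h (min_le_right _ _)⟩

lemma triRetract_eq {R ρ : ℝ} {p : ℝ × ℝ} (hp : p ∈ tri R ρ) : triRetract R ρ p = p := by
  obtain ⟨h1, h2, h3⟩ := hp
  have : max R (min p.2 ρ) = p.2 := by rw [min_eq_left h3, max_eq_right (h1.trans h2)]
  ext
  · simp only [triRetract, this, min_eq_left h2, max_eq_right h1]
  · exact this

lemma exists_continuous_eqOn_tri {X : Type*} [TopologicalSpace X] {R ρ : ℝ} (h : R ≤ ρ)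
    {k : X → ℝ → ℝ → ℝ}
    (hk : ContinuousOn (fun x : X × ℝ × ℝ => k x.1 x.2.1 x.2.2) (univ ×ˢ tri R ρ)) :
    ∃ k' : X → ℝ → ℝ → ℝ, Continuous (fun x : X × ℝ × ℝ => k' x.1 x.2.1 x.2.2) ∧
      ∀ ω r a, R ≤ r → r ≤ a → a ≤ ρ → k' ω r a = k ω r a := by
  refine ⟨fun ω r a => k ω (triRetract R ρ (r, a)).1 (triRetract R ρ (r, a)).2, ?_, ?_⟩
  · have hc : Continuous (fun x : X × ℝ × ℝ => (x.1, triRetract R ρ x.2)) :=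
      continuous_fst.prodMk ((continuous_triRetract R ρ).comp continuous_snd)
    exact hk.comp_continuous hc fun x => ⟨mem_univ _, triRetract_mem h _⟩
  · intro ω r a h1 h2 h3
    have := triRetract_eq (p := (r, a)) ⟨h1, h2, h3⟩
    simp only [this]

lemma exists_continuous_eqOn_Icc {X : Type*} [TopologicalSpace X] {R ρ : ℝ} (h : R ≤ ρ)
    {k : X → ℝ → ℝ}
    (hk : ContinuousOn (fun x : X × ℝ => k x.1 x.2) (univ ×ˢ Icc R ρ)) :
    ∃ k' : X → ℝ → ℝ, Continuous (fun x : X × ℝ => k' x.1 x.2) ∧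
      ∀ ω r, R ≤ r → r ≤ ρ → k' ω r = k ω r := by
  refine ⟨fun ω r => k ω (projIcc R ρ h r), ?_, ?_⟩
  · have hc : Continuous (fun x : X × ℝ => (x.1, (projIcc R ρ h x.2 : ℝ))) := by fun_prop
    exact hk.comp_continuous hc fun x => ⟨mem_univ _, (projIcc R ρ h x.2).2⟩
  · intro ω r h1 h2
    simp only [projIcc_of_mem h ⟨h1, h2⟩]

lemma intervalIntegral_triangle_swap {k : ℝ → ℝ → ℝ} (hk : Continuous (fun p : ℝ × ℝ => k p.1 p.2))
    {R ρ : ℝ} (h : R ≤ ρ) :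
    ∫ r in R..ρ, ∫ a in r..ρ, k r a = ∫ a in R..ρ, ∫ r in R..a, k r a := by
  set f : ℝ → ℝ → ℝ := fun r a => (Ioi r).indicator (k r) a with hf
  have h1 : ∫ r in R..ρ, ∫ a in r..ρ, k r a = ∫ r in Ioc R ρ, ∫ a in Ioc R ρ, f r a := by
    rw [intervalIntegral.integral_of_le h]
    refine setIntegral_congr_fun measurableSet_Ioc fun r hr => ?_
    simp only [hf]
    rw [intervalIntegral.integral_of_le hr.2, setIntegral_indicator measurableSet_Ioi]
    congr 2
    ext a
    simp only [mem_Ioc, mem_inter_iff, mem_Ioi]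
    exact ⟨fun h => ⟨⟨hr.1.trans h.1, h.2⟩, h.1⟩, fun h => ⟨h.2, h.1.2⟩⟩
  have h2 : ∫ a in R..ρ, ∫ r in R..a, k r a = ∫ a in Ioc R ρ, ∫ r in Ioc R ρ, f r a := by
    rw [intervalIntegral.integral_of_le h]
    refine setIntegral_congr_fun measurableSet_Ioc fun a ha => ?_
    have : ∀ r, f r a = (Iio a).indicator (fun r => k r a) r := by
      intro r
      simp only [hf, indicator, mem_Ioi, mem_Iio]
    simp only [this]
    rw [intervalIntegral.integral_of_le ha.1.le, setIntegral_indicator measurableSet_Iio,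
      integral_Ioc_eq_integral_Ioo]
    congr 2
    ext r
    simp only [mem_Ioc, mem_inter_iff, mem_Iio, mem_Ioo]
    exact ⟨fun h => ⟨⟨h.1, h.2.le.trans ha.2⟩, h.2⟩, fun h => ⟨h.1.1, h.2⟩⟩
  rw [h1, h2]
  refine integral_integral_swap ?_
  have h3 : Function.uncurry f = {p : ℝ × ℝ | p.1 < p.2}.indicator (fun p => k p.1 p.2) := by
    ext p
    simp only [Function.uncurry, hf, indicator, mem_Ioi, mem_ofPred_eq]
  rw [h3, Measure.prod_restrict]
  refine Integrable.indicator ?_ (measurableSet_lt measurable_fst measurable_snd)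
  exact (hk.continuousOn.integrableOn_compact (isCompact_Icc.prod isCompact_Icc)).mono_set
    (prod_mono Ioc_subset_Icc_self Ioc_subset_Icc_self)

lemma integral_sph_intervalIntegral_swap {k : S2 → ℝ → ℝ}
    (hk : Continuous (fun p : S2 × ℝ => k p.1 p.2)) (a b : ℝ) :
    ∫ ω, (∫ r in a..b, k ω r) ∂sph = ∫ r in a..b, (∫ ω, k ω r ∂sph) := by
  refine (intervalIntegral_integral_swap (f := fun r ω => k ω r) ?_).symm
  have h1 : (volume.restrict (uIoc a b)).prod sph =
      ((volume : Measure ℝ).prod sph).restrict (uIoc a b ×ˢ univ) := by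
    rw [← Measure.prod_restrict, Measure.restrict_univ]
  rw [h1]
  have h2 : Continuous (Function.uncurry fun (r : ℝ) (ω : S2) => k ω r) :=
    hk.comp continuous_swap
  exact (h2.continuousOn.integrableOn_compact (isCompact_uIcc.prod isCompact_univ)).mono_set
    (prod_mono uIoc_subset_uIcc subset_rfl)

lemma continuous_integral_sph {X : Type*} [TopologicalSpace X] [FirstCountableTopology X]
    [LocallyCompactSpace X] {k : S2 → X → ℝ} (hk : Continuous (fun p : S2 × X => k p.1 p.2)) :
    Continuous (fun x => ∫ ω, k ω x ∂sph) := by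
  have h := continuous_parametric_integral_of_continuous (μ := sph) (f := fun x ω => k ω x)
    (hk.comp continuous_swap) (s := univ) isCompact_univ
  simpa using h

lemma integrable_sph {k : S2 → ℝ} (hk : Continuous k) : Integrable k sph := by
  simpa using hk.continuousOn.integrableOn_compact (μ := sph) isCompact_univ

/-- The integral form of `∂ₐ m - 2 ∂ᵣ n = s` on a triangle. -/
lemma integral_triangle_identity {m n ma nr : ℝ → ℝ → ℝ} {R ρ : ℝ} (h : R ≤ ρ)
    (hm : Continuous (fun p : ℝ × ℝ => m p.1 p.2)) (hn : Continuous (fun p : ℝ × ℝ => n p.1 p.2))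
    (hma : Continuous (fun p : ℝ × ℝ => ma p.1 p.2))
    (hnr : Continuous (fun p : ℝ × ℝ => nr p.1 p.2))
    (hdm : ∀ r a, R < r → r < a → a < ρ → HasDerivAt (m r) (ma r a) a)
    (hdn : ∀ r a, R < r → r < a → a < ρ → HasDerivAt (fun r => n r a) (nr r a) r) :
    ∫ r in R..ρ, m r ρ = (∫ r in R..ρ, (m r r + 2 * n r r)) - 2 * (∫ a in R..ρ, n R a) +
      ∫ a in R..ρ, ∫ r in R..a, (ma r a - 2 * nr r a) := by
  have i1 : ∫ r in R..ρ, (m r ρ - m r r) = ∫ r in R..ρ, ∫ a in r..ρ, ma r a := by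
    refine intervalIntegral.integral_congr_Ioo_of_le h fun r hr => ?_
    refine (intervalIntegral.integral_eq_sub_of_hasDerivAt_of_le hr.2.le ?_ ?_ ?_).symm
    · exact (by fun_prop : Continuous (m r)).continuousOn
    · exact fun a ha => hdm r a hr.1 ha.1 ha.2
    · exact (by fun_prop : Continuous (ma r)).intervalIntegrable _ _
  have i2 : ∫ a in R..ρ, (n a a - n R a) = ∫ a in R..ρ, ∫ r in R..a, nr r a := by
    refine intervalIntegral.integral_congr_Ioo_of_le h fun a ha => ?_
    refine (intervalIntegral.integral_eq_sub_of_hasDerivAt_of_le (f := fun r => n r a) ha.1.le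
      ?_ ?_ ?_).symm
    · exact (by fun_prop : Continuous (fun r => n r a)).continuousOn
    · exact fun r hr => hdn r a hr.1 hr.2 ha.2
    · exact (by fun_prop : Continuous (fun r => nr r a)).intervalIntegrable _ _
  rw [intervalIntegral_triangle_swap hma h, intervalIntegral.integral_sub
    ((by fun_prop : Continuous (fun r => m r ρ)).intervalIntegrable _ _)
    ((by fun_prop : Continuous (fun r => m r r)).intervalIntegrable _ _)] at i1
  rw [intervalIntegral.integral_sub
    ((by fun_prop : Continuous (fun r => n r r)).intervalIntegrable _ _)
    ((by fun_prop : Continuous (fun a => n R a)).intervalIntegrable _ _)] at i2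
  rw [intervalIntegral.integral_add
    ((by fun_prop : Continuous (fun r => m r r)).intervalIntegrable _ _)
    ((by fun_prop : Continuous (fun r => 2 * n r r)).intervalIntegrable _ _),
    intervalIntegral.integral_const_mul]
  have i3 : ∫ a in R..ρ, ∫ r in R..a, (ma r a - 2 * nr r a) =
      (∫ a in R..ρ, ∫ r in R..a, ma r a) - 2 * ∫ a in R..ρ, ∫ r in R..a, nr r a := by
    rw [← intervalIntegral.integral_const_mul, ← intervalIntegral.integral_sub]
    · refine intervalIntegral.integral_congr fun a _ => ?_
      rw [← intervalIntegral.integral_const_mul, ← intervalIntegral.integral_sub]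
      · exact (by fun_prop : Continuous (fun r => ma r a)).intervalIntegrable _ _
      · exact (by fun_prop : Continuous (fun r => 2 * nr r a)).intervalIntegrable _ _
    · refine Continuous.intervalIntegrable ?_ _ _
      exact intervalIntegral.continuous_parametric_intervalIntegral_of_continuous
        (f := fun a r => ma r a) (hma.comp continuous_swap) continuous_id
    · refine Continuous.intervalIntegrable ?_ _ _
      exact continuous_const.mul
        (intervalIntegral.continuous_parametric_intervalIntegral_of_continuous
        (f := fun a r => nr r a) (hnr.comp continuous_swap) continuous_id)
  rw [i3, ← i1, ← i2]
  ring

lemma continuous_intervalIntegral_sph {X : Type*} [TopologicalSpace X] [FirstCountableTopology X]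
    [LocallyCompactSpace X] {k : X → ℝ → S2 → ℝ}
    (hk : Continuous (fun p : X × ℝ × S2 => k p.1 p.2.1 p.2.2)) (a b : ℝ) :
    Continuous (fun x => ∫ r in a..b, ∫ ω, k x r ω ∂sph) := by
  refine intervalIntegral.continuous_parametric_intervalIntegral_of_continuous'
    (f := fun x r => ∫ ω, k x r ω ∂sph) ?_ a b
  exact continuous_integral_sph (k := fun ω (p : X × ℝ) => k p.1 p.2 ω)
    (hk.comp (by fun_prop : Continuous fun p : S2 × X × ℝ => (p.2.1, p.2.2, p.1)))

lemma sph_triangle_estimate {M N Ma Nr G D : S2 → ℝ → ℝ → ℝ} {R ρ : ℝ} (h : R ≤ ρ)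
    (hM : ContinuousOn (fun x : S2 × ℝ × ℝ => M x.1 x.2.1 x.2.2) (univ ×ˢ tri R ρ))
    (hN : ContinuousOn (fun x : S2 × ℝ × ℝ => N x.1 x.2.1 x.2.2) (univ ×ˢ tri R ρ))
    (hMa : ContinuousOn (fun x : S2 × ℝ × ℝ => Ma x.1 x.2.1 x.2.2) (univ ×ˢ tri R ρ))
    (hNr : ContinuousOn (fun x : S2 × ℝ × ℝ => Nr x.1 x.2.1 x.2.2) (univ ×ˢ tri R ρ))
    (hG : ContinuousOn (fun x : S2 × ℝ × ℝ => G x.1 x.2.1 x.2.2) (univ ×ˢ tri R ρ))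
    (hD : ContinuousOn (fun x : S2 × ℝ × ℝ => D x.1 x.2.1 x.2.2) (univ ×ˢ tri R ρ))
    (hdM : ∀ ω r a, R < r → r < a → a < ρ → HasDerivAt (M ω r) (Ma ω r a) a)
    (hdN : ∀ ω r a, R < r → r < a → a < ρ → HasDerivAt (fun r => N ω r a) (Nr ω r a) r)
    (h0 : ∀ ω a, R < a → a < ρ → N ω R a = 0)
    (hle : ∀ ω r a, R < r → r < a → a < ρ → Ma ω r a - 2 * Nr ω r a ≤ G ω r a + D ω r a)
    (hD0 : ∀ r a, R < r → r < a → a < ρ → ∫ ω, D ω r a ∂sph = 0) :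
    ∫ r in R..ρ, ∫ ω, M ω r ρ ∂sph ≤ (∫ r in R..ρ, ∫ ω, (M ω r r + 2 * N ω r r) ∂sph) +
      ∫ a in R..ρ, ∫ r in R..a, ∫ ω, G ω r a ∂sph := by
  obtain ⟨M', cM, eM⟩ := exists_continuous_eqOn_tri h hM
  obtain ⟨N', cN, eN⟩ := exists_continuous_eqOn_tri h hN
  obtain ⟨Ma', cMa, eMa⟩ := exists_continuous_eqOn_tri h hMa
  obtain ⟨Nr', cNr, eNr⟩ := exists_continuous_eqOn_tri h hNr
  obtain ⟨G', cG, eG⟩ := exists_continuous_eqOn_tri h hG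
  obtain ⟨D', cD, eD⟩ := exists_continuous_eqOn_tri h hD
  have key : ∀ ω : S2, ∫ r in R..ρ, M' ω r ρ = (∫ r in R..ρ, (M' ω r r + 2 * N' ω r r)) +
      ∫ a in R..ρ, ∫ r in R..a, (Ma' ω r a - 2 * Nr' ω r a) := by
    intro ω
    have hc : Continuous (fun p : ℝ × ℝ => (ω, p.1, p.2)) := by fun_prop
    have := integral_triangle_identity (m := M' ω) (n := N' ω) (ma := Ma' ω) (nr := Nr' ω) h
      (cM.comp hc) (cN.comp hc) (cMa.comp hc) (cNr.comp hc) ?_ ?_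
    · rw [this]
      have h2 : ∫ a in R..ρ, N' ω R a = ∫ a in R..ρ, (0:ℝ) := by
        refine intervalIntegral.integral_congr_Ioo_of_le h fun a ha => ?_
        rw [eN ω R a le_rfl ha.1.le ha.2.le, h0 ω a ha.1 ha.2]
      rw [h2]
      simp
    · intro r a h1 h2 h3
      rw [eMa ω r a h1.le h2.le h3.le]
      refine (hdM ω r a h1 h2 h3).congr_of_eventuallyEq ?_
      filter_upwards [Ioo_mem_nhds h2 h3] with b hb
      exact eM ω r b h1.le hb.1.le hb.2.le
    · intro r a h1 h2 h3
      rw [eNr ω r a h1.le h2.le h3.le]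
      refine (hdN ω r a h1 h2 h3).congr_of_eventuallyEq ?_
      filter_upwards [Ioo_mem_nhds h1 h2] with b hb
      exact eN ω b a hb.1.le hb.2.le h3.le
  set K : S2 → ℝ → ℝ → ℝ := fun ω r a => Ma' ω r a - 2 * Nr' ω r a with hK
  have cK : Continuous (fun x : S2 × ℝ × ℝ => K x.1 x.2.1 x.2.2) := by fun_prop
  have s1 : ∫ r in R..ρ, ∫ ω, M ω r ρ ∂sph = ∫ ω, (∫ r in R..ρ, M' ω r ρ) ∂sph := by
    rw [integral_sph_intervalIntegral_swap (k := fun ω r => M' ω r ρ) (by fun_prop)]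
    refine intervalIntegral.integral_congr_Ioo_of_le h fun r hr => ?_
    exact integral_congr_ae (.of_forall fun ω => (eM ω r ρ hr.1.le hr.2.le le_rfl).symm)
  have s2 : ∫ r in R..ρ, ∫ ω, (M ω r r + 2 * N ω r r) ∂sph =
      ∫ ω, (∫ r in R..ρ, (M' ω r r + 2 * N' ω r r)) ∂sph := by
    rw [integral_sph_intervalIntegral_swap (k := fun ω r => M' ω r r + 2 * N' ω r r) (by fun_prop)]
    refine intervalIntegral.integral_congr_Ioo_of_le h fun r hr => ?_
    refine integral_congr_ae (.of_forall fun ω => ?_)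
    simp only [eM ω r r hr.1.le le_rfl hr.2.le, eN ω r r hr.1.le le_rfl hr.2.le]
  have cK2 : Continuous (fun p : S2 × ℝ => ∫ r in R..p.2, K p.1 r p.2) :=
    intervalIntegral.continuous_parametric_intervalIntegral_of_continuous
      (f := fun (p : S2 × ℝ) r => K p.1 r p.2) (by fun_prop) continuous_snd
  have s3 : ∫ ω, (∫ a in R..ρ, ∫ r in R..a, K ω r a) ∂sph =
      ∫ a in R..ρ, ∫ r in R..a, ∫ ω, K ω r a ∂sph := by
    rw [integral_sph_intervalIntegral_swap (k := fun ω a => ∫ r in R..a, K ω r a) cK2]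
    refine intervalIntegral.integral_congr fun a _ => ?_
    exact integral_sph_intervalIntegral_swap (k := fun ω r => K ω r a) (by fun_prop) _ _
  have c1 : Continuous (fun ω : S2 => ∫ r in R..ρ, (M' ω r r + 2 * N' ω r r)) :=
    intervalIntegral.continuous_parametric_intervalIntegral_of_continuous'
      (f := fun (ω : S2) r => M' ω r r + 2 * N' ω r r) (by fun_prop) _ _
  have c2 : Continuous (fun ω : S2 => ∫ a in R..ρ, ∫ r in R..a, K ω r a) :=
    intervalIntegral.continuous_parametric_intervalIntegral_of_continuous'
      (f := fun (ω : S2) a => ∫ r in R..a, K ω r a) cK2 _ _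
  rw [s1, s2, integral_congr_ae (.of_forall key), integral_add (integrable_sph c1)
    (integrable_sph c2), s3]
  gcongr
  have cKs : Continuous (fun p : ℝ × ℝ => ∫ ω, K ω p.1 p.2 ∂sph) :=
    continuous_integral_sph (k := fun ω (p : ℝ × ℝ) => K ω p.1 p.2) (by fun_prop)
  have cGs : Continuous (fun p : ℝ × ℝ => ∫ ω, G' ω p.1 p.2 ∂sph) :=
    continuous_integral_sph (k := fun ω (p : ℝ × ℝ) => G' ω p.1 p.2) (by fun_prop)
  have s4 : ∫ a in R..ρ, ∫ r in R..a, ∫ ω, G ω r a ∂sph =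
      ∫ a in R..ρ, ∫ r in R..a, ∫ ω, G' ω r a ∂sph := by
    refine intervalIntegral.integral_congr_Ioo_of_le h fun a ha => ?_
    refine intervalIntegral.integral_congr_Ioo_of_le ha.1.le fun r hr => ?_
    exact integral_congr_ae (.of_forall fun ω => (eG ω r a hr.1.le hr.2.le ha.2.le).symm)
  rw [s4]
  refine intervalIntegral.integral_mono_on_of_le_Ioo h ?_ ?_ fun a ha => ?_
  · exact (intervalIntegral.continuous_parametric_intervalIntegral_of_continuous
      (f := fun a r => ∫ ω, K ω r a ∂sph) (cKs.comp continuous_swap)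
      continuous_id).intervalIntegrable _ _
  · exact (intervalIntegral.continuous_parametric_intervalIntegral_of_continuous
      (f := fun a r => ∫ ω, G' ω r a ∂sph) (cGs.comp continuous_swap)
      continuous_id).intervalIntegrable _ _
  refine intervalIntegral.integral_mono_on_of_le_Ioo ha.1.le ?_ ?_ fun r hr => ?_
  · exact (cKs.comp (by fun_prop : Continuous fun r : ℝ => (r, a))).intervalIntegrable _ _
  · exact (cGs.comp (by fun_prop : Continuous fun r : ℝ => (r, a))).intervalIntegrable _ _
  have iG : Integrable (fun ω => G' ω r a) sph := integrable_sph (by fun_prop)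
  have iD : Integrable (fun ω => D' ω r a) sph := integrable_sph (by fun_prop)
  have hD1 : ∫ ω, D' ω r a ∂sph = 0 := by
    rw [← hD0 r a hr.1 hr.2 ha.2]
    exact integral_congr_ae (.of_forall fun ω => eD ω r a hr.1.le hr.2.le ha.2.le)
  have : ∫ ω, G' ω r a ∂sph = ∫ ω, (G' ω r a + D' ω r a) ∂sph := by
    rw [integral_add iG iD, hD1, add_zero]
  rw [this]
  refine integral_mono (integrable_sph (by fun_prop)) (iG.add iD) fun ω => ?_
  simp only [hK, eMa ω r a hr.1.le hr.2.le ha.2.le, eNr ω r a hr.1.le hr.2.le ha.2.le,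
    eG ω r a hr.1.le hr.2.le ha.2.le, eD ω r a hr.1.le hr.2.le ha.2.le]
  exact hle ω r a hr.1 hr.2 ha.2

/-- The integral over the sphere of a derivative along rotations vanishes. -/
lemma integral_sph_rot_deriv {h h' : S2 → ℝ} (k : Fin 3) (hc : Continuous h)
    (hc' : Continuous h')
    (hd : ∀ (ω : S2) θ, HasDerivAt (fun θ => h (sphMap (rotIso k θ) ω))
      (h' (sphMap (rotIso k θ) ω)) θ) : ∫ ω, h' ω ∂sph = 0 := by
  have hs : Continuous (fun p : S2 × ℝ => sphMap (rotIso k p.2) p.1) := by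
    rw [continuous_induced_rng]
    change Continuous (fun p : S2 × ℝ => rot k p.2 (p.1 : E3))
    have hp : Continuous fun p : S2 × ℝ => (p.2, (p.1 : E3)) := by fun_prop
    have hr := (continuous_rot k).comp hp
    exact hr
  have h1 : ∀ ω : S2, ∫ θ in (0:ℝ)..1, h' (sphMap (rotIso k θ) ω) =
      h (sphMap (rotIso k 1) ω) - h (sphMap (rotIso k 0) ω) := by
    intro ω
    refine intervalIntegral.integral_eq_sub_of_hasDerivAt (fun θ _ => hd ω θ) ?_
    exact (hc'.comp (hs.comp (by fun_prop : Continuous fun θ : ℝ => (ω, θ)))).intervalIntegrable _ _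
  have h2 := integral_sph_intervalIntegral_swap (k := fun ω θ => h' (sphMap (rotIso k θ) ω))
    (hc'.comp hs) 0 1
  simp only [integral_sphMap] at h2
  rw [integral_congr_ae (.of_forall h1), integral_sub, integral_sphMap, integral_sphMap] at h2
  · simpa using h2.symm
  · exact integrable_sph (hc.comp (sphMap _).continuous)
  · exact integrable_sph (hc.comp (sphMap _).continuous)

lemma tendsto_integral_slope_sq {h h' : ℝ → ℝ → S2 → ℝ} {R ρ : ℝ} (hle : R ≤ ρ)
    (hc : ContinuousOn (fun x : ℝ × ℝ × S2 => h' x.1 x.2.1 x.2.2) (univ ×ˢ Icc R ρ ×ˢ univ))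
    (hd : ∀ θ ω, ∀ r ∈ Icc R ρ, HasDerivAt (fun θ => h θ r ω) (h' θ r ω) θ) :
    Tendsto (fun θ => ∫ r in R..ρ, ∫ ω, ((h θ r ω - h 0 r ω) / θ) ^ 2 ∂sph) (𝓝[≠] 0)
      (𝓝 (∫ r in R..ρ, ∫ ω, (h' 0 r ω) ^ 2 ∂sph)) := by
  set k : ℝ → ℝ → S2 → ℝ := fun θ r ω => h' θ (projIcc R ρ hle r) ω with hk
  have ck : Continuous (fun x : ℝ × ℝ × S2 => k x.1 x.2.1 x.2.2) :=
    hc.comp_continuous (f := fun x : ℝ × ℝ × S2 => (x.1, (projIcc R ρ hle x.2.1 : ℝ), x.2.2))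
      (by fun_prop) fun x => ⟨mem_univ _, (projIcc R ρ hle x.2.1).2, mem_univ _⟩
  have ek : ∀ θ ω, ∀ r ∈ Icc R ρ, k θ r ω = h' θ r ω := by
    intro θ ω r hr
    simp only [hk, projIcc_of_mem hle hr]
  set F : ℝ → ℝ → S2 → ℝ := fun θ r ω => ∫ s in (0:ℝ)..1, k (s * θ) r ω with hF
  have cF : Continuous (fun x : ℝ × ℝ × S2 => F x.1 x.2.1 x.2.2) :=
    intervalIntegral.continuous_parametric_intervalIntegral_of_continuous'
      (f := fun (x : ℝ × ℝ × S2) s => k (s * x.1) x.2.1 x.2.2) (by fun_prop) _ _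
  have eF : ∀ θ ω, ∀ r ∈ Icc R ρ, θ ≠ 0 → F θ r ω = (h θ r ω - h 0 r ω) / θ := by
    intro θ ω r hr hθ
    have h1 : ∀ s ∈ uIcc (0:ℝ) 1, HasDerivAt (fun s => h (s * θ) r ω / θ) (k (s * θ) r ω) s := by
      intro s _
      rw [ek _ _ _ hr]
      have := (hd (s * θ) ω r hr).comp s ((hasDerivAt_id s).mul_const θ)
      refine (this.div_const θ).congr_deriv ?_
      field_simp
    have h2 := intervalIntegral.integral_eq_sub_of_hasDerivAt h1
      ((by fun_prop : Continuous fun s => k (s * θ) r ω).intervalIntegrable _ _)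
    simp only [hF, h2]
    simp [sub_div]
  have cI : Continuous (fun θ => ∫ r in R..ρ, ∫ ω, (F θ r ω) ^ 2 ∂sph) :=
    continuous_intervalIntegral_sph (k := fun θ r ω => (F θ r ω) ^ 2) (by fun_prop) _ _
  have h0 : ∫ r in R..ρ, ∫ ω, (F 0 r ω) ^ 2 ∂sph = ∫ r in R..ρ, ∫ ω, (h' 0 r ω) ^ 2 ∂sph := by
    refine intervalIntegral.integral_congr_Ioo_of_le hle fun r hr => ?_
    refine integral_congr_ae (.of_forall fun ω => ?_)
    simp [hF, ek 0 ω r ⟨hr.1.le, hr.2.le⟩]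
  rw [← h0]
  refine ((cI.tendsto 0).mono_left nhdsWithin_le_nhds).congr' ?_
  filter_upwards [self_mem_nhdsWithin] with θ hθ
  refine intervalIntegral.integral_congr_Ioo_of_le hle fun r hr => ?_
  refine integral_congr_ae (.of_forall fun ω => ?_)
  simp only [eF θ ω r ⟨hr.1.le, hr.2.le⟩ hθ]

lemma eq_zero_of_le_integral {φ : ℝ → ℝ} {R b C : ℝ} (hC : 0 ≤ C)
    (hc : ContinuousOn φ (Icc R b)) (h0 : ∀ ρ ∈ Icc R b, 0 ≤ φ ρ)
    (hle : ∀ ρ ∈ Icc R b, φ ρ ≤ C * ∫ r in R..ρ, φ r) : ∀ ρ ∈ Icc R b, φ ρ = 0 := by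
  intro ρ hρ
  have hRb : R ≤ b := hρ.1.trans hρ.2
  obtain ⟨φ', cφ, eφ⟩ := exists_continuous_eqOn_Icc (X := Unit) (k := fun _ r => φ r) hRb
    (hc.comp continuousOn_snd fun x hx => hx.2)
  have cφ' : Continuous (φ' ()) := cφ.comp (by fun_prop : Continuous fun r : ℝ => ((), r))
  set Φ : ℝ → ℝ := fun ρ => ∫ r in R..ρ, φ' () r with hΦ
  have hd : ∀ x, HasDerivAt Φ (φ' () x) x := fun x => (cφ'.integral_hasStrictDerivAt R x).hasDerivAt
  have eΦ : ∀ x ∈ Icc R b, ∫ r in R..x, φ r = Φ x := by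
    intro x hx
    refine intervalIntegral.integral_congr_Ioo_of_le hx.1 fun r hr => ?_
    exact (eφ () r hr.1.le (hr.2.le.trans hx.2)).symm
  have hΦ0 : ∀ x ∈ Icc R b, 0 ≤ Φ x := by
    intro x hx
    rw [← eΦ x hx]
    exact intervalIntegral.integral_nonneg hx.1 fun r hr => h0 r ⟨hr.1, hr.2.trans hx.2⟩
  have := norm_le_gronwallBound_of_norm_deriv_right_le (f := Φ) (f' := φ' ()) (δ := 0) (K := C)
    (ε := 0) (a := R) (b := b)
    (continuous_iff_continuousAt.2 fun x => (hd x).continuousAt).continuousOn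
    (fun x _ => (hd x).hasDerivWithinAt) (by simp [hΦ]) (fun x hx => by
      have hx' : x ∈ Icc R b := ⟨hx.1, hx.2.le⟩
      rw [eφ () x hx'.1 hx'.2, Real.norm_of_nonneg (h0 x hx'), Real.norm_of_nonneg (hΦ0 x hx'),
        add_zero, ← eΦ x hx']
      exact hle x hx') ρ hρ
  rw [gronwallBound_ε0_δ0, Real.norm_of_nonneg (hΦ0 ρ hρ)] at this
  have h3 := hle ρ hρ
  rw [eΦ ρ hρ] at h3
  nlinarith [h0 ρ hρ, hΦ0 ρ hρ]

/-- A function `v` on the cone with first and second derivatives `g` and `H` that solves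
`∂_t² v - Δ v = c v + f` in the interior of the cone. -/
structure IsWaveJet (c f v : E3 × ℝ → ℝ) (g : E3 × ℝ → E3 × ℝ →L[ℝ] ℝ)
    (H : E3 × ℝ → E3 × ℝ →L[ℝ] E3 × ℝ →L[ℝ] ℝ) : Prop where
  cont_fun : ContinuousOn v cone
  cont_grad : ContinuousOn g cone
  cont_hess : ContinuousOn H cone
  hasGrad : ∀ z : E3 × ℝ, ‖z.1‖ < z.2 → HasFDerivAt v (g z) z
  hasHess : ∀ z : E3 × ℝ, ‖z.1‖ < z.2 → HasFDerivAt g (H z) z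
  symm : ∀ z : E3 × ℝ, ‖z.1‖ < z.2 → ∀ a b, H z a b = H z b a
  pde : ∀ z : E3 × ℝ, ‖z.1‖ < z.2 →
    H z (0, 1) (0, 1) - ∑ i, H z (basis3 i, 0) (basis3 i, 0) = c z * v z + f z

lemma hasDerivAt_weighted_energy {wt wr w τ : ℝ → ℝ} {y : Fin 3 → ℝ → ℝ}
    {wt' wr' w' τ' : ℝ} {y' : Fin 3 → ℝ} {x L : ℝ}
    (h1 : HasDerivAt wt wt' x) (h2 : HasDerivAt wr wr' x) (h3 : HasDerivAt w w' x)
    (h4 : ∀ k, HasDerivAt (y k) (y' k) x) (h5 : HasDerivAt τ τ' x) :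
    HasDerivAt (fun s => exp (-(L * τ s)) *
      (((wt s) ^ 2 + (wr s) ^ 2 + ∑ k, (y k s) ^ 2 + (w s) ^ 2) / 2 - wt s * wr s))
      (exp (-(L * τ x)) * (-(L * τ') *
        (((wt x) ^ 2 + (wr x) ^ 2 + ∑ k, (y k x) ^ 2 + (w x) ^ 2) / 2 - wt x * wr x) +
        (wt x * wt' + wr x * wr' + ∑ k, y k x * y' k + w x * w') -
        (wt' * wr x + wt x * wr'))) x := by
  simp only [Fin.sum_univ_three]
  have e := ((h5.const_mul L).fun_neg).exp
  have q := (((((h1.fun_pow 2).fun_add (h2.fun_pow 2)).fun_add ((((h4 0).fun_pow 2).fun_add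
    ((h4 1).fun_pow 2)).fun_add ((h4 2).fun_pow 2))).fun_add (h3.fun_pow 2)).div_const 2).fun_sub
    (h1.fun_mul h2)
  refine (e.fun_mul q).congr_deriv ?_
  push_cast
  ring

lemma hasDerivAt_weighted_flux {wt wr τ : ℝ → ℝ} {wt' wr' τ' x L : ℝ}
    (h1 : HasDerivAt wt wt' x) (h2 : HasDerivAt wr wr' x) (h5 : HasDerivAt τ τ' x) :
    HasDerivAt (fun s => exp (-(L * τ s)) * (wt s * wr s))
      (exp (-(L * τ x)) * (-(L * τ') * (wt x * wr x) + (wt' * wr x + wt x * wr'))) x := by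
  have e := ((h5.const_mul L).fun_neg).exp
  refine (e.fun_mul (h1.fun_mul h2)).congr_deriv ?_
  ring

lemma energy_density_le {r gT gN v c f Q HTT HNN HTN S : ℝ} {gA gAA HAA HTA : Fin 3 → ℝ}
    (hQ : |c| ≤ Q) (hgAA : ∑ k, gAA k = -2 * gN) (htr : ∑ k, HAA k + HNN = S)
    (hpde : HTT - S = c * v + f) :
    (-((Q + 2) * 2) * (((r * gT) ^ 2 + (v + r * gN) ^ 2 + ∑ k, (r * gA k) ^ 2 +
        (r * v) ^ 2) / 2 - (r * gT) * (v + r * gN)) +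
      ((r * gT) * (2 * (r * HTT)) + (v + r * gN) * (2 * gT + 2 * (r * HTN)) +
        ∑ k, (r * gA k) * (2 * (r * HTA k)) + (r * v) * (2 * (r * gT))) -
      (2 * (r * HTT) * (v + r * gN) + (r * gT) * (2 * gT + 2 * (r * HTN)))) -
    2 * (-((Q + 2) * (-1)) * ((r * gT) * (v + r * gN)) +
      ((gT + r * (HTN - HTT)) * (v + r * gN) +
        (r * gT) * (2 * gN - gT + r * (HNN - HTN)))) ≤
    (r * f) ^ 2 + 2 * ∑ k, r * (r * HTA k * gA k + gT * (r * HAA k + gAA k)) := by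
  obtain ⟨h1, h2⟩ := abs_le.1 hQ
  simp only [Fin.sum_univ_three] at *
  have key : 2 * (r * gT) * (c * (r * v) + r * f + r * v) ≤
      (Q + 2) * ((r * gT) ^ 2 + (r * v) ^ 2) + (r * f) ^ 2 := by
    nlinarith [mul_nonneg (sub_nonneg.2 h2) (sq_nonneg (r * gT + r * v)),
      mul_nonneg (by linarith : 0 ≤ c + Q) (sq_nonneg (r * gT - r * v)),
      sq_nonneg (r * gT - r * f), sq_nonneg (r * gT - r * v), abs_nonneg c]
  have hQ0 : 0 ≤ Q + 2 := by linarith [abs_nonneg c]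
  have hpos : 0 ≤ (Q + 2) * ((v + r * gN) ^ 2 +
    ((r * gA 0) ^ 2 + (r * gA 1) ^ 2 + (r * gA 2) ^ 2)) := by positivity
  have hN : HNN = S - (HAA 0 + HAA 1 + HAA 2) := by linarith
  have hT : HTT = c * v + f + S := by linarith
  have hg : gAA 0 = -2 * gN - gAA 1 - gAA 2 := by linarith
  rw [hN, hT, hg]
  linarith

lemma coneMap_mem {R ρ r a : ℝ} (hR : 0 < R) (h : (r, a) ∈ tri R ρ) (ω : S2) :
    ((r • (ω : E3), 2 * a - r) : E3 × ℝ) ∈ cone := by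
  obtain ⟨h1, h2, -⟩ := h
  change ‖r • (ω : E3)‖ ≤ 2 * a - r
  dsimp only at h1 h2
  rw [norm_smul, norm_S2, mul_one, Real.norm_of_nonneg (hR.le.trans h1)]
  linarith

lemma norm_smul_S2 {r : ℝ} (hr : 0 < r) (ω : S2) : ‖r • (ω : E3)‖ = r := by
  rw [norm_smul, norm_S2, mul_one, Real.norm_of_nonneg hr.le]

/-- Characteristic coordinates on the cone. -/
def coneMap (ω : S2) (r a : ℝ) : E3 × ℝ := (r • (ω : E3), 2 * a - r)

lemma continuous_coneMap : Continuous (fun x : S2 × ℝ × ℝ => coneMap x.1 x.2.1 x.2.2) := by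
  unfold coneMap
  fun_prop

lemma continuousOn_coneMap {R ρ : ℝ} (hR : 0 < R) {Y : Type*} [TopologicalSpace Y]
    {g : E3 × ℝ → Y} (hg : ContinuousOn g cone) :
    ContinuousOn (fun x : S2 × ℝ × ℝ => g (coneMap x.1 x.2.1 x.2.2)) (univ ×ˢ tri R ρ) :=
  hg.comp continuous_coneMap.continuousOn fun x hx => coneMap_mem hR hx.2 x.1

lemma coneMap_interior {R r a : ℝ} (hR : 0 < R) (h1 : R ≤ r) (h2 : r < a) (ω : S2) :
    ‖(coneMap ω r a).1‖ < (coneMap ω r a).2 := by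
  simp only [coneMap, norm_smul_S2 (hR.trans_le h1)]
  linarith

lemma hasDerivAt_coneMap_right (ω : S2) (r a : ℝ) :
    HasDerivAt (fun a => coneMap ω r a) ((2 : ℝ) • ((0, 1) : E3 × ℝ)) a := by
  have : (2 : ℝ) • ((0, 1) : E3 × ℝ) = (0, 2) := by simp
  rw [this]
  refine (hasDerivAt_const a _).prodMk ?_
  simpa using ((hasDerivAt_id a).const_mul 2).sub_const r

lemma hasDerivAt_coneMap_left (ω : S2) (r a : ℝ) :
    HasDerivAt (fun r => coneMap ω r a) (((ω : E3), (0:ℝ)) - ((0, 1) : E3 × ℝ)) r := by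
  have : ((ω : E3), (0:ℝ)) - ((0, 1) : E3 × ℝ) = ((ω : E3), -1) := by simp
  rw [this]
  refine HasDerivAt.prodMk ?_ ?_
  · simpa using (hasDerivAt_id r).smul_const (ω : E3)
  · simpa using (hasDerivAt_id r).const_sub (2 * a)

lemma hasDerivAt_coneMap_rot (ω : S2) (k : Fin 3) (r a θ : ℝ) :
    HasDerivAt (fun θ => coneMap (sphMap (rotIso k θ) ω) r a)
      (r • ((gen k (sphMap (rotIso k θ) ω), 0) : E3 × ℝ)) θ := by
  have h := ((hasDerivAt_rot k θ (ω : E3)).const_smul r).prodMk (hasDerivAt_const θ (2 * a - r))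
  have e : r • ((gen k (sphMap (rotIso k θ) ω), 0) : E3 × ℝ) =
    (r • gen k (rot k θ (ω : E3)), 0) := by simp [coe_sphMap_rotIso]
  rw [e]
  exact h

lemma hasDerivAt_gen_sphMap_rot (ω : S2) (k : Fin 3) (θ : ℝ) :
    HasDerivAt (fun θ => ((gen k (sphMap (rotIso k θ) ω), 0) : E3 × ℝ))
      (gen k (gen k (sphMap (rotIso k θ) ω)), 0) θ := by
  simp only [coe_sphMap_rotIso]
  have h1 := (gen k).hasFDerivAt.comp_hasDerivAt θ (hasDerivAt_rot k θ (ω : E3))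
  exact h1.prodMk (hasDerivAt_const θ (0:ℝ))

section
variable {c f v : E3 × ℝ → ℝ} {g : E3 × ℝ → E3 × ℝ →L[ℝ] ℝ}
  {H : E3 × ℝ → E3 × ℝ →L[ℝ] E3 × ℝ →L[ℝ] ℝ}

lemma IsWaveJet.hasDerivAt_fun (hj : IsWaveJet c f v g H) {z : ℝ → E3 × ℝ} {z' : E3 × ℝ} {x : ℝ}
    (hz : HasDerivAt z z' x) (hi : ‖(z x).1‖ < (z x).2) :
    HasDerivAt (fun x => v (z x)) (g (z x) z') x :=
  (hj.hasGrad _ hi).comp_hasDerivAt x hz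

lemma IsWaveJet.hasDerivAt_grad_apply (hj : IsWaveJet c f v g H) {z b : ℝ → E3 × ℝ}
    {z' b' : E3 × ℝ} {x : ℝ} (hz : HasDerivAt z z' x) (hi : ‖(z x).1‖ < (z x).2)
    (hb : HasDerivAt b b' x) :
    HasDerivAt (fun x => g (z x) (b x)) (H (z x) z' (b x) + g (z x) b') x :=
  ((hj.hasHess _ hi).comp_hasDerivAt x hz).clm_apply hb

lemma IsWaveJet.hasDerivAt_grad (hj : IsWaveJet c f v g H) {z : ℝ → E3 × ℝ} {z' : E3 × ℝ} {x : ℝ}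
    (hz : HasDerivAt z z' x) (hi : ‖(z x).1‖ < (z x).2) (b : E3 × ℝ) :
    HasDerivAt (fun x => g (z x) b) (H (z x) z' b) x := by
  simpa using hj.hasDerivAt_grad_apply hz hi (hasDerivAt_const x b)

lemma IsWaveJet.integral_div_eq_zero (hj : IsWaveJet c f v g H) {r a : ℝ} (hr : 0 < r)
    (h : r < a) (k : Fin 3) :
    Continuous (fun ω : S2 => r * H (coneMap ω r a) (gen k ω, 0) (0, 1) *
        g (coneMap ω r a) (gen k ω, 0) + g (coneMap ω r a) (0, 1) *
        (r * H (coneMap ω r a) (gen k ω, 0) (gen k ω, 0) +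
          g (coneMap ω r a) (gen k (gen k ω), 0))) ∧
      ∫ ω : S2, (r * H (coneMap ω r a) (gen k ω, 0) (0, 1) *
        g (coneMap ω r a) (gen k ω, 0) + g (coneMap ω r a) (0, 1) *
        (r * H (coneMap ω r a) (gen k ω, 0) (gen k ω, 0) +
          g (coneMap ω r a) (gen k (gen k ω), 0))) ∂sph = 0 := by
  have hi : ∀ ω, ‖(coneMap ω r a).1‖ < (coneMap ω r a).2 := coneMap_interior hr le_rfl h
  have cz : Continuous (fun ω : S2 => coneMap ω r a) :=
    continuous_coneMap.comp (by fun_prop : Continuous fun ω : S2 => (ω, r, a))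
  have cg : Continuous (fun ω : S2 => g (coneMap ω r a)) :=
    hj.cont_grad.comp_continuous cz fun ω => (hi ω).le
  have cH : Continuous (fun ω : S2 => H (coneMap ω r a)) :=
    hj.cont_hess.comp_continuous cz fun ω => (hi ω).le
  have bT : Continuous (fun _ : S2 => ((0, 1) : E3 × ℝ)) := continuous_const
  have bA : Continuous (fun ω : S2 => ((gen k ω, 0) : E3 × ℝ)) := by fun_prop
  have bAA : Continuous (fun ω : S2 => ((gen k (gen k ω), 0) : E3 × ℝ)) := by fun_prop
  have c1 : Continuous (fun ω : S2 => r * H (coneMap ω r a) (gen k ω, 0) (0, 1) *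
        g (coneMap ω r a) (gen k ω, 0) + g (coneMap ω r a) (0, 1) *
        (r * H (coneMap ω r a) (gen k ω, 0) (gen k ω, 0) +
          g (coneMap ω r a) (gen k (gen k ω), 0))) :=
    ((continuous_const.mul ((cH.clm_apply bA).clm_apply bT)).mul (cg.clm_apply bA)).add
      ((cg.clm_apply bT).mul ((continuous_const.mul ((cH.clm_apply bA).clm_apply bA)).add
        (cg.clm_apply bAA)))
  refine ⟨c1, integral_sph_rot_deriv (h := fun ω => g (coneMap ω r a) (0, 1) *
    g (coneMap ω r a) (gen k ω, 0)) k
    ((cg.clm_apply bT).mul (cg.clm_apply bA)) c1 fun ω θ => ?_⟩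
  have hz := hasDerivAt_coneMap_rot ω k r a θ
  have d1 := hj.hasDerivAt_grad hz (hi _) (0, 1)
  have d2 := hj.hasDerivAt_grad_apply hz (hi _) (hasDerivAt_gen_sphMap_rot ω k θ)
  refine (d1.mul d2).congr_deriv ?_
  simp only [map_smul, smul_apply, smul_eq_mul]

end

lemma intervalIntegral_sph_mono {f g : ℝ → S2 → ℝ} {R ρ : ℝ} (h : R ≤ ρ)
    (hf : ContinuousOn (fun x : ℝ × S2 => f x.1 x.2) (Icc R ρ ×ˢ univ))
    (hg : ContinuousOn (fun x : ℝ × S2 => g x.1 x.2) (Icc R ρ ×ˢ univ))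
    (hle : ∀ r ∈ Icc R ρ, ∀ ω, f r ω ≤ g r ω) :
    ∫ r in R..ρ, ∫ ω, f r ω ∂sph ≤ ∫ r in R..ρ, ∫ ω, g r ω ∂sph := by
  have key : ∀ {f : ℝ → S2 → ℝ}, ContinuousOn (fun x : ℝ × S2 => f x.1 x.2) (Icc R ρ ×ˢ univ) →
      IntervalIntegrable (fun r => ∫ ω, f r ω ∂sph) volume R ρ := by
    intro f hf
    refine ContinuousOn.intervalIntegrable ?_
    rw [uIcc_of_le h]
    exact continuousOn_integral_of_compact_support (μ := sph) (k := univ) isCompact_univ hf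
      (fun _ x _ hx => absurd (mem_univ x) hx)
  refine intervalIntegral.integral_mono_on h (key hf) (key hg) fun r hr => ?_
  have hc : ∀ {f : ℝ → S2 → ℝ}, ContinuousOn (fun x : ℝ × S2 => f x.1 x.2) (Icc R ρ ×ˢ univ) →
      Continuous (f r) := fun hf =>
    hf.comp_continuous (by fun_prop : Continuous fun ω : S2 => (r, ω)) fun ω => ⟨hr, mem_univ _⟩
  exact integral_mono (integrable_sph (hc hf)) (integrable_sph (hc hg)) (hle r hr)

lemma weighted_energy_estimate {V V' gT gT' gN gN' : ℝ → S2 → ℝ} {gA gA' : Fin 3 → ℝ → S2 → ℝ}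
    {R T Q ρ X : ℝ} (hρ : R ≤ ρ) (hρT : 2 * ρ ≤ R + T) (hR : 0 < R) (hQ : 0 ≤ Q)
    (cV : ContinuousOn (fun x : ℝ × S2 => V x.1 x.2) (Icc R ρ ×ˢ univ))
    (cV' : ContinuousOn (fun x : ℝ × S2 => V' x.1 x.2) (Icc R ρ ×ˢ univ))
    (cgT : ContinuousOn (fun x : ℝ × S2 => gT x.1 x.2) (Icc R ρ ×ˢ univ))
    (cgT' : ContinuousOn (fun x : ℝ × S2 => gT' x.1 x.2) (Icc R ρ ×ˢ univ))
    (cgN : ContinuousOn (fun x : ℝ × S2 => gN x.1 x.2) (Icc R ρ ×ˢ univ))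
    (cgN' : ContinuousOn (fun x : ℝ × S2 => gN' x.1 x.2) (Icc R ρ ×ˢ univ))
    (cgA : ∀ k, ContinuousOn (fun x : ℝ × S2 => gA k x.1 x.2) (Icc R ρ ×ˢ univ))
    (cgA' : ∀ k, ContinuousOn (fun x : ℝ × S2 => gA' k x.1 x.2) (Icc R ρ ×ˢ univ))
    (main : (∫ r in R..ρ, ∫ ω, exp (-((Q + 2) * (2 * ρ - r))) * (((r * gT r ω) ^ 2 +
      (V r ω + r * gN r ω) ^ 2 + ∑ k, (r * gA k r ω) ^ 2 + (r * V r ω) ^ 2) / 2 -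
      (r * gT r ω) * (V r ω + r * gN r ω)) ∂sph) ≤ (∫ r in R..ρ, ∫ ω,
      (exp (-((Q + 2) * (2 * r - r))) * (((r * gT' r ω) ^ 2 +
      (V' r ω + r * gN' r ω) ^ 2 + ∑ k, (r * gA' k r ω) ^ 2 + (r * V' r ω) ^ 2) / 2 -
      (r * gT' r ω) * (V' r ω + r * gN' r ω)) +
      2 * (exp (-((Q + 2) * (2 * r - r))) *
      ((r * gT' r ω) * (V' r ω + r * gN' r ω)))) ∂sph) + X) :
    exp (-((Q + 2) * T)) * (∫ r in R..ρ, ∫ ω : S2, ((r * V r ω) ^ 2 +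
        ∑ k, (r * gA k r ω) ^ 2) ∂sph) ≤
      (∫ r in R..ρ, ∫ ω : S2, ((V' r ω + r * (gN' r ω + gT' r ω)) ^ 2 +
        ∑ k, (r * gA' k r ω) ^ 2 + (r * V' r ω) ^ 2) ∂sph) + 2 * X := by
  have lower := (intervalIntegral_sph_mono (f := fun r ω => exp (-((Q + 2) * T)) / 2 *
      ((r * V r ω) ^ 2 + ∑ k, (r * gA k r ω) ^ 2)) (g := fun r ω =>
      exp (-((Q + 2) * (2 * ρ - r))) * (((r * gT r ω) ^ 2 +
      (V r ω + r * gN r ω) ^ 2 + ∑ k, (r * gA k r ω) ^ 2 + (r * V r ω) ^ 2) / 2 -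
      (r * gT r ω) * (V r ω + r * gN r ω))) hρ (by fun_prop) (by fun_prop) (by
    intro r hr ω
    have e1 : exp (-((Q + 2) * T)) ≤ exp (-((Q + 2) * (2 * ρ - r))) :=
      exp_le_exp.2 (neg_le_neg (mul_le_mul_of_nonneg_left (by linarith [hr.1]) (by linarith)))
    have hX : 0 ≤ (r * V r ω) ^ 2 + ∑ k, (r * gA k r ω) ^ 2 := by positivity
    have hY : ((r * V r ω) ^ 2 + ∑ k, (r * gA k r ω) ^ 2) / 2 ≤ ((r * gT r ω) ^ 2 +
      (V r ω + r * gN r ω) ^ 2 + ∑ k, (r * gA k r ω) ^ 2 + (r * V r ω) ^ 2) / 2 -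
      (r * gT r ω) * (V r ω + r * gN r ω) := by
      linarith [sq_nonneg (r * gT r ω - (V r ω + r * gN r ω))]
    calc _ = exp (-((Q + 2) * T)) *
          (((r * V r ω) ^ 2 + ∑ k, (r * gA k r ω) ^ 2) / 2) := by ring
      _ ≤ _ := mul_le_mul e1 hY (by positivity) (exp_pos _).le))
  have upper := intervalIntegral_sph_mono (f := fun r ω => 2 *
      (exp (-((Q + 2) * (2 * r - r))) * (((r * gT' r ω) ^ 2 +
    (V' r ω + r * gN' r ω) ^ 2 + ∑ k, (r * gA' k r ω) ^ 2 + (r * V' r ω) ^ 2) / 2 -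
    (r * gT' r ω) * (V' r ω + r * gN' r ω)) +
    2 * (exp (-((Q + 2) * (2 * r - r))) *
    ((r * gT' r ω) * (V' r ω + r * gN' r ω)))))
    (g := fun r ω => ((V' r ω + r * (gN' r ω + gT' r ω)) ^ 2 +
      ∑ k, (r * gA' k r ω) ^ 2 + (r * V' r ω) ^ 2)) hρ (by fun_prop) (by fun_prop) (by
    intro r hr ω
    have e1 : exp (-((Q + 2) * (2 * r - r))) ≤ 1 :=
      exp_le_one_iff.2 (neg_nonpos.2 (mul_nonneg (by linarith) (by linarith [hr.1])))
    refine le_trans (le_of_eq ?_) (mul_le_mul_of_nonneg_right e1 (by positivity) |>.trans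
      (one_mul ((V' r ω + r * (gN' r ω + gT' r ω)) ^ 2 +
      ∑ k, (r * gA' k r ω) ^ 2 + (r * V' r ω) ^ 2)).le)
    ring)
  have lower' := lower.trans main
  simp only [intervalIntegral.integral_const_mul, integral_const_mul] at upper lower'
  linarith

lemma IsWaveJet.energy {c f v : E3 × ℝ → ℝ} {g : E3 × ℝ → E3 × ℝ →L[ℝ] ℝ}
    {H : E3 × ℝ → E3 × ℝ →L[ℝ] E3 × ℝ →L[ℝ] ℝ} (hj : IsWaveJet c f v g H)
    (hf : ContinuousOn f cone) {R T Q ρ : ℝ} (hR : 0 < R) (hρ : R ≤ ρ) (hρT : 2 * ρ ≤ R + T)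
    (hQ : 0 ≤ Q) (hc : ∀ z : E3 × ℝ, ‖z.1‖ < z.2 → z.2 < T → |c z| ≤ Q)
    (hb : ∀ z : E3 × ℝ, ‖z.1‖ = R → R < z.2 → z.2 < T → v z = 0) :
    exp (-((Q + 2) * T)) * (∫ r in R..ρ, ∫ ω : S2, ((r * v (r • (ω : E3), 2 * ρ - r)) ^ 2 +
        ∑ k, (r * g (r • (ω : E3), 2 * ρ - r) (gen k ω, 0)) ^ 2) ∂sph) ≤
      (∫ r in R..ρ, ∫ ω : S2, ((v (r • (ω : E3), r) + r * g (r • (ω : E3), r) (ω, 1)) ^ 2 +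
        ∑ k, (r * g (r • (ω : E3), r) (gen k ω, 0)) ^ 2 + (r * v (r • (ω : E3), r)) ^ 2) ∂sph) +
      2 * ∫ a in R..ρ, ∫ r in R..a, ∫ ω : S2, (r * f (r • (ω : E3), 2 * a - r)) ^ 2 ∂sph := by
  have cg : ∀ {b : S2 → E3 × ℝ}, Continuous b → ContinuousOn (fun x : S2 × ℝ × ℝ =>
      g (coneMap x.1 x.2.1 x.2.2) (b x.1)) (univ ×ˢ tri R ρ) := fun hb =>
    (continuousOn_coneMap hR hj.cont_grad).clm_apply (hb.comp continuous_fst).continuousOn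
  have cH : ∀ {b b' : S2 → E3 × ℝ}, Continuous b → Continuous b' →
      ContinuousOn (fun x : S2 × ℝ × ℝ =>
      H (coneMap x.1 x.2.1 x.2.2) (b x.1) (b' x.1)) (univ ×ˢ tri R ρ) := fun hb hb' =>
    ((continuousOn_coneMap hR hj.cont_hess).clm_apply
      (hb.comp continuous_fst).continuousOn).clm_apply (hb'.comp continuous_fst).continuousOn
  have bT : Continuous (fun _ : S2 => ((0, 1) : E3 × ℝ)) := continuous_const
  have bN : Continuous (fun ω : S2 => ((ω, 0) : E3 × ℝ)) := by fun_prop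
  have bA : ∀ k, Continuous (fun ω : S2 => ((gen k ω, 0) : E3 × ℝ)) := fun k => by fun_prop
  have bAA : ∀ k, Continuous (fun ω : S2 => ((gen k (gen k ω), 0) : E3 × ℝ)) :=
    fun k => by fun_prop
  obtain ⟨V, hV⟩ : ∃ V : S2 → ℝ → ℝ → ℝ, ∀ ω r a, V ω r a = v (coneMap ω r a) :=
    ⟨_, fun _ _ _ => rfl⟩
  obtain ⟨F, hF⟩ : ∃ F : S2 → ℝ → ℝ → ℝ, ∀ ω r a, F ω r a = f (coneMap ω r a) :=
    ⟨_, fun _ _ _ => rfl⟩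
  obtain ⟨gT, hgT⟩ : ∃ gT : S2 → ℝ → ℝ → ℝ, ∀ ω r a, gT ω r a = g (coneMap ω r a) (0, 1) :=
    ⟨_, fun _ _ _ => rfl⟩
  obtain ⟨gN, hgN⟩ : ∃ gN : S2 → ℝ → ℝ → ℝ, ∀ ω r a, gN ω r a = g (coneMap ω r a) (ω, 0) :=
    ⟨_, fun _ _ _ => rfl⟩
  obtain ⟨gA, hgA⟩ : ∃ gA : Fin 3 → S2 → ℝ → ℝ → ℝ, ∀ k ω r a,
    gA k ω r a = g (coneMap ω r a) (gen k ω, 0) := ⟨_, fun _ _ _ _ => rfl⟩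
  obtain ⟨gAA, hgAA⟩ : ∃ gAA : Fin 3 → S2 → ℝ → ℝ → ℝ, ∀ k ω r a,
    gAA k ω r a = g (coneMap ω r a) (gen k (gen k ω), 0) := ⟨_, fun _ _ _ _ => rfl⟩
  obtain ⟨HTT, hHTT⟩ : ∃ h : S2 → ℝ → ℝ → ℝ, ∀ ω r a,
    h ω r a = H (coneMap ω r a) (0, 1) (0, 1) := ⟨_, fun _ _ _ => rfl⟩
  obtain ⟨HTN, hHTN⟩ : ∃ h : S2 → ℝ → ℝ → ℝ, ∀ ω r a,
    h ω r a = H (coneMap ω r a) (0, 1) (ω, 0) := ⟨_, fun _ _ _ => rfl⟩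
  obtain ⟨HNT, hHNT⟩ : ∃ h : S2 → ℝ → ℝ → ℝ, ∀ ω r a,
    h ω r a = H (coneMap ω r a) (ω, 0) (0, 1) := ⟨_, fun _ _ _ => rfl⟩
  obtain ⟨HNN, hHNN⟩ : ∃ h : S2 → ℝ → ℝ → ℝ, ∀ ω r a,
    h ω r a = H (coneMap ω r a) (ω, 0) (ω, 0) := ⟨_, fun _ _ _ => rfl⟩
  obtain ⟨HTA, hHTA⟩ : ∃ h : Fin 3 → S2 → ℝ → ℝ → ℝ, ∀ k ω r a,
    h k ω r a = H (coneMap ω r a) (0, 1) (gen k ω, 0) := ⟨_, fun _ _ _ _ => rfl⟩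
  obtain ⟨HAT, hHAT⟩ : ∃ h : Fin 3 → S2 → ℝ → ℝ → ℝ, ∀ k ω r a,
    h k ω r a = H (coneMap ω r a) (gen k ω, 0) (0, 1) := ⟨_, fun _ _ _ _ => rfl⟩
  obtain ⟨HAA, hHAA⟩ : ∃ h : Fin 3 → S2 → ℝ → ℝ → ℝ, ∀ k ω r a,
    h k ω r a = H (coneMap ω r a) (gen k ω, 0) (gen k ω, 0) := ⟨_, fun _ _ _ _ => rfl⟩
  have cV : ContinuousOn (fun x : S2 × ℝ × ℝ => V x.1 x.2.1 x.2.2) (univ ×ˢ tri R ρ) := by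
    simp only [hV]; exact continuousOn_coneMap hR hj.cont_fun
  have cF : ContinuousOn (fun x : S2 × ℝ × ℝ => F x.1 x.2.1 x.2.2) (univ ×ˢ tri R ρ) := by
    simp only [hF]; exact continuousOn_coneMap hR hf
  have cgT : ContinuousOn (fun x : S2 × ℝ × ℝ => gT x.1 x.2.1 x.2.2) (univ ×ˢ tri R ρ) := by
    simp only [hgT]; exact cg bT
  have cgN : ContinuousOn (fun x : S2 × ℝ × ℝ => gN x.1 x.2.1 x.2.2) (univ ×ˢ tri R ρ) := by
    simp only [hgN]; exact cg bN
  have cgA : ∀ k, ContinuousOn (fun x : S2 × ℝ × ℝ => gA k x.1 x.2.1 x.2.2)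
      (univ ×ˢ tri R ρ) := fun k => by
    simp only [hgA]; exact cg (bA k)
  have cgAA : ∀ k, ContinuousOn (fun x : S2 × ℝ × ℝ => gAA k x.1 x.2.1 x.2.2)
      (univ ×ˢ tri R ρ) := fun k => by
    simp only [hgAA]; exact cg (bAA k)
  have cHTT : ContinuousOn (fun x : S2 × ℝ × ℝ => HTT x.1 x.2.1 x.2.2) (univ ×ˢ tri R ρ) := by
    simp only [hHTT]; exact cH bT bT
  have cHTN : ContinuousOn (fun x : S2 × ℝ × ℝ => HTN x.1 x.2.1 x.2.2) (univ ×ˢ tri R ρ) := by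
    simp only [hHTN]; exact cH bT bN
  have cHNT : ContinuousOn (fun x : S2 × ℝ × ℝ => HNT x.1 x.2.1 x.2.2) (univ ×ˢ tri R ρ) := by
    simp only [hHNT]; exact cH bN bT
  have cHNN : ContinuousOn (fun x : S2 × ℝ × ℝ => HNN x.1 x.2.1 x.2.2) (univ ×ˢ tri R ρ) := by
    simp only [hHNN]; exact cH bN bN
  have cHTA : ∀ k, ContinuousOn (fun x : S2 × ℝ × ℝ => HTA k x.1 x.2.1 x.2.2)
      (univ ×ˢ tri R ρ) := fun k => by
    simp only [hHTA]; exact cH bT (bA k)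
  have cHAT : ∀ k, ContinuousOn (fun x : S2 × ℝ × ℝ => HAT k x.1 x.2.1 x.2.2)
      (univ ×ˢ tri R ρ) := fun k => by
    simp only [hHAT]; exact cH (bA k) bT
  have cHAA : ∀ k, ContinuousOn (fun x : S2 × ℝ × ℝ => HAA k x.1 x.2.1 x.2.2)
      (univ ×ˢ tri R ρ) := fun k => by
    simp only [hHAA]; exact cH (bA k) (bA k)
  have Va : ∀ ω {r a}, R ≤ r → r < a → HasDerivAt (V ω r) (2 * gT ω r a) a := by
    intro ω r a h1 h2
    have := hj.hasDerivAt_fun (hasDerivAt_coneMap_right ω r a) (coneMap_interior hR h1 h2 ω)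
    simp only [map_smul, smul_eq_mul, ← hV, ← hgT] at this
    exact this
  have Vr : ∀ ω {r a}, R ≤ r → r < a →
      HasDerivAt (fun r => V ω r a) (gN ω r a - gT ω r a) r := by
    intro ω r a h1 h2
    have := hj.hasDerivAt_fun (hasDerivAt_coneMap_left ω r a) (coneMap_interior hR h1 h2 ω)
    simp only [map_sub, ← hV, ← hgT, ← hgN] at this
    exact this
  have ga : ∀ ω {r a} b, R ≤ r → r < a →
      HasDerivAt (fun a => g (coneMap ω r a) b) (2 * H (coneMap ω r a) (0, 1) b) a := by
    intro ω r a b h1 h2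
    have := hj.hasDerivAt_grad (hasDerivAt_coneMap_right ω r a) (coneMap_interior hR h1 h2 ω) b
    simpa only [map_smul, smul_apply, smul_eq_mul] using this
  have gr : ∀ ω {r a} b, R ≤ r → r < a → HasDerivAt (fun r => g (coneMap ω r a) b)
      (H (coneMap ω r a) (ω, 0) b - H (coneMap ω r a) (0, 1) b) r := by
    intro ω r a b h1 h2
    have := hj.hasDerivAt_grad (hasDerivAt_coneMap_left ω r a) (coneMap_interior hR h1 h2 ω) b
    simpa only [map_sub, sub_apply] using this
  have gTa : ∀ ω {r a}, R ≤ r → r < a → HasDerivAt (gT ω r) (2 * HTT ω r a) a := by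
    intro ω r a h1 h2
    have := ga ω (0, 1) h1 h2
    simp only [← hgT, ← hHTT] at this
    exact this
  have gNa : ∀ ω {r a}, R ≤ r → r < a → HasDerivAt (gN ω r) (2 * HTN ω r a) a := by
    intro ω r a h1 h2
    have := ga ω (ω, 0) h1 h2
    simp only [← hgN, ← hHTN] at this
    exact this
  have gAa : ∀ k ω {r a}, R ≤ r → r < a → HasDerivAt (gA k ω r) (2 * HTA k ω r a) a := by
    intro k ω r a h1 h2
    have := ga ω (gen k ω, 0) h1 h2
    simp only [← hgA, ← hHTA] at this
    exact this
  have gTr : ∀ ω {r a}, R ≤ r → r < a →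
      HasDerivAt (fun r => gT ω r a) (HNT ω r a - HTT ω r a) r := by
    intro ω r a h1 h2
    have := gr ω (0, 1) h1 h2
    simp only [← hgT, ← hHTT, ← hHNT] at this
    exact this
  have gNr : ∀ ω {r a}, R ≤ r → r < a →
      HasDerivAt (fun r => gN ω r a) (HNN ω r a - HTN ω r a) r := by
    intro ω r a h1 h2
    have := gr ω (ω, 0) h1 h2
    simp only [← hgN, ← hHTN, ← hHNN] at this
    exact this
  have main := sph_triangle_estimate
    (M := fun ω r a => exp (-((Q + 2) * (2 * a - r))) * (((r * gT ω r a) ^ 2 +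
      (V ω r a + r * gN ω r a) ^ 2 + ∑ k, (r * gA k ω r a) ^ 2 + (r * V ω r a) ^ 2) / 2 -
      (r * gT ω r a) * (V ω r a + r * gN ω r a)))
    (N := fun ω r a => exp (-((Q + 2) * (2 * a - r))) *
      ((r * gT ω r a) * (V ω r a + r * gN ω r a)))
    (Ma := fun ω r a => exp (-((Q + 2) * (2 * a - r))) *
      (-((Q + 2) * 2) * (((r * gT ω r a) ^ 2 + (V ω r a + r * gN ω r a) ^ 2 +
        ∑ k, (r * gA k ω r a) ^ 2 + (r * V ω r a) ^ 2) / 2 -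
        (r * gT ω r a) * (V ω r a + r * gN ω r a)) +
      ((r * gT ω r a) * (2 * (r * HTT ω r a)) +
        (V ω r a + r * gN ω r a) * (2 * gT ω r a + 2 * (r * HTN ω r a)) +
        ∑ k, (r * gA k ω r a) * (2 * (r * HTA k ω r a)) + (r * V ω r a) * (2 * (r * gT ω r a))) -
      (2 * (r * HTT ω r a) * (V ω r a + r * gN ω r a) +
        (r * gT ω r a) * (2 * gT ω r a + 2 * (r * HTN ω r a)))))
    (Nr := fun ω r a => exp (-((Q + 2) * (2 * a - r))) *
      (-((Q + 2) * (-1)) * ((r * gT ω r a) * (V ω r a + r * gN ω r a)) +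
      ((gT ω r a + r * (HNT ω r a - HTT ω r a)) * (V ω r a + r * gN ω r a) +
        (r * gT ω r a) * (2 * gN ω r a - gT ω r a + r * (HNN ω r a - HTN ω r a)))))
    (G := fun ω r a => (r * F ω r a) ^ 2)
    (D := fun ω r a => exp (-((Q + 2) * (2 * a - r))) *
      (2 * ∑ k, r * (r * HAT k ω r a * gA k ω r a + gT ω r a * (r * HAA k ω r a + gAA k ω r a))))
    hρ (by fun_prop) (by fun_prop) (by fun_prop) (by fun_prop) (by fun_prop) (by fun_prop)
    ?_ ?_ ?_ ?_ ?_
  · have eF : ∀ ω : S2, ∀ r a, f (r • (ω : E3), 2 * a - r) = F ω r a := fun ω r a => (hF ω r a).symm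
    have eV : ∀ ω : S2, ∀ r a, v (r • (ω : E3), 2 * a - r) = V ω r a := fun ω r a => (hV ω r a).symm
    have eA : ∀ k, ∀ ω : S2, ∀ r a, g (r • (ω : E3), 2 * a - r) (gen k ω, 0) = gA k ω r a :=
      fun k ω r a => (hgA k ω r a).symm
    have e2 : ∀ ω : S2, ∀ r, ((r • (ω : E3), r) : E3 × ℝ) = coneMap ω r r := by
      intro ω r
      rw [coneMap, two_mul, add_sub_cancel_right]
    have eT : ∀ ω : S2, ∀ r, g (coneMap ω r r) (ω, 1) = gN ω r r + gT ω r r := by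
      intro ω r
      have : (((ω : E3), 1) : E3 × ℝ) = ((ω : E3), 0) + (0, 1) := by simp
      rw [this, map_add, hgN, hgT]
    simp only [eF, eV, eA, e2, eT, ← hV, ← hgA]
    have c1 : ∀ {W : S2 → ℝ → ℝ → ℝ},
        ContinuousOn (fun x : S2 × ℝ × ℝ => W x.1 x.2.1 x.2.2) (univ ×ˢ tri R ρ) →
        ContinuousOn (fun x : ℝ × S2 => W x.2 x.1 ρ) (Icc R ρ ×ˢ univ) := fun hW =>
      hW.comp (f := fun x : ℝ × S2 => (x.2, x.1, ρ)) (by fun_prop)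
        fun x hx => ⟨mem_univ _, hx.1.1, hx.1.2, le_rfl⟩
    have c2 : ∀ {W : S2 → ℝ → ℝ → ℝ},
        ContinuousOn (fun x : S2 × ℝ × ℝ => W x.1 x.2.1 x.2.2) (univ ×ˢ tri R ρ) →
        ContinuousOn (fun x : ℝ × S2 => W x.2 x.1 x.1) (Icc R ρ ×ˢ univ) := fun hW =>
      hW.comp (f := fun x : ℝ × S2 => (x.2, x.1, x.1)) (by fun_prop)
        fun x hx => ⟨mem_univ _, hx.1.1, le_rfl, hx.1.2⟩
    exact weighted_energy_estimate (V := fun r ω => V ω r ρ) (V' := fun r ω => V ω r r)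
      (gT := fun r ω => gT ω r ρ) (gT' := fun r ω => gT ω r r) (gN := fun r ω => gN ω r ρ)
      (gN' := fun r ω => gN ω r r) (gA := fun k r ω => gA k ω r ρ)
      (gA' := fun k r ω => gA k ω r r) hρ hρT hR hQ (c1 cV) (c2 cV) (c1 cgT) (c2 cgT) (c1 cgN)
      (c2 cgN) (fun k => c1 (cgA k)) (fun k => c2 (cgA k)) main
  · intro ω r a h1 h2 h3
    refine (hasDerivAt_weighted_energy (wt := fun a => r * gT ω r a)
      (wr := fun a => V ω r a + r * gN ω r a) (w := fun a => r * V ω r a)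
      (y := fun k a => r * gA k ω r a) (τ := fun a => 2 * a - r) (L := Q + 2)
      (wt' := 2 * (r * HTT ω r a)) (wr' := 2 * gT ω r a + 2 * (r * HTN ω r a))
      (w' := 2 * (r * gT ω r a)) (τ' := 2) (y' := fun k => 2 * (r * HTA k ω r a))
      ?_ ?_ ?_ ?_ ?_)
    · exact ((gTa ω h1.le h2).const_mul r).congr_deriv (by ring)
    · exact ((Va ω h1.le h2).fun_add ((gNa ω h1.le h2).const_mul r)).congr_deriv (by ring)
    · exact ((Va ω h1.le h2).const_mul r).congr_deriv (by ring)
    · exact fun k => ((gAa k ω h1.le h2).const_mul r).congr_deriv (by ring)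
    · simpa using ((hasDerivAt_id a).const_mul 2).sub_const r
  · intro ω r a h1 h2 h3
    refine (hasDerivAt_weighted_flux (wt := fun r => r * gT ω r a)
      (wr := fun r => V ω r a + r * gN ω r a)
      (τ := fun r => 2 * a - r) (L := Q + 2) (τ' := -1)
      (wt' := gT ω r a + r * (HNT ω r a - HTT ω r a))
      (wr' := 2 * gN ω r a - gT ω r a + r * (HNN ω r a - HTN ω r a)) ?_ ?_ ?_)
    · exact ((hasDerivAt_id' r).fun_mul (gTr ω h1.le h2)).congr_deriv (by ring)
    · exact ((Vr ω h1.le h2).fun_add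
        ((hasDerivAt_id' r).fun_mul (gNr ω h1.le h2))).congr_deriv (by ring)
    · simpa using (hasDerivAt_id r).const_sub (2 * a)
  · intro ω a h1 h2
    have hT : gT ω R a = 0 := by
      have h3 := Va ω (r := R) le_rfl h1
      have h4 : HasDerivAt (V ω R) 0 a := by
        refine (hasDerivAt_const a (0:ℝ)).congr_of_eventuallyEq ?_
        filter_upwards [Ioo_mem_nhds h1 h2] with b hb'
        rw [hV]
        refine hb _ (norm_smul_S2 hR ω) ?_ ?_ <;> simp only [coneMap] <;> linarith [hb'.1, hb'.2]
      linarith [h3.unique h4]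
    simp only [hT, mul_zero, zero_mul]
  · intro ω r a h1 h2 h3
    have hi := coneMap_interior hR h1.le h2 ω
    have hg2 : ∑ k, gAA k ω r a = -2 * gN ω r a := by
      have h5 : ∑ k, ((gen k (gen k (ω : E3)), 0) : E3 × ℝ) = (-2 : ℝ) • ((ω : E3), 0) := by
        have := sum_gen_gen (ω : E3)
        rw [Prod.smul_mk, ← this, smul_zero]
        ext1 <;> simp [Prod.fst_sum, Prod.snd_sum]
      simp only [hgAA, hgN]
      rw [← map_sum, h5, map_smul, smul_eq_mul]
    have htr := sum_bilin_gen ((H (coneMap ω r a)).bilinearComp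
      (ContinuousLinearMap.inl ℝ E3 ℝ) (ContinuousLinearMap.inl ℝ E3 ℝ)) (ω : E3)
    simp only [ContinuousLinearMap.bilinearComp_apply, ContinuousLinearMap.inl_apply,
      norm_S2, one_pow, one_mul, ← hHAA, ← hHNN] at htr
    have hpde := hj.pde _ hi
    rw [← hHTT, ← hV, ← hF] at hpde
    have hct := hc _ hi (by simp only [coneMap]; linarith)
    have key := energy_density_le (r := r) (gT := gT ω r a) (gA := fun k => gA k ω r a)
      (HTN := HTN ω r a) (HTA := fun k => HTA k ω r a) hct hg2 htr hpde
    have hE0 : 0 < exp (-((Q + 2) * (2 * a - r))) := exp_pos _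
    have hE1 : exp (-((Q + 2) * (2 * a - r))) ≤ 1 := by
      refine exp_le_one_iff.2 (neg_nonpos.2 (mul_nonneg (by positivity) (by linarith)))
    have hNT : HNT ω r a = HTN ω r a := by rw [hHNT, hHTN]; exact hj.symm _ hi _ _
    have hAT : ∀ k, HAT k ω r a = HTA k ω r a := fun k => by
      rw [hHAT, hHTA]; exact hj.symm _ hi _ _
    simp only [hNT, hAT]
    have k2 := mul_le_mul_of_nonneg_left key hE0.le
    have k3 := mul_le_mul_of_nonneg_right hE1 (sq_nonneg (r * F ω r a))
    rw [mul_add] at k2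
    refine (le_of_eq_of_le ?_ k2).trans ?_
    · ring
    · linarith
  · intro r a h1 h2 h3
    have hD1 := fun k => hj.integral_div_eq_zero (hR.trans h1) h2 k
    simp only [← hgA, ← hgT, ← hgAA, ← hHAT, ← hHAA] at hD1
    rw [integral_const_mul, integral_const_mul, integral_finsetSum]
    · simp only [integral_const_mul, (hD1 _).2]
      simp
    · exact fun k _ => (integrable_sph (hD1 k).1).const_mul r

lemma convex_cone : Convex ℝ cone := by
  intro x hx y hy a b ha hb _
  change ‖a • x.1 + b • y.1‖ ≤ a * x.2 + b * y.2
  refine (norm_add_le _ _).trans ?_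
  rw [norm_smul, norm_smul, Real.norm_of_nonneg ha, Real.norm_of_nonneg hb]
  exact add_le_add (mul_le_mul_of_nonneg_left hx ha) (mul_le_mul_of_nonneg_left hy hb)

lemma isOpen_cone_interior : IsOpen {z : E3 × ℝ | ‖z.1‖ < z.2} :=
  isOpen_lt (by fun_prop) (by fun_prop)

lemma cone_mem_nhds {z : E3 × ℝ} (h : ‖z.1‖ < z.2) : cone ∈ 𝓝 z :=
  mem_of_superset (isOpen_cone_interior.mem_nhds h) fun z (h : ‖z.1‖ < z.2) => h.le

lemma isClosed_cone : IsClosed cone := isClosed_le (by fun_prop) (by fun_prop)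

lemma uniqueDiffOn_cone : UniqueDiffOn ℝ cone :=
  uniqueDiffOn_convex convex_cone
    ⟨(0, 1), mem_interior_iff_mem_nhds.2 (cone_mem_nhds (by simp))⟩

lemma pd_fixT {w : E3 × ℝ → ℝ} {z : E3 × ℝ} {w' : E3 × ℝ →L[ℝ] ℝ} (h : HasFDerivAt w w' z)
    (i : Fin 3) : pd i (fixT w z.2) z.1 = w' (basis3 i, 0) := by
  have h1 : HasFDerivAt (fun y : E3 => (y, z.2)) (ContinuousLinearMap.inl ℝ E3 ℝ) z.1 :=
    hasFDerivAt_prodMk_left z.1 z.2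
  have h2 := HasFDerivAt.comp (g := w) z.1 h h1
  rw [pd, show fixT w z.2 = w ∘ fun y : E3 => (y, z.2) from rfl, h2.fderiv]
  rfl

/-- `w` has the continuous derivative `g` on the cone, up to the boundary. -/
structure HasConeGrad (w : E3 × ℝ → ℝ) (g : E3 × ℝ → E3 × ℝ →L[ℝ] ℝ) : Prop where
  cont : ContinuousOn g cone
  hasGrad : ∀ z ∈ cone, HasFDerivWithinAt w (g z) cone z

lemma HasConeGrad.hasDerivAt {w : E3 × ℝ → ℝ} {g : E3 × ℝ → E3 × ℝ →L[ℝ] ℝ}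
    (h : HasConeGrad w g) {z : ℝ → E3 × ℝ} {z' : E3 × ℝ} {x : ℝ} (hz : HasDerivAt z z' x)
    (hc : ∀ᶠ y in 𝓝 x, z y ∈ cone) : HasDerivAt (fun x => w (z x)) (g (z x) z') x :=
  (h.hasGrad _ hc.self_of_nhds).comp_hasDerivAt x hz hc

lemma HasConeGrad.sub {w w' : E3 × ℝ → ℝ} {g g' : E3 × ℝ → E3 × ℝ →L[ℝ] ℝ}
    (h : HasConeGrad w g) (h' : HasConeGrad w' g') : HasConeGrad (w - w') (g - g') :=
  ⟨h.cont.sub h'.cont, fun z hz => (h.hasGrad z hz).sub (h'.hasGrad z hz)⟩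

lemma HasConeGrad.of_contDiff {f : E3 → ℝ} (hf : ContDiff ℝ 1 f) :
    HasConeGrad (fun z => f z.1)
      (fun z => (fderiv ℝ f z.1).comp (ContinuousLinearMap.fst ℝ E3 ℝ)) := by
  refine ⟨?_, fun z _ => ?_⟩
  · have := hf.continuous_fderiv one_ne_zero
    fun_prop
  · exact ((hf.differentiable one_ne_zero z.1).hasFDerivAt.comp z hasFDerivAt_fst).hasFDerivWithinAt

lemma GoursatSol.exists_jet {q : E3 → ℝ} {u : E3 × ℝ → ℝ} (h : GoursatSol q u) :
    ∃ g H, IsWaveJet (fun z => q z.1) 0 u g H ∧ HasConeGrad u g ∧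
      ∀ z ∈ cone, HasFDerivWithinAt g (H z) cone z := by
  obtain ⟨h1, h2, -⟩ := h
  have hd : DifferentiableOn ℝ u cone := h1.differentiableOn two_ne_zero
  have h3 : ContDiffOn ℝ 1 (fderivWithin ℝ u cone) cone :=
    h1.fderivWithin uniqueDiffOn_cone (by norm_num)
  have hd' : DifferentiableOn ℝ (fderivWithin ℝ u cone) cone := h3.differentiableOn one_ne_zero
  have hG : ∀ z : E3 × ℝ, ‖z.1‖ < z.2 → HasFDerivAt u (fderivWithin ℝ u cone z) z :=
    fun z hz => (hd z hz.le).hasFDerivWithinAt.hasFDerivAt (cone_mem_nhds hz)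
  have hH : ∀ z : E3 × ℝ, ‖z.1‖ < z.2 → HasFDerivAt (fderivWithin ℝ u cone)
      (fderivWithin ℝ (fderivWithin ℝ u cone) cone z) z :=
    fun z hz => (hd' z hz.le).hasFDerivWithinAt.hasFDerivAt (cone_mem_nhds hz)
  refine ⟨fderivWithin ℝ u cone, fderivWithin ℝ (fderivWithin ℝ u cone) cone,
    ⟨h1.continuousOn, h3.continuousOn, h3.continuousOn_fderivWithin uniqueDiffOn_cone le_rfl,
      hG, hH, fun z hz => ?_, fun z hz => ?_⟩,
    ⟨h3.continuousOn, fun z hz => (hd z hz).hasFDerivWithinAt⟩,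
    fun z hz => (hd' z hz).hasFDerivWithinAt⟩
  · refine second_derivative_symmetric_of_eventually_of_real (f := u) ?_ (hH z hz)
    filter_upwards [isOpen_cone_interior.mem_nhds hz] with y hy using hG y hy
  · have ha : ∀ b, HasFDerivAt (fun y => fderivWithin ℝ u cone y b)
        ((ContinuousLinearMap.apply ℝ ℝ b).comp
          (fderivWithin ℝ (fderivWithin ℝ u cone) cone z)) z :=
      fun b => (ContinuousLinearMap.apply ℝ ℝ b).hasFDerivAt.comp z (hH z hz)
    have e1 : pdt (pdt u) z = fderivWithin ℝ (fderivWithin ℝ u cone) cone z (0, 1) (0, 1) := by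
      have : pdt u =ᶠ[𝓝 z] fun y => fderivWithin ℝ u cone y (0, 1) := by
        filter_upwards [isOpen_cone_interior.mem_nhds hz] with y hy
        rw [pdt, (hG y hy).fderiv]
      rw [pdt, this.fderiv_eq, (ha _).fderiv]
      rfl
    have e2 : ∀ i, pd i (pd i (fixT u z.2)) z.1 =
        fderivWithin ℝ (fderivWithin ℝ u cone) cone z (basis3 i, 0) (basis3 i, 0) := by
      intro i
      have : pd i (fixT u z.2) =ᶠ[𝓝 z.1]
          fixT (fun y => fderivWithin ℝ u cone y (basis3 i, 0)) z.2 := by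
        have ho : IsOpen {y : E3 | ‖y‖ < z.2} := isOpen_lt (by fun_prop) (by fun_prop)
        filter_upwards [ho.mem_nhds hz] with y hy
        exact pd_fixT (z := (y, z.2)) (hG (y, z.2) hy) i
      rw [pd, this.fderiv_eq]
      exact pd_fixT (ha _) i
    have := h2 z hz
    rw [e1, lapX, lap, Finset.sum_congr rfl fun i _ => e2 i] at this
    simp only [Pi.zero_apply]
    linarith

lemma pdrX_eq {w : E3 × ℝ → ℝ} {z : E3 × ℝ} {w' : E3 × ℝ →L[ℝ] ℝ} (h : HasFDerivAt w w' z) :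
    pdrX w z = w' (‖z.1‖⁻¹ • z.1, 0) := by
  have e : ((‖z.1‖⁻¹ • z.1, 0) : E3 × ℝ) =
      ‖z.1‖⁻¹ • ∑ i, z.1 i • ((basis3 i, 0) : E3 × ℝ) := by
    conv_lhs => rw [sum_basis3 z.1]
    ext1 <;> simp [Prod.fst_sum, Prod.snd_sum, ← sum_basis3]
  rw [e, map_smul, map_sum, pdrX, pdr, smul_eq_mul]
  simp only [pd_fixT h, map_smul, smul_eq_mul]

lemma IsWaveJet.sub_potential {q1 q2 : E3 → ℝ} {u1 u2 : E3 × ℝ → ℝ}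
    {g1 g2 : E3 × ℝ → E3 × ℝ →L[ℝ] ℝ} {H1 H2 : E3 × ℝ → E3 × ℝ →L[ℝ] E3 × ℝ →L[ℝ] ℝ}
    (h1 : IsWaveJet (fun z => q1 z.1) 0 u1 g1 H1) (h2 : IsWaveJet (fun z => q2 z.1) 0 u2 g2 H2) :
    IsWaveJet (fun z => q1 z.1) (fun z => (q1 - q2) z.1 * u2 z) (u1 - u2) (g1 - g2) (H1 - H2) where
  cont_fun := h1.cont_fun.sub h2.cont_fun
  cont_grad := h1.cont_grad.sub h2.cont_grad
  cont_hess := by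
    let : SeminormedAddCommGroup (E3 × ℝ →L[ℝ] E3 × ℝ →L[ℝ] ℝ) :=
      ContinuousLinearMap.toSeminormedAddCommGroup
    exact h1.cont_hess.sub h2.cont_hess
  hasGrad z hz := (h1.hasGrad z hz).sub (h2.hasGrad z hz)
  hasHess z hz := (h1.hasHess z hz).sub (h2.hasHess z hz)
  symm z hz a b := by
    simp only [Pi.sub_apply, sub_apply, h1.symm z hz a b, h2.symm z hz a b]
  pde z hz := by
    have e1 := h1.pde z hz
    have e2 := h2.pde z hz
    simp only [Pi.zero_apply, Pi.sub_apply, sub_apply, Finset.sum_sub_distrib] at *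
    linarith

lemma hasFDerivAt_norm_E3 {x : E3} (hx : x ≠ 0) :
    HasFDerivAt (fun y : E3 => ‖y‖) (‖x‖⁻¹ • innerSL ℝ x) x := by
  have h := (hasStrictFDerivAt_norm_sq x).hasFDerivAt.sqrt
    (pow_ne_zero 2 (norm_ne_zero_iff.2 hx))
  simp only [sqrt_sq (norm_nonneg _)] at h
  refine h.congr_fderiv ?_
  ext y
  have := norm_ne_zero_iff.2 hx
  simp
  field_simp

/-- The derivative along the infinitesimal rotation `gen k`. -/
def rotd (k : Fin 3) (f : E3 → ℝ) (x : E3) : ℝ := fderiv ℝ f x (gen k x)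

lemma ang_eq_rotd (k : Fin 3) (f : E3 → ℝ) : ang (planeFst k) (planeSnd k) f = rotd k f :=
  funext (ang_plane k f)

section
variable {p : E3 → ℝ} (hp : ContDiffOn ℝ 2 p {0}ᶜ)
include hp

lemma hasFDerivAt_of_contDiffOn_compl {x : E3} (hx : x ≠ 0) : HasFDerivAt p (fderiv ℝ p x) x :=
  ((hp.differentiableOn two_ne_zero).differentiableAt
    (isOpen_compl_singleton.mem_nhds hx)).hasFDerivAt

lemma contDiffOn_fderiv_compl : ContDiffOn ℝ 1 (fderiv ℝ p) {0}ᶜ :=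
  hp.fderiv_of_isOpen isOpen_compl_singleton (by norm_num)

lemma hasFDerivAt_fderiv_compl {x : E3} (hx : x ≠ 0) :
    HasFDerivAt (fderiv ℝ p) (fderiv ℝ (fderiv ℝ p) x) x :=
  (((contDiffOn_fderiv_compl hp).differentiableOn one_ne_zero).differentiableAt
    (isOpen_compl_singleton.mem_nhds hx)).hasFDerivAt

lemma continuousOn_fderiv_fderiv_compl : ContinuousOn (fderiv ℝ (fderiv ℝ p)) {0}ᶜ :=
  (contDiffOn_fderiv_compl hp).continuousOn_fderiv_of_isOpen isOpen_compl_singleton le_rfl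

lemma fderiv_fderiv_symm_compl {x : E3} (hx : x ≠ 0) (a b : E3) :
    fderiv ℝ (fderiv ℝ p) x a b = fderiv ℝ (fderiv ℝ p) x b a := by
  refine second_derivative_symmetric_of_eventually_of_real (f := p) ?_
    (hasFDerivAt_fderiv_compl hp hx) a b
  filter_upwards [isOpen_compl_singleton.mem_nhds hx] with y hy
    using hasFDerivAt_of_contDiffOn_compl hp hy

lemma rotd_rotd (k l : Fin 3) {x : E3} (hx : x ≠ 0) :
    rotd l (rotd k p) x =
      fderiv ℝ (fderiv ℝ p) x (gen l x) (gen k x) + fderiv ℝ p x (gen k (gen l x)) := by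
  have h := (hasFDerivAt_fderiv_compl hp hx).clm_apply (gen k).hasFDerivAt
  rw [rotd, show rotd k p = fun y => fderiv ℝ p y (gen k y) from rfl, h.fderiv]
  simp [add_comm]

lemma continuousOn_rotd (k : Fin 3) : ContinuousOn (rotd k p) {0}ᶜ :=
  (contDiffOn_fderiv_compl hp).continuousOn.clm_apply (gen k).continuous.continuousOn

lemma continuousOn_rotd_rotd (k l : Fin 3) : ContinuousOn (rotd l (rotd k p)) {0}ᶜ := by
  refine ContinuousOn.congr ?_ fun x hx => rotd_rotd hp k l hx
  exact (((continuousOn_fderiv_fderiv_compl hp).clm_apply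
    (gen l).continuous.continuousOn).clm_apply (gen k).continuous.continuousOn).add
    ((contDiffOn_fderiv_compl hp).continuousOn.clm_apply
      ((gen k).continuous.comp (gen l).continuous).continuousOn)

end

lemma gen_commutator (k l : Fin 3) : ∃ m, ∃ s : ℝ, s ^ 2 ≤ 1 ∧
    ∀ x, gen l (gen k x) - gen k (gen l x) = s • gen m x := by
  fin_cases k <;> fin_cases l
  · exact ⟨0, 0, by norm_num, fun x => by simp⟩
  · exact ⟨2, -1, by norm_num, fun x => by
      ext j; fin_cases j <;> simp [gen_apply, basis3, planeFst, planeSnd]⟩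
  · exact ⟨1, 1, by norm_num, fun x => by
      ext j; fin_cases j <;> simp [gen_apply, basis3, planeFst, planeSnd]⟩
  · exact ⟨2, 1, by norm_num, fun x => by
      ext j; fin_cases j <;> simp [gen_apply, basis3, planeFst, planeSnd]⟩
  · exact ⟨0, 0, by norm_num, fun x => by simp⟩
  · exact ⟨0, -1, by norm_num, fun x => by
      ext j; fin_cases j <;> simp [gen_apply, basis3, planeFst, planeSnd]⟩
  · exact ⟨1, -1, by norm_num, fun x => by
      ext j; fin_cases j <;> simp [gen_apply, basis3, planeFst, planeSnd]⟩
  · exact ⟨0, 1, by norm_num, fun x => by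
      ext j; fin_cases j <;> simp [gen_apply, basis3, planeFst, planeSnd]⟩
  · exact ⟨0, 0, by norm_num, fun x => by simp⟩

lemma pfun_eq (q : E3 → ℝ) (x : E3) : pfun q x = ‖x‖ * ∫ σ in (0:ℝ)..1, q (σ • x) := by
  rcases eq_or_ne x 0 with rfl | hx
  · simp [pfun]
  have h : ‖x‖ ≠ 0 := norm_ne_zero_iff.2 hx
  have := intervalIntegral.integral_comp_div (a := 0) (b := ‖x‖) (fun s : ℝ => q (s • x)) h
  rw [pfun, this]
  simp [h]

section
variable {p : E3 → ℝ} {u : E3 × ℝ → ℝ} {g : E3 × ℝ → E3 × ℝ →L[ℝ] ℝ}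

lemma norm_mem_cone (x : E3) : ((x, ‖x‖) : E3 × ℝ) ∈ cone := le_refl ‖x‖

lemma contDiffOn_of_eq_norm_mul (hu : ContDiffOn ℝ 2 u cone) (h : ∀ x, p x = ‖x‖ * u (x, ‖x‖)) :
    ContDiffOn ℝ 2 p {0}ᶜ := by
  have hn : ContDiffOn ℝ 2 (fun x : E3 => ‖x‖) {0}ᶜ :=
    fun x hx => (contDiffAt_norm ℝ hx).contDiffWithinAt
  rw [show p = fun x => ‖x‖ * u (x, ‖x‖) from funext h]
  exact hn.mul (hu.comp (contDiffOn_id.prodMk hn) fun x _ => norm_mem_cone x)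

lemma HasConeGrad.fderiv_norm_mul (hu : HasConeGrad u g) (h : ∀ x, p x = ‖x‖ * u (x, ‖x‖))
    {x : E3} (hx : x ≠ 0) (b : E3) :
    fderiv ℝ p x b = ‖x‖ * g (x, ‖x‖) (b, ‖x‖⁻¹ * inner ℝ x b) +
      ‖x‖⁻¹ * inner ℝ x b * u (x, ‖x‖) := by
  have hn := hasFDerivAt_norm_E3 hx
  have hc : HasFDerivAt (fun y : E3 => (y, ‖y‖))
      ((ContinuousLinearMap.id ℝ E3).prod (‖x‖⁻¹ • innerSL ℝ x)) x := (hasFDerivAt_id x).prodMk hn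
  have h2 := (hu.hasGrad _ (norm_mem_cone x)).comp_hasFDerivAt (f := fun y : E3 => (y, ‖y‖)) x hc
    (Eventually.of_forall norm_mem_cone)
  rw [show p = (fun y : E3 => ‖y‖) * u ∘ fun y => (y, ‖y‖) from funext h, (hn.mul h2).fderiv]
  simp
  ring

lemma HasConeGrad.fderiv_tangent (hu : HasConeGrad u g) (h : ∀ x, p x = ‖x‖ * u (x, ‖x‖))
    {x : E3} (hx : x ≠ 0) {b : E3} (hb : inner ℝ x b = 0) :
    fderiv ℝ p x b = ‖x‖ * g (x, ‖x‖) (b, 0) := by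
  rw [hu.fderiv_norm_mul h hx, hb]
  simp

lemma HasConeGrad.fderiv_radial (hu : HasConeGrad u g) (h : ∀ x, p x = ‖x‖ * u (x, ‖x‖))
    {r : ℝ} (hr : 0 < r) (ω : S2) :
    fderiv ℝ p (r • (ω : E3)) ω = u (r • (ω : E3), r) + r * g (r • (ω : E3), r) (ω, 1) := by
  have hn := norm_smul_S2 hr ω
  rw [hu.fderiv_norm_mul h (norm_ne_zero_iff.1 (by rw [hn]; exact hr.ne')), hn]
  have : r⁻¹ * inner ℝ (r • (ω : E3)) (ω : E3) = 1 := by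
    rw [real_inner_smul_left, real_inner_self_eq_norm_sq, norm_S2]
    field_simp
  rw [this]
  ring

end

lemma pfun_smul {q : E3 → ℝ} {r : ℝ} (hr : 0 < r) (ω : S2) :
    pfun q (r • (ω : E3)) = ∫ s in (0:ℝ)..r, q (s • (ω : E3)) := by
  rw [pfun, norm_smul_S2 hr]
  refine intervalIntegral.integral_congr fun s _ => ?_
  simp only [smul_smul]
  rw [div_mul_cancel₀ _ hr.ne']

lemma hasDerivAt_pfun_smul {q : E3 → ℝ} (hq : Continuous q) {r : ℝ} (hr : 0 < r) (ω : S2) :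
    HasDerivAt (fun r : ℝ => pfun q (r • (ω : E3))) (q (r • (ω : E3))) r := by
  have hc : Continuous fun s : ℝ => q (s • (ω : E3)) := by fun_prop
  refine (intervalIntegral.integral_hasDerivAt_right (hc.intervalIntegrable 0 r)
    hc.stronglyMeasurable.stronglyMeasurableAtFilter hc.continuousAt).congr_of_eventuallyEq ?_
  filter_upwards [lt_mem_nhds hr] with s hs using pfun_smul hs ω

lemma fderiv_pfun_radial {q : E3 → ℝ} (hq : Continuous q) (hp : ContDiffOn ℝ 2 (pfun q) {0}ᶜ)
    {r : ℝ} (hr : 0 < r) (ω : S2) :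
    fderiv ℝ (pfun q) (r • (ω : E3)) ω = q (r • (ω : E3)) := by
  have hx : r • (ω : E3) ≠ 0 := norm_ne_zero_iff.1 (by rw [norm_smul_S2 hr]; exact hr.ne')
  have h1 : HasDerivAt (fun r : ℝ => r • (ω : E3)) (ω : E3) r := by
    simpa using (hasDerivAt_id r).smul_const (ω : E3)
  have h2 := (hasFDerivAt_of_contDiffOn_compl hp hx).comp_hasDerivAt r h1
  exact h2.unique (hasDerivAt_pfun_smul hq hr ω)

lemma pdr_eq_fderiv (f : E3 → ℝ) (x : E3) : pdr f x = fderiv ℝ f x (‖x‖⁻¹ • x) := by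
  rw [pdr, map_smul, smul_eq_mul]
  conv_rhs => rw [show fderiv ℝ f x x = fderiv ℝ f x (∑ i, x i • basis3 i) by rw [← sum_basis3]]
  simp only [pd, map_smul, map_sum, smul_eq_mul]

lemma smul_S2_surj {x : E3} (hx : x ≠ 0) : ∃ ω : S2, x = ‖x‖ • (ω : E3) := by
  have h := norm_ne_zero_iff.2 hx
  refine ⟨⟨‖x‖⁻¹ • x, ?_⟩, ?_⟩
  · simp [norm_smul, h]
  · simp [smul_smul, h]

lemma pdr_pfun {q : E3 → ℝ} (hq : Continuous q) (hp : ContDiffOn ℝ 2 (pfun q) {0}ᶜ)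
    {x : E3} (hx : x ≠ 0) : pdr (pfun q) x = q x := by
  obtain ⟨ω, h⟩ := smul_S2_surj hx
  have hn := norm_pos_iff.2 hx
  have e : ‖x‖⁻¹ • x = ω := by
    conv_lhs => rw [h, norm_smul_S2 hn]
    rw [smul_smul, inv_mul_cancel₀ hn.ne', one_smul]
  rw [pdr_eq_fderiv, e]
  conv_lhs => rw [h]
  conv_rhs => rw [h]
  exact fderiv_pfun_radial hq hp hn ω

/-- The rotation `rot k θ` acting on the space variable of space-time. -/
def rotST (k : Fin 3) (θ : ℝ) : E3 × ℝ →L[ℝ] E3 × ℝ :=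
  (rot k θ).prodMap (ContinuousLinearMap.id ℝ ℝ)

lemma rotST_apply (k : Fin 3) (θ : ℝ) (x : E3) (t : ℝ) : rotST k θ (x, t) = (rot k θ x, t) := rfl

lemma rotST_mem_cone (k : Fin 3) (θ : ℝ) {z : E3 × ℝ} (hz : z ∈ cone) : rotST k θ z ∈ cone :=
  (norm_rot k θ z.1).le.trans hz

lemma IsWaveJet.rotDiff {c f u : E3 × ℝ → ℝ} {g : E3 × ℝ → E3 × ℝ →L[ℝ] ℝ}
    {H : E3 × ℝ → E3 × ℝ →L[ℝ] E3 × ℝ →L[ℝ] ℝ} (hj : IsWaveJet c f u g H) (k : Fin 3) (θ : ℝ) :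
    ∃ H', IsWaveJet (fun z => c (rotST k θ z))
      (fun z => ((c (rotST k θ z) - c z) * u z + (f (rotST k θ z) - f z)) / θ)
      (fun z => (u (rotST k θ z) - u z) / θ)
      (fun z => θ⁻¹ • ((g (rotST k θ z)).comp (rotST k θ) - g z)) H' := by
  let R := rotST k θ
  let P := (ContinuousLinearMap.compL ℝ (E3 × ℝ) (E3 × ℝ) ℝ).flip R
  have hm : MapsTo R cone cone := fun z hz => rotST_mem_cone k θ hz
  have hi : ∀ z : E3 × ℝ, ‖z.1‖ < z.2 → ‖(R z).1‖ < (R z).2 := fun z hz =>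
    (norm_rot k θ z.1).trans_lt hz
  have hR : ContinuousOn R cone := R.continuous.continuousOn
  refine ⟨fun z => θ⁻¹ • ((P.comp (H (R z))).comp R - H z), ?_, ?_, ?_, ?_, ?_, ?_, ?_⟩
  · exact ((hj.cont_fun.comp hR hm).sub hj.cont_fun).div_const θ
  · exact ((P.continuous.comp_continuousOn (hj.cont_grad.comp hR hm)).sub
      hj.cont_grad).const_smul θ⁻¹
  · let : SeminormedAddCommGroup (E3 × ℝ →L[ℝ] E3 × ℝ →L[ℝ] ℝ) :=
      ContinuousLinearMap.toSeminormedAddCommGroup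
    exact (((continuousOn_const.clm_comp (hj.cont_hess.comp hR hm)).clm_comp
      continuousOn_const).sub hj.cont_hess).const_smul θ⁻¹
  · intro z hz
    have h := (((hj.hasGrad _ (hi z hz)).comp z R.hasFDerivAt).sub (hj.hasGrad z hz)).const_smul θ⁻¹
    refine h.congr_of_eventuallyEq (Eventually.of_forall fun y => ?_)
    simp [div_eq_inv_mul, R]
  · intro z hz
    exact ((P.hasFDerivAt.comp z ((hj.hasHess _ (hi z hz)).comp z R.hasFDerivAt)).sub
      (hj.hasHess z hz)).const_smul θ⁻¹
  · intro z hz a b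
    change θ⁻¹ * (H (R z) (R a) (R b) - H z a b) = θ⁻¹ * (H (R z) (R b) (R a) - H z b a)
    rw [hj.symm _ (hi z hz), hj.symm _ hz]
  · intro z hz
    change θ⁻¹ * (H (R z) (R (0, 1)) (R (0, 1)) - H z (0, 1) (0, 1)) -
      ∑ i, θ⁻¹ * (H (R z) (R (basis3 i, 0)) (R (basis3 i, 0)) - H z (basis3 i, 0) (basis3 i, 0)) = _
    have h0 : R (0, 1) = (0, 1) := by simp [R, rotST_apply]
    have hs := sum_bilin_rot ((H (R z)).bilinearComp
      (ContinuousLinearMap.inl ℝ E3 ℝ) (ContinuousLinearMap.inl ℝ E3 ℝ)) k θ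
    simp only [ContinuousLinearMap.bilinearComp_apply, ContinuousLinearMap.inl_apply] at hs
    have hs' : ∑ i, H (R z) (R (basis3 i, 0)) (R (basis3 i, 0)) =
      ∑ i, H (R z) (basis3 i, 0) (basis3 i, 0) := hs
    rw [h0, ← Finset.mul_sum, Finset.sum_sub_distrib, hs']
    have e1 := hj.pde z hz
    have e2 := hj.pde _ (hi z hz)
    have : ∀ A B A' B' : ℝ, θ⁻¹ * (A - A') - θ⁻¹ * (B - B') = ((A - B) - (A' - B')) / θ := by
      intros; ring
    rw [this, e1, e2]
    change (c (R z) * u (R z) + f (R z) - (c z * u z + f z)) / θ = c (R z) * ((u (R z) - u z) / θ) +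
      ((c (R z) - c z) * u z + (f (R z) - f z)) / θ
    ring

lemma isCompact_cone_le (T : ℝ) : IsCompact (cone ∩ {z | z.2 ≤ T}) := by
  refine (((isCompact_closedBall (0 : E3) T).prod
    (isCompact_Icc (a := 0) (b := T)))).of_isClosed_subset
    (isClosed_cone.inter (isClosed_le (by fun_prop) (by fun_prop))) ?_
  rintro z ⟨h1, h2⟩
  have h1' : ‖z.1‖ ≤ z.2 := h1
  have h2' : z.2 ≤ T := h2
  exact ⟨by simpa using h1'.trans h2', (norm_nonneg _).trans h1', h2'⟩

lemma HasConeGrad.exists_bound {w : E3 × ℝ → ℝ} {g : E3 × ℝ → E3 × ℝ →L[ℝ] ℝ}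
    (h : HasConeGrad w g) {T : ℝ} (hT : 0 ≤ T) : ∃ B, 0 ≤ B ∧ ∀ z ∈ cone, z.2 ≤ T → |w z| ≤ B ∧
      ∀ k θ, |(w (rotST k θ z) - w z) / θ| ≤ B := by
  have hw : ContinuousOn w cone := fun z hz => (h.hasGrad z hz).continuousWithinAt
  obtain ⟨B1, hB1⟩ := (isCompact_cone_le T).exists_bound_of_continuousOn (hw.mono inter_subset_left)
  obtain ⟨B2, hB2⟩ :=
    (isCompact_cone_le T).exists_bound_of_continuousOn (h.cont.mono inter_subset_left)
  have h0 : ((0, 0) : E3 × ℝ) ∈ cone ∩ {z | z.2 ≤ T} := ⟨by simp [cone], hT⟩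
  have hB10 := (norm_nonneg _).trans (hB1 _ h0)
  have hB20 := (norm_nonneg _).trans (hB2 _ h0)
  obtain ⟨G, hG0, hG⟩ : ∃ G, 0 ≤ G ∧ ∀ k, ‖gen k‖ ≤ G :=
    ⟨∑ k, ‖gen k‖, Finset.sum_nonneg fun _ _ => norm_nonneg _,
      fun k => Finset.single_le_sum (f := fun k => ‖gen k‖) (fun _ _ => norm_nonneg _)
        (Finset.mem_univ k)⟩
  refine ⟨B1 + B2 * (G * T), by positivity, fun z hz hzT => ⟨?_, fun k θ => ?_⟩⟩
  · exact (hB1 z ⟨hz, hzT⟩).trans (le_add_of_nonneg_right (by positivity))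
  · have hd : ∀ s ∈ (univ : Set ℝ), HasDerivWithinAt (fun s => w (rotST k s z))
        (g (rotST k s z) (gen k (rot k s z.1), 0)) univ s := by
      intro s _
      refine (h.hasDerivAt ?_
        (Eventually.of_forall fun s => rotST_mem_cone k s hz)).hasDerivWithinAt
      exact (hasDerivAt_rot k s z.1).prodMk (hasDerivAt_const s z.2)
    have hb : ∀ s ∈ (univ : Set ℝ), ‖g (rotST k s z) (gen k (rot k s z.1), 0)‖ ≤ B2 * (G * T) := by
      intro s _
      refine (ContinuousLinearMap.le_opNorm _ _).trans
        (mul_le_mul (hB2 _ ⟨rotST_mem_cone k s hz, hzT⟩) ?_ (norm_nonneg _) hB20)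
      have e : ‖((gen k (rot k s z.1), 0) : E3 × ℝ)‖ = ‖gen k (rot k s z.1)‖ := by
        simp [Prod.norm_def]
      rw [e]
      refine (ContinuousLinearMap.le_opNorm _ _).trans
        (mul_le_mul (hG k) ?_ (norm_nonneg _) hG0)
      rw [norm_rot]
      exact le_trans hz hzT
    have := convex_univ.norm_image_sub_le_of_norm_hasDerivWithin_le hd hb (mem_univ 0) (mem_univ θ)
    have e0 : rotST k 0 z = z := by
      rw [← Prod.mk.eta (p := z), rotST_apply, rot_zero]
    rw [e0, sub_zero, Real.norm_eq_abs, Real.norm_eq_abs] at this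
    rw [abs_div]
    exact (div_le_of_le_mul₀ (abs_nonneg _) (by positivity) this).trans
      (le_add_of_nonneg_left hB10)

/-- The integral over `[R, ρ] × S²`. -/
def slab (R ρ : ℝ) (f : ℝ → S2 → ℝ) : ℝ := ∫ r in R..ρ, ∫ ω, f r ω ∂sph

section
variable {R ρ : ℝ} {f g : ℝ → S2 → ℝ}

lemma slab_mono (h : R ≤ ρ)
    (hf : ContinuousOn (fun x : ℝ × S2 => f x.1 x.2) (Icc R ρ ×ˢ univ))
    (hg : ContinuousOn (fun x : ℝ × S2 => g x.1 x.2) (Icc R ρ ×ˢ univ))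
    (hle : ∀ r ∈ Icc R ρ, ∀ ω, f r ω ≤ g r ω) : slab R ρ f ≤ slab R ρ g :=
  intervalIntegral_sph_mono h hf hg hle

lemma slab_congr (h : R ≤ ρ) (hle : ∀ r ∈ Icc R ρ, ∀ ω, f r ω = g r ω) :
    slab R ρ f = slab R ρ g := by
  refine intervalIntegral.integral_congr fun r hr => ?_
  rw [uIcc_of_le h] at hr
  exact integral_congr_ae (Eventually.of_forall (hle r hr))

lemma slab_nonneg (h : R ≤ ρ) (hf : ∀ r ∈ Icc R ρ, ∀ ω, 0 ≤ f r ω) : 0 ≤ slab R ρ f :=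
  intervalIntegral.integral_nonneg h fun r hr => integral_nonneg (hf r hr)

lemma slab_const_mul (c : ℝ) : slab R ρ (fun r ω => c * f r ω) = c * slab R ρ f := by
  simp only [slab, integral_const_mul, intervalIntegral.integral_const_mul]

lemma continuousOn_integral_slab
    (hf : ContinuousOn (fun x : ℝ × S2 => f x.1 x.2) (Icc R ρ ×ˢ univ)) :
    ContinuousOn (fun r => ∫ ω, f r ω ∂sph) (Icc R ρ) :=
  continuousOn_integral_of_compact_support (μ := sph) (k := univ) isCompact_univ hf
    (fun _ x _ hx => absurd (mem_univ x) hx)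

lemma continuous_slab_section (hf : ContinuousOn (fun x : ℝ × S2 => f x.1 x.2) (Icc R ρ ×ˢ univ))
    {r : ℝ} (hr : r ∈ Icc R ρ) : Continuous (f r) :=
  hf.comp_continuous (by fun_prop : Continuous fun ω : S2 => (r, ω)) fun _ => ⟨hr, mem_univ _⟩

lemma slab_add (h : R ≤ ρ)
    (hf : ContinuousOn (fun x : ℝ × S2 => f x.1 x.2) (Icc R ρ ×ˢ univ))
    (hg : ContinuousOn (fun x : ℝ × S2 => g x.1 x.2) (Icc R ρ ×ˢ univ)) :
    slab R ρ (fun r ω => f r ω + g r ω) = slab R ρ f + slab R ρ g := by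
  have key : ∀ {f : ℝ → S2 → ℝ}, ContinuousOn (fun x : ℝ × S2 => f x.1 x.2) (Icc R ρ ×ˢ univ) →
      IntervalIntegrable (fun r => ∫ ω, f r ω ∂sph) volume R ρ := fun hf => by
    refine ContinuousOn.intervalIntegrable ?_
    rw [uIcc_of_le h]
    exact continuousOn_integral_slab hf
  rw [slab, slab, slab, ← intervalIntegral.integral_add (key hf) (key hg)]
  refine intervalIntegral.integral_congr fun r hr => ?_
  rw [uIcc_of_le h] at hr
  exact integral_add (integrable_sph (continuous_slab_section hf hr))
    (integrable_sph (continuous_slab_section hg hr))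

lemma slab_sum (h : R ≤ ρ) {f : Fin 3 → ℝ → S2 → ℝ}
    (hf : ∀ k, ContinuousOn (fun x : ℝ × S2 => f k x.1 x.2) (Icc R ρ ×ˢ univ)) :
    slab R ρ (fun r ω => ∑ k, f k r ω) = ∑ k, slab R ρ (f k) := by
  simp only [Fin.sum_univ_three]
  rw [slab_add h ((hf 0).add (hf 1)) (hf 2), slab_add h (hf 0) (hf 1)]

lemma slab_mono_right {a : ℝ} (ha : R ≤ a) (haρ : a ≤ ρ)
    (hf : ContinuousOn (fun x : ℝ × S2 => f x.1 x.2) (Icc R ρ ×ˢ univ))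
    (h0 : ∀ r ∈ Icc R ρ, ∀ ω, 0 ≤ f r ω) : slab R a f ≤ slab R ρ f := by
  have hc := continuousOn_integral_slab hf
  have i1 : IntervalIntegrable (fun r => ∫ ω, f r ω ∂sph) volume R a :=
    ContinuousOn.intervalIntegrable
      (hc.mono (by rw [uIcc_of_le ha]; exact Icc_subset_Icc le_rfl haρ))
  have i2 : IntervalIntegrable (fun r => ∫ ω, f r ω ∂sph) volume a ρ :=
    ContinuousOn.intervalIntegrable
      (hc.mono (by rw [uIcc_of_le haρ]; exact Icc_subset_Icc ha le_rfl))
  rw [slab, slab, ← intervalIntegral.integral_add_adjacent_intervals i1 i2]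
  refine le_add_of_nonneg_right (intervalIntegral.integral_nonneg haρ fun r hr => ?_)
  exact integral_nonneg (h0 r ⟨ha.trans hr.1, hr.2⟩)

end

lemma intervalIntegral_le_const {K : ℝ → ℝ} {a b C : ℝ} (h : a ≤ b)
    (h0 : ∀ x ∈ Ioc a b, 0 ≤ K x) (hK : ∀ x ∈ Ioc a b, K x ≤ C) :
    ∫ x in a..b, K x ≤ C * (b - a) := by
  have := intervalIntegral.norm_integral_le_of_norm_le_const (a := a) (b := b) (f := K) (C := C)
    fun x hx => by
      rw [uIoc_of_le h] at hx
      rw [Real.norm_of_nonneg (h0 x hx)]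
      exact hK x hx
  rw [abs_of_nonneg (sub_nonneg.2 h)] at this
  exact (le_abs_self _).trans this

lemma smul_rot_ne_zero {r : ℝ} (hr : 0 < r) (l : Fin 3) (θ : ℝ) (ω : S2) :
    r • rot l θ ω ≠ 0 := by
  rw [← norm_ne_zero_iff, norm_smul, norm_rot, norm_S2, mul_one, norm_ne_zero_iff]
  exact hr.ne'

lemma smul_S2_ne_zero {r : ℝ} (hr : 0 < r) (ω : S2) : r • (ω : E3) ≠ 0 := by
  simpa [rot_zero] using smul_rot_ne_zero hr 0 0 ω

lemma hasDerivAt_smul_rot (l : Fin 3) (r θ : ℝ) (ω : S2) :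
    HasDerivAt (fun θ => r • rot l θ (ω : E3)) (r • gen l (rot l θ ω)) θ :=
  (hasDerivAt_rot l θ (ω : E3)).const_smul r

lemma Continuous.rot {X : Type*} [TopologicalSpace X] {a : X → ℝ} {b : X → E3} (l : Fin 3)
    (ha : Continuous a) (hb : Continuous b) : Continuous fun x => rot l (a x) (b x) :=
  (continuous_rot l).comp₂ ha hb

lemma continuous_rot_comp (l : Fin 3) {b : S2 → E3} (hb : Continuous b) :
    Continuous fun x : ℝ × ℝ × S2 => rot l x.1 (b x.2.2) := by
  have h1 : Continuous fun x : ℝ × ℝ × S2 => b x.2.2 := by fun_prop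
  exact Continuous.rot l continuous_fst h1

lemma continuous_fst_smul {F : ℝ × ℝ × S2 → E3} (hF : Continuous F) :
    Continuous fun x : ℝ × ℝ × S2 => x.2.1 • F x := by fun_prop

lemma continuous_smul_rot (l : Fin 3) :
    Continuous fun x : ℝ × ℝ × S2 => x.2.1 • rot l x.1 (x.2.2 : E3) :=
  continuous_fst_smul (continuous_rot_comp l (b := fun ω => (ω : E3)) (by fun_prop))

section
variable {Y : Type*} [TopologicalSpace Y] {R ρ : ℝ}

lemma continuousOn_smul_S2 {F : E3 → Y} (hR : 0 < R) (hF : ContinuousOn F {0}ᶜ) :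
    ContinuousOn (fun x : ℝ × S2 => F (x.1 • (x.2 : E3))) (Icc R ρ ×ˢ univ) :=
  hF.comp (f := fun x : ℝ × S2 => x.1 • (x.2 : E3)) (by fun_prop)
    fun x hx => smul_S2_ne_zero (hR.trans_le hx.1.1) x.2

lemma continuousOn_smul_rot {F : E3 → Y} (hR : 0 < R) (hF : ContinuousOn F {0}ᶜ) (l : Fin 3) :
    ContinuousOn (fun x : ℝ × ℝ × S2 => F (x.2.1 • rot l x.1 x.2.2))
      (univ ×ˢ Icc R ρ ×ˢ univ) := by
  exact hF.comp (f := fun x : ℝ × ℝ × S2 => x.2.1 • rot l x.1 (x.2.2 : E3))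
    (continuous_smul_rot l).continuousOn
    fun x hx => smul_rot_ne_zero (hR.trans_le hx.2.1.1) l x.1 x.2.2

lemma continuousOn_cone_top {F : E3 × ℝ → Y} (hR : 0 < R) (hF : ContinuousOn F cone) :
    ContinuousOn (fun x : ℝ × S2 => F (x.1 • (x.2 : E3), 2 * ρ - x.1)) (Icc R ρ ×ˢ univ) :=
  hF.comp (f := fun x : ℝ × S2 => (x.1 • (x.2 : E3), 2 * ρ - x.1)) (by fun_prop)
    fun x hx => coneMap_mem (ρ := ρ) hR ⟨hx.1.1, hx.1.2, le_rfl⟩ x.2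

lemma continuousOn_cone_top_rot {F : E3 × ℝ → Y} (hR : 0 < R) (hF : ContinuousOn F cone)
    (l : Fin 3) : ContinuousOn (fun x : ℝ × ℝ × S2 => F (x.2.1 • rot l x.1 x.2.2, 2 * ρ - x.2.1))
      (univ ×ˢ Icc R ρ ×ˢ univ) := by
  have h1 : Continuous fun x : ℝ × ℝ × S2 => 2 * ρ - x.2.1 := by fun_prop
  exact hF.comp (f := fun x : ℝ × ℝ × S2 => (x.2.1 • rot l x.1 (x.2.2 : E3), 2 * ρ - x.2.1))
    ((continuous_smul_rot l).prodMk h1).continuousOn fun x hx =>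
      coneMap_mem (ρ := ρ) hR ⟨hx.2.1.1, hx.2.1.2, le_rfl⟩ (sphMap (rotIso l x.1) x.2.2)

end

lemma tendsto_slab_slope_sq {h h' : ℝ → ℝ → S2 → ℝ} {R ρ : ℝ} (hle : R ≤ ρ)
    (hc : ContinuousOn (fun x : ℝ × ℝ × S2 => h' x.1 x.2.1 x.2.2) (univ ×ˢ Icc R ρ ×ˢ univ))
    (hd : ∀ θ ω, ∀ r ∈ Icc R ρ, HasDerivAt (fun θ => h θ r ω) (h' θ r ω) θ) :
    Tendsto (fun θ => slab R ρ fun r ω => ((h θ r ω - h 0 r ω) / θ) ^ 2) (𝓝[≠] 0)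
      (𝓝 (slab R ρ fun r ω => (h' 0 r ω) ^ 2)) :=
  tendsto_integral_slope_sq hle hc hd

section
variable {R ρ : ℝ} (hR : 0 < R) (hρ : R ≤ ρ) (l : Fin 3)
include hR hρ

lemma tendsto_slab_slope_fun {F : E3 → ℝ} (hF : ContDiffOn ℝ 1 F {0}ᶜ) :
    Tendsto (fun θ => slab R ρ fun r ω => ((F (r • rot l θ ω) - F (r • (ω : E3))) / θ) ^ 2) (𝓝[≠] 0)
      (𝓝 (slab R ρ fun r ω => (rotd l F (r • (ω : E3))) ^ 2)) := by
  have hc : ContinuousOn (rotd l F) {0}ᶜ :=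
    (hF.continuousOn_fderiv_of_isOpen isOpen_compl_singleton le_rfl).clm_apply
      (gen l).continuous.continuousOn
  have := tendsto_slab_slope_sq (h := fun θ r ω => F (r • rot l θ ω))
    (h' := fun θ r ω => rotd l F (r • rot l θ ω)) hρ (continuousOn_smul_rot hR hc l) ?_
  · simpa only [rot_zero] using this
  · intro θ ω r hr
    have hd : HasFDerivAt F (fderiv ℝ F (r • rot l θ ω)) (r • rot l θ ω) :=
      ((hF.differentiableOn one_ne_zero).differentiableAt (isOpen_compl_singleton.mem_nhds
        (smul_rot_ne_zero (hR.trans_le hr.1) l θ ω))).hasFDerivAt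
    have h2 := hd.comp_hasDerivAt θ (hasDerivAt_smul_rot l r θ ω)
    rw [rotd, map_smul]
    exact h2

lemma tendsto_slab_slope_fderiv {p : E3 → ℝ} (hp : ContDiffOn ℝ 2 p {0}ᶜ) (k : Fin 3) :
    Tendsto (fun θ => slab R ρ fun r ω => ((fderiv ℝ p (r • rot l θ ω) (rot l θ (gen k ω)) -
      fderiv ℝ p (r • (ω : E3)) (gen k ω)) / θ) ^ 2) (𝓝[≠] 0)
      (𝓝 (slab R ρ fun r ω => (r * fderiv ℝ (fderiv ℝ p) (r • (ω : E3)) (gen l ω) (gen k ω) +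
        fderiv ℝ p (r • (ω : E3)) (gen l (gen k ω))) ^ 2)) := by
  have c0 := continuous_rot_comp l (b := fun ω => (ω : E3)) (by fun_prop)
  have c1 := continuous_rot_comp l (b := fun ω => gen k (ω : E3)) (by fun_prop)
  have c2 : Continuous fun x : ℝ × ℝ × S2 => x.2.1 := by fun_prop
  have := tendsto_slab_slope_sq
    (h := fun θ r ω => fderiv ℝ p (r • rot l θ ω) (rot l θ (gen k ω)))
    (h' := fun θ r ω => fderiv ℝ (fderiv ℝ p) (r • rot l θ ω) (r • gen l (rot l θ ω))
      (rot l θ (gen k ω)) + fderiv ℝ p (r • rot l θ ω) (gen l (rot l θ (gen k ω)))) hρ ?_ ?_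
  · simpa only [rot_zero, map_smul, smul_apply, smul_eq_mul] using this
  · have k1 := continuousOn_smul_rot (ρ := ρ) hR (continuousOn_fderiv_fderiv_compl hp) l
    have k2 := continuousOn_smul_rot (ρ := ρ) hR (contDiffOn_fderiv_compl hp).continuousOn l
    have k3 : Continuous fun x : ℝ × ℝ × S2 => x.2.1 • gen l (rot l x.1 (x.2.2 : E3)) :=
      continuous_fst_smul ((gen l).continuous.comp c0)
    have k4 : Continuous fun x : ℝ × ℝ × S2 => gen l (rot l x.1 (gen k (x.2.2 : E3))) :=
      (gen l).continuous.comp c1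
    exact ((k1.clm_apply k3.continuousOn).clm_apply c1.continuousOn).add
      (k2.clm_apply k4.continuousOn)
  · intro θ ω r hr
    have h0 := hasFDerivAt_fderiv_compl hp (smul_rot_ne_zero (hR.trans_le hr.1) l θ ω)
    have h1 : HasDerivAt (fun θ => fderiv ℝ p (r • rot l θ (ω : E3)))
        (fderiv ℝ (fderiv ℝ p) (r • rot l θ (ω : E3)) (r • gen l (rot l θ ω))) θ :=
      h0.comp_hasDerivAt θ (hasDerivAt_smul_rot l r θ ω)
    have h2 := hasDerivAt_rot l θ (gen k (ω : E3))
    exact h1.clm_apply h2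

lemma tendsto_slab_slope_grad {g : E3 × ℝ → E3 × ℝ →L[ℝ] ℝ}
    {H : E3 × ℝ → E3 × ℝ →L[ℝ] E3 × ℝ →L[ℝ] ℝ} (hc : ContinuousOn g cone)
    (hcH : ContinuousOn H cone) (hH : ∀ z ∈ cone, HasFDerivWithinAt g (H z) cone z) :
    Tendsto (fun θ => slab R ρ fun r ω =>
      ((r * g (r • rot l θ ω, 2 * ρ - r) (gen l (rot l θ ω), 0) -
      r * g (r • (ω : E3), 2 * ρ - r) (gen l ω, 0)) / θ) ^ 2) (𝓝[≠] 0)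
      (𝓝 (slab R ρ fun r ω => (r * (r * H (r • (ω : E3), 2 * ρ - r) (gen l ω, 0) (gen l ω, 0) +
        g (r • (ω : E3), 2 * ρ - r) (gen l (gen l ω), 0))) ^ 2)) := by
  have c0 := continuous_rot_comp l (b := fun ω => (ω : E3)) (by fun_prop)
  have c2 : Continuous fun x : ℝ × ℝ × S2 => x.2.1 := by fun_prop
  have k1 := continuousOn_cone_top_rot (ρ := ρ) hR hcH l
  have k2 := continuousOn_cone_top_rot (ρ := ρ) hR hc l
  have k3 : Continuous fun x : ℝ × ℝ × S2 => ((gen l (rot l x.1 (x.2.2 : E3)), 0) : E3 × ℝ) :=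
    ((gen l).continuous.comp c0).prodMk continuous_const
  have k4 : Continuous fun x : ℝ × ℝ × S2 =>
      ((gen l (gen l (rot l x.1 (x.2.2 : E3))), 0) : E3 × ℝ) :=
    ((gen l).continuous.comp ((gen l).continuous.comp c0)).prodMk continuous_const
  have := tendsto_slab_slope_sq
    (h := fun θ r ω => r * g (r • rot l θ ω, 2 * ρ - r) (gen l (rot l θ ω), 0))
    (h' := fun θ r ω => r * (r * H (r • rot l θ ω, 2 * ρ - r) (gen l (rot l θ ω), 0)
      (gen l (rot l θ ω), 0) + g (r • rot l θ ω, 2 * ρ - r) (gen l (gen l (rot l θ ω)), 0)))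
    hρ ?_ ?_
  · simpa only [rot_zero] using this
  · exact c2.continuousOn.mul ((c2.continuousOn.mul
      ((k1.clm_apply k3.continuousOn).clm_apply k3.continuousOn)).add
      (k2.clm_apply k4.continuousOn))
  · intro θ ω r hr
    have hm : ∀ θ, (r • rot l θ (ω : E3), 2 * ρ - r) ∈ cone := fun θ =>
      coneMap_mem (ρ := ρ) hR ⟨hr.1, hr.2, le_rfl⟩ (sphMap (rotIso l θ) ω)
    have h1 : HasDerivAt (fun θ => ((r • rot l θ (ω : E3), 2 * ρ - r) : E3 × ℝ))
        (r • gen l (rot l θ ω), 0) θ :=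
      (hasDerivAt_smul_rot l r θ ω).prodMk (hasDerivAt_const θ (2 * ρ - r))
    have h2 : HasDerivAt (fun θ => g (r • rot l θ (ω : E3), 2 * ρ - r))
        (H (r • rot l θ (ω : E3), 2 * ρ - r) (r • gen l (rot l θ ω), 0)) θ :=
      (hH _ (hm θ)).comp_hasDerivAt θ h1 (Eventually.of_forall hm)
    have h3 : HasDerivAt (fun θ => ((gen l (rot l θ (ω : E3)), 0) : E3 × ℝ))
        (gen l (gen l (rot l θ ω)), 0) θ :=
      ((gen l).hasFDerivAt.comp_hasDerivAt θ (hasDerivAt_rot l θ (ω : E3))).prodMk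
        (hasDerivAt_const θ 0)
    have e : ((r • gen l (rot l θ ω), 0) : E3 × ℝ) = r • (gen l (rot l θ ω), 0) := by
      simp [Prod.smul_mk]
    refine ((h2.clm_apply h3).const_mul r).congr_deriv ?_
    rw [e, map_smul, smul_apply, smul_eq_mul]

end

/-- Two potentials `q1` and `q1 - q` together with the difference `u` of the corresponding waves,
its gradient `g` and its Hessian `H`, when the Cauchy data of `u` on the cylinder vanish. -/
structure InverseData (R T : ℝ) (q q1 : E3 → ℝ) (u2 u : E3 × ℝ → ℝ)
    (g2 g : E3 × ℝ → E3 × ℝ →L[ℝ] ℝ) (H : E3 × ℝ → E3 × ℝ →L[ℝ] E3 × ℝ →L[ℝ] ℝ) : Prop where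
  pos : 0 < R
  lt : R < T
  diff : ContDiff ℝ 1 q
  diff_one : ContDiff ℝ 1 q1
  grad_two : HasConeGrad u2 g2
  jet : IsWaveJet (fun z => q1 z.1) (fun z => q z.1 * u2 z) u g H
  grad : HasConeGrad u g
  hess : ∀ z ∈ cone, HasFDerivWithinAt g (H z) cone z
  diff_pfun : ContDiffOn ℝ 2 (pfun q) {0}ᶜ
  bottom : ∀ x, pfun q x = ‖x‖ * u (x, ‖x‖)
  zero : ∀ z : E3 × ℝ, ‖z.1‖ = R → R ≤ z.2 → z.2 ≤ T → u z = 0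
  zero_grad : ∀ z : E3 × ℝ, ‖z.1‖ = R → R < z.2 → z.2 < T → g z (‖z.1‖⁻¹ • z.1, 0) = 0

/-- The squares of `p = pfun q` and `q` and of their angular derivatives, up to order two for `p`
and one for `q`. -/
def den (q : E3 → ℝ) (x : E3) : ℝ :=
  pfun q x ^ 2 + ∑ k, rotd k (pfun q) x ^ 2 + ∑ k, ∑ l, rotd l (rotd k (pfun q)) x ^ 2 +
    q x ^ 2 + ∑ k, rotd k q x ^ 2

section den
variable (q : E3 → ℝ) (x : E3)

lemma den_nonneg : 0 ≤ den q x := by unfold den; positivity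

lemma sq_pfun_le_den : pfun q x ^ 2 ≤ den q x := by
  unfold den
  have h1 : 0 ≤ ∑ k, rotd k (pfun q) x ^ 2 := by positivity
  have h2 : 0 ≤ ∑ k, ∑ l, rotd l (rotd k (pfun q)) x ^ 2 := by positivity
  have h3 : 0 ≤ ∑ k, rotd k q x ^ 2 := by positivity
  nlinarith [sq_nonneg (q x)]

lemma sq_le_den : q x ^ 2 ≤ den q x := by
  unfold den
  have h1 : 0 ≤ ∑ k, rotd k (pfun q) x ^ 2 := by positivity
  have h2 : 0 ≤ ∑ k, ∑ l, rotd l (rotd k (pfun q)) x ^ 2 := by positivity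
  have h3 : 0 ≤ ∑ k, rotd k q x ^ 2 := by positivity
  nlinarith [sq_nonneg (pfun q x)]

lemma sum_sq_rotd_pfun_le_den : ∑ k, rotd k (pfun q) x ^ 2 ≤ den q x := by
  unfold den
  have h2 : 0 ≤ ∑ k, ∑ l, rotd l (rotd k (pfun q)) x ^ 2 := by positivity
  have h3 : 0 ≤ ∑ k, rotd k q x ^ 2 := by positivity
  nlinarith [sq_nonneg (pfun q x), sq_nonneg (q x)]

lemma sq_rotd_pfun_le_den (k : Fin 3) : rotd k (pfun q) x ^ 2 ≤ den q x :=
  (Finset.single_le_sum (f := fun k => rotd k (pfun q) x ^ 2) (fun _ _ => sq_nonneg _)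
    (Finset.mem_univ k)).trans (sum_sq_rotd_pfun_le_den q x)

lemma sq_rotd_rotd_le_den (k l : Fin 3) : rotd l (rotd k (pfun q)) x ^ 2 ≤ den q x := by
  have h := (Finset.single_le_sum (f := fun l => rotd l (rotd k (pfun q)) x ^ 2)
    (fun _ _ => sq_nonneg _) (Finset.mem_univ l)).trans
    (Finset.single_le_sum (f := fun k => ∑ l, rotd l (rotd k (pfun q)) x ^ 2)
      (fun _ _ => by positivity) (Finset.mem_univ k))
  refine h.trans ?_
  unfold den
  have h2 : 0 ≤ ∑ k, rotd k (pfun q) x ^ 2 := by positivity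
  have h3 : 0 ≤ ∑ k, rotd k q x ^ 2 := by positivity
  nlinarith [sq_nonneg (pfun q x), sq_nonneg (q x)]

lemma sq_rotd_le_den (k : Fin 3) : rotd k q x ^ 2 ≤ den q x := by
  refine (Finset.single_le_sum (f := fun k => rotd k q x ^ 2) (fun _ _ => sq_nonneg _)
    (Finset.mem_univ k)).trans ?_
  unfold den
  have h1 : 0 ≤ ∑ k, rotd k (pfun q) x ^ 2 := by positivity
  have h2 : 0 ≤ ∑ k, ∑ l, rotd l (rotd k (pfun q)) x ^ 2 := by positivity
  nlinarith [sq_nonneg (pfun q x), sq_nonneg (q x)]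

end den

lemma ContDiff.continuous_rotd {q : E3 → ℝ} (hq : ContDiff ℝ 1 q) (k : Fin 3) :
    Continuous (rotd k q) :=
  (hq.continuous_fderiv one_ne_zero).clm_apply (gen k).continuous

lemma fderiv_pfun_gen (q : E3 → ℝ) {r : ℝ} (hr : 0 < r) (ω : S2) (k : Fin 3) :
    fderiv ℝ (pfun q) (r • (ω : E3)) (gen k ω) = r⁻¹ * rotd k (pfun q) (r • (ω : E3)) := by
  rw [rotd, map_smul, map_smul, smul_eq_mul, inv_mul_cancel_left₀ hr.ne']

lemma slab_den_nonneg (q : E3 → ℝ) {R ρ : ℝ} (hρ : R ≤ ρ) :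
    0 ≤ slab R ρ fun r ω => den q (r • (ω : E3)) :=
  slab_nonneg hρ fun _ _ _ => den_nonneg _ _

lemma HasConeGrad.continuousOn {w : E3 × ℝ → ℝ} {g : E3 × ℝ → E3 × ℝ →L[ℝ] ℝ}
    (h : HasConeGrad w g) : ContinuousOn w cone :=
  fun z hz => (h.hasGrad z hz).continuousWithinAt

namespace InverseData
variable {R T : ℝ} {q q1 : E3 → ℝ} {u2 u : E3 × ℝ → ℝ}
    {g2 g : E3 × ℝ → E3 × ℝ →L[ℝ] ℝ} {H : E3 × ℝ → E3 × ℝ →L[ℝ] E3 × ℝ →L[ℝ] ℝ}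
    (h : InverseData R T q q1 u2 u g2 g H)
include h

lemma continuousOn_den : ContinuousOn (den q) {0}ᶜ := by
  have h1 := h.diff_pfun.continuousOn
  have h2 := fun k => continuousOn_rotd h.diff_pfun k
  have h3 := fun k l => continuousOn_rotd_rotd h.diff_pfun k l
  have h4 := h.diff.continuous.continuousOn (s := ({0}ᶜ : Set E3))
  have h5 := fun k => (h.diff.continuous_rotd k).continuousOn (s := ({0}ᶜ : Set E3))
  exact ((((h1.pow 2).add (continuousOn_finsetSum _ fun k _ => (h2 k).pow 2)).add
    (continuousOn_finsetSum _ fun k _ => continuousOn_finsetSum _ fun l _ => (h3 k l).pow 2)).add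
    (h4.pow 2)).add (continuousOn_finsetSum _ fun k _ => (h5 k).pow 2)

lemma slab_den_mono {a ρ : ℝ} (ha : R ≤ a) (haρ : a ≤ ρ) :
    slab R a (fun r ω => den q (r • (ω : E3))) ≤ slab R ρ fun r ω => den q (r • (ω : E3)) :=
  slab_mono_right ha haρ (continuousOn_smul_S2 h.pos h.continuousOn_den)
    fun _ _ _ => den_nonneg _ _

lemma exists_bound : ∃ B, 0 ≤ B ∧ ∀ z ∈ cone, z.2 ≤ T → |q1 z.1| ≤ B ∧ |u2 z| ≤ B ∧
    ∀ k θ, |(q1 (rot k θ z.1) - q1 z.1) / θ| ≤ B ∧ |(u2 (rotST k θ z) - u2 z) / θ| ≤ B := by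
  have hT : 0 ≤ T := (h.pos.trans h.lt).le
  obtain ⟨B1, hB1, b1⟩ := (HasConeGrad.of_contDiff h.diff_one).exists_bound hT
  obtain ⟨B2, hB2, b2⟩ := h.grad_two.exists_bound hT
  refine ⟨B1 + B2, add_nonneg hB1 hB2, fun z hz hzT => ⟨?_, ?_, fun k θ => ⟨?_, ?_⟩⟩⟩
  · exact (b1 z hz hzT).1.trans (le_add_of_nonneg_right hB2)
  · exact (b2 z hz hzT).1.trans (le_add_of_nonneg_left hB1)
  · exact ((b1 z hz hzT).2 k θ).trans (le_add_of_nonneg_right hB2)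
  · exact ((b2 z hz hzT).2 k θ).trans (le_add_of_nonneg_left hB1)

lemma bottom_smul {r : ℝ} (hr : 0 < r) (ω : S2) :
    r * u (r • (ω : E3), r) = pfun q (r • (ω : E3)) := by
  rw [h.bottom, norm_smul_S2 hr]

lemma bottom_tangent {r : ℝ} (hr : 0 < r) (ω : S2) {b : E3} (hb : inner ℝ (ω : E3) b = 0) :
    r * g (r • (ω : E3), r) (b, 0) = fderiv ℝ (pfun q) (r • (ω : E3)) b := by
  rw [h.grad.fderiv_tangent h.bottom (smul_S2_ne_zero hr ω) (by rw [inner_smul_left, hb]; simp),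
    norm_smul_S2 hr]

lemma bottom_radial {r : ℝ} (hr : 0 < r) (ω : S2) :
    u (r • (ω : E3), r) + r * g (r • (ω : E3), r) ((ω : E3), 1) = q (r • (ω : E3)) := by
  rw [← h.grad.fderiv_radial h.bottom hr,
    fderiv_pfun_radial h.diff.continuous h.diff_pfun hr]

lemma exists_slab_sq_le : ∃ C, 0 ≤ C ∧ ∀ ρ ∈ Icc R ((R + T) / 2),
    slab R ρ (fun r ω => (r * u (r • (ω : E3), 2 * ρ - r)) ^ 2) ≤
      C * slab R ρ fun r ω => den q (r • (ω : E3)) := by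
  obtain ⟨B, hB, hb⟩ := h.exists_bound
  have hR := h.pos
  have hT : 0 < T := hR.trans h.lt
  have e0 : 0 < exp (-((B + 2) * T)) := exp_pos _
  have hR2 : 0 < R⁻¹ ^ 2 := by positivity
  refine ⟨(exp (-((B + 2) * T)))⁻¹ * (2 + R⁻¹ ^ 2 + 2 * (T ^ 2 * B ^ 2 * T)), by positivity,
    fun ρ hρ => ?_⟩
  have hρT : 2 * ρ ≤ R + T := by linarith [hρ.2]
  have hN := slab_den_nonneg q hρ.1
  have cden : ∀ {ρ}, _ := fun {ρ} => continuousOn_smul_S2 (ρ := ρ) hR h.continuousOn_den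
  have en := h.jet.energy (h.diff.continuous.comp_continuousOn continuousOn_fst |>.mul
    h.grad_two.continuousOn) hR hρ.1 hρT hB
    (fun z hz hzT => (hb z hz.le hzT.le).1) fun z h1 h2 h3 => h.zero z h1 h2.le h3.le
  set N := slab R ρ fun r ω => den q (r • (ω : E3)) with hNdef
  have b1 : (∫ r in R..ρ, ∫ ω : S2, ((u (r • (ω : E3), r) +
      r * g (r • (ω : E3), r) ((ω : E3), 1)) ^ 2 +
      ∑ k, (r * g (r • (ω : E3), r) (gen k ω, 0)) ^ 2 + (r * u (r • (ω : E3), r)) ^ 2) ∂sph) ≤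
      (2 + R⁻¹ ^ 2) * N := by
    rw [hNdef, ← slab_const_mul]
    have e : ∀ r ∈ Icc R ρ, ∀ ω : S2, ((u (r • (ω : E3), r) +
      r * g (r • (ω : E3), r) ((ω : E3), 1)) ^ 2 +
      ∑ k, (r * g (r • (ω : E3), r) (gen k ω, 0)) ^ 2 + (r * u (r • (ω : E3), r)) ^ 2) =
      q (r • (ω : E3)) ^ 2 + ∑ k, (r⁻¹ * rotd k (pfun q) (r • (ω : E3))) ^ 2 +
        pfun q (r • (ω : E3)) ^ 2 := by
      intro r hr ω
      have hr0 := hR.trans_le hr.1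
      rw [h.bottom_radial hr0, h.bottom_smul hr0]
      simp only [h.bottom_tangent hr0 ω (inner_gen_self _ _), fderiv_pfun_gen q hr0]
    refine (slab_congr hρ.1 e).trans_le (slab_mono hρ.1 ?_ (cden.const_mul _) ?_)
    · have c1 := continuousOn_smul_S2 (ρ := ρ) hR
        (h.diff.continuous.continuousOn (s := ({0}ᶜ : Set E3)))
      have c2 := fun k => continuousOn_smul_S2 (ρ := ρ) hR (continuousOn_rotd h.diff_pfun k)
      have c3 := continuousOn_smul_S2 (ρ := ρ) hR h.diff_pfun.continuousOn
      have c4 : ContinuousOn (fun x : ℝ × S2 => x.1⁻¹) (Icc R ρ ×ˢ univ) :=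
        continuousOn_fst.inv₀ fun x hx => (hR.trans_le hx.1.1).ne'
      exact ((c1.pow 2).add (continuousOn_finsetSum _ fun k _ => (c4.mul (c2 k)).pow 2)).add
        (c3.pow 2)
    · intro r hr ω
      have hr0 := hR.trans_le hr.1
      have i1 : r⁻¹ ^ 2 ≤ R⁻¹ ^ 2 := by gcongr; exact hr.1
      have i2 := sum_sq_rotd_pfun_le_den q (r • (ω : E3))
      have i3 : ∑ k, (r⁻¹ * rotd k (pfun q) (r • (ω : E3))) ^ 2 ≤
          R⁻¹ ^ 2 * den q (r • (ω : E3)) := by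
        simp only [mul_pow]
        rw [← Finset.mul_sum]
        exact mul_le_mul i1 i2 (by positivity) hR2.le
      linarith [sq_le_den q (r • (ω : E3)), sq_pfun_le_den q (r • (ω : E3))]
  have b2 : (∫ a in R..ρ, ∫ r in R..a, ∫ ω : S2,
      (r * (q (r • (ω : E3)) * u2 (r • (ω : E3), 2 * a - r))) ^ 2 ∂sph) ≤
      T ^ 2 * B ^ 2 * N * (ρ - R) := by
    refine intervalIntegral_le_const hρ.1 (fun a ha => ?_) fun a ha => ?_
    · exact slab_nonneg ha.1.le fun _ _ _ => sq_nonneg _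
    · calc _ ≤ slab R a fun r ω => T ^ 2 * B ^ 2 * den q (r • (ω : E3)) := by
            refine slab_mono ha.1.le ?_ (cden.const_mul _) fun r hr ω => ?_
            · have c1 := continuousOn_smul_S2 (ρ := a) hR
                (h.diff.continuous.continuousOn (s := ({0}ᶜ : Set E3)))
              have c2 := continuousOn_cone_top (ρ := a) hR h.grad_two.continuousOn
              exact (continuousOn_fst.mul (c1.mul c2)).pow 2
            · have hr0 := hR.trans_le hr.1
              have hm := coneMap_mem (ρ := a) hR ⟨hr.1, hr.2, le_rfl⟩ ω
              have i1 : |u2 (r • (ω : E3), 2 * a - r)| ≤ B :=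
                (hb _ hm (by change 2 * a - r ≤ T; linarith [hr.1, ha.2])).2.1
              have i2 : r ≤ T := by linarith [hr.2, ha.2, h.lt]
              have i3 : u2 (r • (ω : E3), 2 * a - r) ^ 2 ≤ B ^ 2 :=
                sq_le_sq' (abs_le.1 i1).1 (abs_le.1 i1).2
              rw [mul_pow, mul_pow]
              calc _ = r ^ 2 * u2 (r • (ω : E3), 2 * a - r) ^ 2 * q (r • (ω : E3)) ^ 2 := by ring
                _ ≤ T ^ 2 * B ^ 2 * den q (r • (ω : E3)) := by
                    have := sq_le_den q (r • (ω : E3))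
                    gcongr
        _ = T ^ 2 * B ^ 2 * slab R a fun r ω => den q (r • (ω : E3)) := slab_const_mul _
        _ ≤ T ^ 2 * B ^ 2 * N := by
            have := h.slab_den_mono ha.1.le ha.2
            gcongr
  have b3 : T ^ 2 * B ^ 2 * N * (ρ - R) ≤ T ^ 2 * B ^ 2 * N * T := by
    have : ρ - R ≤ T := by linarith [hρ.2, h.lt]
    gcongr
  have b4 : slab R ρ (fun r ω => (r * u (r • (ω : E3), 2 * ρ - r)) ^ 2) ≤
      ∫ r in R..ρ, ∫ ω : S2, ((r * u (r • (ω : E3), 2 * ρ - r)) ^ 2 +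
        ∑ k, (r * g (r • (ω : E3), 2 * ρ - r) (gen k ω, 0)) ^ 2) ∂sph := by
    have c1 := continuousOn_cone_top (ρ := ρ) hR h.grad.continuousOn
    have c2 := continuousOn_cone_top (ρ := ρ) hR h.grad.cont
    have c3 : ∀ k, ContinuousOn (fun x : ℝ × S2 => ((gen k (x.2 : E3), 0) : E3 × ℝ))
        (Icc R ρ ×ˢ univ) := fun k => by fun_prop
    refine slab_mono hρ.1 ((continuousOn_fst.mul c1).pow 2) (((continuousOn_fst.mul c1).pow 2).add
      (continuousOn_finsetSum _ fun k _ => (continuousOn_fst.mul (c2.clm_apply (c3 k))).pow 2))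
      fun r _ ω => le_add_of_nonneg_right (by positivity)
  rw [mul_assoc, ← div_eq_inv_mul, le_div_iff₀' e0]
  refine (mul_le_mul_of_nonneg_left b4 e0.le).trans (en.trans ?_)
  nlinarith [b1, b2, b3]

end InverseData

lemma rotST_smul (l : Fin 3) (θ r t : ℝ) (ω : E3) :
    rotST l θ (r • ω, t) = (r • rot l θ ω, t) := by
  rw [rotST_apply, map_smul]

lemma continuous_rotST (l : Fin 3) (θ : ℝ) : Continuous (rotST l θ) := (rotST l θ).continuous

lemma inner_rot (l : Fin 3) (θ : ℝ) (x y : E3) :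
    inner ℝ (rot l θ x) (rot l θ y) = inner ℝ x y :=
  (rotIso l θ).inner_map_map x y

lemma add_add_sq_le (a b c : ℝ) : (a + b + c) ^ 2 ≤ 3 * (a ^ 2 + b ^ 2 + c ^ 2) := by
  nlinarith [sq_nonneg (a - b), sq_nonneg (b - c), sq_nonneg (a - c)]

/-- The bound on the source of the rotated difference quotient. -/
lemma sq_rot_source_le {r T B a b c d e s : ℝ} (hr : 0 ≤ r) (hrT : r ≤ T)
    (ha : |a| ≤ B) (hc : |c| ≤ B) (he : |e| ≤ B) :
    (r * (a * b + (d * c + s * e))) ^ 2 ≤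
      3 * B ^ 2 * ((r * b) ^ 2 + (T ^ 2 * d ^ 2 + T ^ 2 * s ^ 2)) := by
  have ha' : a ^ 2 ≤ B ^ 2 := sq_le_sq' (abs_le.1 ha).1 (abs_le.1 ha).2
  have hc' : c ^ 2 ≤ B ^ 2 := sq_le_sq' (abs_le.1 hc).1 (abs_le.1 hc).2
  have he' : e ^ 2 ≤ B ^ 2 := sq_le_sq' (abs_le.1 he).1 (abs_le.1 he).2
  have hr' : r ^ 2 ≤ T ^ 2 := by gcongr
  have h1 : (a * (r * b)) ^ 2 ≤ B ^ 2 * (r * b) ^ 2 := by rw [mul_pow]; gcongr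
  have h2 : (r * d * c) ^ 2 ≤ T ^ 2 * d ^ 2 * B ^ 2 := by rw [mul_pow, mul_pow]; gcongr
  have h3 : (r * s * e) ^ 2 ≤ T ^ 2 * s ^ 2 * B ^ 2 := by rw [mul_pow, mul_pow]; gcongr
  calc _ = (a * (r * b) + r * d * c + r * s * e) ^ 2 := by ring
    _ ≤ _ := add_add_sq_le _ _ _
    _ ≤ _ := by nlinarith

namespace InverseData
variable {R T : ℝ} {q q1 : E3 → ℝ} {u2 u : E3 × ℝ → ℝ}
    {g2 g : E3 × ℝ → E3 × ℝ →L[ℝ] ℝ} {H : E3 × ℝ → E3 × ℝ →L[ℝ] E3 × ℝ →L[ℝ] ℝ}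
    (h : InverseData R T q q1 u2 u g2 g H)
include h

lemma bottom_rot {r : ℝ} (hr : 0 < r) (l : Fin 3) (θ : ℝ) (ω : S2) :
    r * ((u (rotST l θ (r • (ω : E3), r)) - u (r • (ω : E3), r)) / θ) =
      (pfun q (r • rot l θ ω) - pfun q (r • (ω : E3))) / θ := by
  have e := h.bottom_smul hr (sphMap (rotIso l θ) ω)
  rw [coe_sphMap_rotIso] at e
  rw [rotST_smul, ← h.bottom_smul hr ω, ← e]
  ring

lemma bottom_rot_tangent {r : ℝ} (hr : 0 < r) (l : Fin 3) (θ : ℝ) (ω : S2) (k : Fin 3) :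
    r * (θ⁻¹ • ((g (rotST l θ (r • (ω : E3), r))).comp (rotST l θ) - g (r • (ω : E3), r)))
      (gen k ω, 0) = (fderiv ℝ (pfun q) (r • rot l θ ω) (rot l θ (gen k ω)) -
        fderiv ℝ (pfun q) (r • (ω : E3)) (gen k ω)) / θ := by
  have e := h.bottom_tangent hr (sphMap (rotIso l θ) ω) (b := rot l θ (gen k ω))
    (by rw [coe_sphMap_rotIso, inner_rot, inner_gen_self])
  rw [coe_sphMap_rotIso] at e
  rw [← h.bottom_tangent hr ω (inner_gen_self k _), ← e, rotST_smul]
  simp only [smul_apply, sub_apply, ContinuousLinearMap.comp_apply, rotST_apply, smul_eq_mul]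
  ring

lemma bottom_rot_radial {r : ℝ} (hr : 0 < r) (l : Fin 3) (θ : ℝ) (ω : S2) :
    (u (rotST l θ (r • (ω : E3), r)) - u (r • (ω : E3), r)) / θ +
      r * (θ⁻¹ • ((g (rotST l θ (r • (ω : E3), r))).comp (rotST l θ) - g (r • (ω : E3), r)))
        ((ω : E3), 1) = (q (r • rot l θ ω) - q (r • (ω : E3))) / θ := by
  have e := h.bottom_radial hr (sphMap (rotIso l θ) ω)
  rw [coe_sphMap_rotIso] at e
  rw [← h.bottom_radial hr ω, ← e, rotST_smul]
  simp only [smul_apply, sub_apply, ContinuousLinearMap.comp_apply, rotST_apply, smul_eq_mul]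
  ring

lemma continuousOn_source : ContinuousOn (fun z : E3 × ℝ => q z.1 * u2 z) cone :=
  (h.diff.continuous.comp_continuousOn continuousOn_fst).mul h.grad_two.continuousOn

lemma continuousOn_rot_source (l : Fin 3) (θ : ℝ) : ContinuousOn (fun z : E3 × ℝ =>
    ((q1 (rotST l θ z).1 - q1 z.1) * u z + (q (rotST l θ z).1 * u2 (rotST l θ z) -
      q z.1 * u2 z)) / θ) cone := by
  have c1 : Continuous fun z : E3 × ℝ => q1 (rotST l θ z).1 - q1 z.1 :=
    (h.diff_one.continuous.comp (continuous_fst.comp (continuous_rotST l θ))).sub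
      (h.diff_one.continuous.comp continuous_fst)
  have c2 : ContinuousOn (fun z : E3 × ℝ => q (rotST l θ z).1 * u2 (rotST l θ z)) cone :=
    h.continuousOn_source.comp (continuous_rotST l θ).continuousOn
      fun z hz => rotST_mem_cone l θ hz
  exact ((c1.continuousOn.mul h.grad.continuousOn).add
    (c2.sub h.continuousOn_source)).div_const θ

lemma continuousOn_rot_slope {F : E3 → ℝ} (hF : ContinuousOn F {0}ᶜ) (l : Fin 3) (θ : ℝ)
    {ρ : ℝ} : ContinuousOn (fun x : ℝ × S2 =>
      (F (x.1 • rot l θ (x.2 : E3)) - F (x.1 • (x.2 : E3))) / θ) (Icc R ρ ×ˢ univ) := by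
  have c1 := (continuousOn_smul_rot (ρ := ρ) h.pos hF l).comp
    (f := fun x : ℝ × S2 => (θ, x.1, x.2)) (s := Icc R ρ ×ˢ univ) (by fun_prop)
    fun x hx => ⟨mem_univ _, hx⟩
  exact (c1.sub (continuousOn_smul_S2 h.pos hF)).div_const θ

lemma slab_rot_source_le {B C ρ a θ : ℝ}
    (hb : ∀ z ∈ cone, z.2 ≤ T → |q1 z.1| ≤ B ∧ |u2 z| ≤ B ∧
      ∀ k θ, |(q1 (rot k θ z.1) - q1 z.1) / θ| ≤ B ∧ |(u2 (rotST k θ z) - u2 z) / θ| ≤ B)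
    (hC0 : 0 ≤ C)
    (hC : ∀ ρ ∈ Icc R ((R + T) / 2), slab R ρ (fun r ω => (r * u (r • (ω : E3), 2 * ρ - r)) ^ 2) ≤
      C * slab R ρ fun r ω => den q (r • (ω : E3)))
    (hρ : ρ ∈ Icc R ((R + T) / 2)) (ha : a ∈ Ioc R ρ) (l : Fin 3) :
    slab R a (fun r ω => (r * (((q1 (rotST l θ (r • (ω : E3), 2 * a - r)).1 -
      q1 (r • (ω : E3), 2 * a - r).1) * u (r • (ω : E3), 2 * a - r) +
      (q (rotST l θ (r • (ω : E3), 2 * a - r)).1 * u2 (rotST l θ (r • (ω : E3), 2 * a - r)) -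
      q (r • (ω : E3), 2 * a - r).1 * u2 (r • (ω : E3), 2 * a - r))) / θ)) ^ 2) ≤
    3 * B ^ 2 * (C * slab R ρ (fun r ω => den q (r • (ω : E3))) +
      (T ^ 2 * slab R ρ (fun r ω => ((q (r • rot l θ ω) - q (r • (ω : E3))) / θ) ^ 2) +
        T ^ 2 * slab R ρ fun r ω => den q (r • (ω : E3)))) := by
  have hR := h.pos
  have cq := h.diff.continuous.continuousOn (s := ({0}ᶜ : Set E3))
  have c1 := continuousOn_cone_top (ρ := a) hR h.grad.continuousOn
  have c2 := h.continuousOn_rot_slope cq l θ (ρ := a)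
  have c2' := h.continuousOn_rot_slope cq l θ (ρ := ρ)
  have c3 := continuousOn_smul_S2 (ρ := a) hR h.continuousOn_den
  have c4 := continuousOn_cone_top (ρ := a) hR (h.continuousOn_rot_source l θ)
  calc _ ≤ slab R a fun r ω => 3 * B ^ 2 * ((r * u (r • (ω : E3), 2 * a - r)) ^ 2 +
        (T ^ 2 * ((q (r • rot l θ ω) - q (r • (ω : E3))) / θ) ^ 2 +
          T ^ 2 * den q (r • (ω : E3)))) := by
        refine slab_mono ha.1.le ((continuousOn_fst.mul c4).pow 2)
          ((((continuousOn_fst.mul c1).pow 2).add (((c2.pow 2).const_mul _).add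
            (c3.const_mul _))).const_mul _) fun r hr ω => ?_
        have hm := coneMap_mem (ρ := a) hR ⟨hr.1, hr.2, le_rfl⟩ ω
        have hm' := coneMap_mem (ρ := a) hR ⟨hr.1, hr.2, le_rfl⟩ (sphMap (rotIso l θ) ω)
        have ht : 2 * a - r ≤ T := by linarith [hr.1, ha.2, hρ.2]
        have hrT : r ≤ T := by linarith [hr.2, ha.2, hρ.2, h.lt]
        obtain ⟨-, b1, b2⟩ := hb _ hm ht
        obtain ⟨-, b1', -⟩ := hb _ hm' ht
        have key := sq_rot_source_le (b := u (r • (ω : E3), 2 * a - r))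
          (d := (q (r • rot l θ ω) - q (r • (ω : E3))) / θ) (s := q (r • (ω : E3)))
          (hR.trans_le hr.1).le hrT (b2 l θ).1 b1' (b2 l θ).2
        have hs := sq_le_den q (r • (ω : E3))
        simp only [coe_sphMap_rotIso] at key
        rw [rotST_smul]
        rw [rotST_smul, map_smul] at key
        refine le_trans (le_of_eq ?_) (key.trans ?_)
        · ring
        · gcongr
    _ = 3 * B ^ 2 * (slab R a (fun r ω => (r * u (r • (ω : E3), 2 * a - r)) ^ 2) +
      (T ^ 2 * slab R a (fun r ω => ((q (r • rot l θ ω) - q (r • (ω : E3))) / θ) ^ 2) +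
        T ^ 2 * slab R a fun r ω => den q (r • (ω : E3)))) := by
        rw [slab_const_mul, slab_add ha.1.le ((continuousOn_fst.mul c1).pow 2)
          (((c2.pow 2).const_mul _).add (c3.const_mul _)),
          slab_add ha.1.le ((c2.pow 2).const_mul _) (c3.const_mul _), slab_const_mul,
          slab_const_mul]
    _ ≤ _ := by
        have i1 := hC a ⟨ha.1.le, ha.2.trans hρ.2⟩
        have i2 := h.slab_den_mono ha.1.le ha.2
        have i3 := slab_mono_right (f := fun r (ω : S2) =>
          ((q (r • rot l θ ω) - q (r • (ω : E3))) / θ) ^ 2) ha.1.le ha.2 (c2'.pow 2)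
            fun _ _ _ => sq_nonneg _
        have i4 := i1.trans (mul_le_mul_of_nonneg_left i2 hC0)
        gcongr

lemma rot_energy {B C ρ θ : ℝ} (hB : 0 ≤ B)
    (hb : ∀ z ∈ cone, z.2 ≤ T → |q1 z.1| ≤ B ∧ |u2 z| ≤ B ∧
      ∀ k θ, |(q1 (rot k θ z.1) - q1 z.1) / θ| ≤ B ∧ |(u2 (rotST k θ z) - u2 z) / θ| ≤ B)
    (hC0 : 0 ≤ C)
    (hC : ∀ ρ ∈ Icc R ((R + T) / 2), slab R ρ (fun r ω => (r * u (r • (ω : E3), 2 * ρ - r)) ^ 2) ≤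
      C * slab R ρ fun r ω => den q (r • (ω : E3)))
    (hρ : ρ ∈ Icc R ((R + T) / 2)) (l : Fin 3) :
    exp (-((B + 2) * T)) * slab R ρ (fun r ω =>
      ((r * g (r • rot l θ ω, 2 * ρ - r) (gen l (rot l θ ω), 0) -
        r * g (r • (ω : E3), 2 * ρ - r) (gen l ω, 0)) / θ) ^ 2) ≤
    slab R ρ (fun r ω => ((q (r • rot l θ ω) - q (r • (ω : E3))) / θ) ^ 2) +
    ∑ k, slab R ρ (fun r ω => ((fderiv ℝ (pfun q) (r • rot l θ ω) (rot l θ (gen k ω)) -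
        fderiv ℝ (pfun q) (r • (ω : E3)) (gen k ω)) / θ) ^ 2) +
    slab R ρ (fun r ω => ((pfun q (r • rot l θ ω) - pfun q (r • (ω : E3))) / θ) ^ 2) +
    2 * (3 * B ^ 2 * (C * slab R ρ (fun r ω => den q (r • (ω : E3))) +
      (T ^ 2 * slab R ρ (fun r ω => ((q (r • rot l θ ω) - q (r • (ω : E3))) / θ) ^ 2) +
        T ^ 2 * slab R ρ fun r ω => den q (r • (ω : E3)))) * (ρ - R)) := by
  have hR := h.pos
  have hρT : 2 * ρ ≤ R + T := by linarith [hρ.2]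
  obtain ⟨H', hj⟩ := h.jet.rotDiff l θ
  have en := hj.energy (h.continuousOn_rot_source l θ) hR hρ.1 hρT hB
    (fun z hz hzT => (hb _ (rotST_mem_cone l θ hz.le) hzT.le).1) fun z h1 h2 h3 => by
      rw [h.zero z h1 h2.le h3.le, h.zero (rotST l θ z) ((norm_rot l θ z.1).trans h1) h2.le h3.le]
      simp
  have cg := continuousOn_cone_top (ρ := ρ) hR hj.cont_grad
  have cv := continuousOn_cone_top (ρ := ρ) hR hj.cont_fun
  have ck : ∀ k, ContinuousOn (fun x : ℝ × S2 => ((gen k (x.2 : E3), 0) : E3 × ℝ))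
      (Icc R ρ ×ˢ univ) := fun k => by fun_prop
  have left : slab R ρ (fun r ω =>
      ((r * g (r • rot l θ ω, 2 * ρ - r) (gen l (rot l θ ω), 0) -
        r * g (r • (ω : E3), 2 * ρ - r) (gen l ω, 0)) / θ) ^ 2) =
      slab R ρ fun r ω => (r * (θ⁻¹ • ((g (rotST l θ (r • (ω : E3), 2 * ρ - r))).comp (rotST l θ) -
        g (r • (ω : E3), 2 * ρ - r))) (gen l ω, 0)) ^ 2 := by
    refine slab_congr hρ.1 fun r _ ω => ?_
    rw [rotST_smul]
    simp only [smul_apply, sub_apply, ContinuousLinearMap.comp_apply, rotST_apply, smul_eq_mul,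
      rot_gen]
    ring
  have left_le : slab R ρ (fun r ω => (r * (θ⁻¹ • ((g (rotST l θ
      (r • (ω : E3), 2 * ρ - r))).comp (rotST l θ) - g (r • (ω : E3), 2 * ρ - r)))
        (gen l ω, 0)) ^ 2) ≤ ∫ r in R..ρ, ∫ ω : S2, ((r * ((u (rotST l θ
      (r • (ω : E3), 2 * ρ - r)) - u (r • (ω : E3), 2 * ρ - r)) / θ)) ^ 2 +
      ∑ k, (r * (θ⁻¹ • ((g (rotST l θ (r • (ω : E3), 2 * ρ - r))).comp (rotST l θ) -
        g (r • (ω : E3), 2 * ρ - r))) (gen k ω, 0)) ^ 2) ∂sph := by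
    refine slab_mono hρ.1 ((continuousOn_fst.mul (cg.clm_apply (ck l))).pow 2)
      (((continuousOn_fst.mul cv).pow 2).add (continuousOn_finsetSum Finset.univ
        fun k _ => (continuousOn_fst.mul (cg.clm_apply (ck k))).pow 2)) fun r _ ω => ?_
    exact (Finset.single_le_sum (f := fun k => (r * (θ⁻¹ • ((g (rotST l θ
      (r • (ω : E3), 2 * ρ - r))).comp (rotST l θ) - g (r • (ω : E3), 2 * ρ - r)))
        (gen k ω, 0)) ^ 2) (fun _ _ => sq_nonneg _) (Finset.mem_univ l)).trans
      (le_add_of_nonneg_left (sq_nonneg _))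
  have cq := h.continuousOn_rot_slope (h.diff.continuous.continuousOn) l θ (ρ := ρ)
  have cp := h.continuousOn_rot_slope h.diff_pfun.continuousOn l θ (ρ := ρ)
  have right : (∫ r in R..ρ, ∫ ω : S2,
      (((u (rotST l θ (r • (ω : E3), r)) - u (r • (ω : E3), r)) / θ +
      r * (θ⁻¹ • ((g (rotST l θ (r • (ω : E3), r))).comp (rotST l θ) - g (r • (ω : E3), r)))
        ((ω : E3), 1)) ^ 2 +
      ∑ k, (r * (θ⁻¹ • ((g (rotST l θ (r • (ω : E3), r))).comp (rotST l θ) - g (r • (ω : E3), r)))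
        (gen k ω, 0)) ^ 2 +
      (r * ((u (rotST l θ (r • (ω : E3), r)) - u (r • (ω : E3), r)) / θ)) ^ 2) ∂sph) =
      slab R ρ (fun r ω => ((q (r • rot l θ ω) - q (r • (ω : E3))) / θ) ^ 2) +
    ∑ k, slab R ρ (fun r ω => ((fderiv ℝ (pfun q) (r • rot l θ ω) (rot l θ (gen k ω)) -
        fderiv ℝ (pfun q) (r • (ω : E3)) (gen k ω)) / θ) ^ 2) +
    slab R ρ (fun r ω => ((pfun q (r • rot l θ ω) - pfun q (r • (ω : E3))) / θ) ^ 2) := by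
    have cd : ∀ k, ContinuousOn (fun x : ℝ × S2 =>
        (fderiv ℝ (pfun q) (x.1 • rot l θ (x.2 : E3)) (rot l θ (gen k (x.2 : E3))) -
        fderiv ℝ (pfun q) (x.1 • (x.2 : E3)) (gen k (x.2 : E3))) / θ) (Icc R ρ ×ˢ univ) := by
      intro k
      have c0 := (contDiffOn_fderiv_compl h.diff_pfun).continuousOn
      have c1 := (continuousOn_smul_rot (ρ := ρ) hR c0 l).comp
        (f := fun x : ℝ × S2 => (θ, x.1, x.2)) (s := Icc R ρ ×ˢ univ) (by fun_prop)
        fun x hx => ⟨mem_univ _, hx⟩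
      have c2 : Continuous fun x : ℝ × S2 => gen k (x.2 : E3) := by fun_prop
      have c3 : Continuous fun x : ℝ × S2 => rot l θ (gen k (x.2 : E3)) :=
        (rot l θ).continuous.comp c2
      exact ((c1.clm_apply c3.continuousOn).sub
        ((continuousOn_smul_S2 hR c0).clm_apply c2.continuousOn)).div_const θ
    rw [← slab_sum hρ.1 fun k => (cd k).pow 2, ← slab_add hρ.1 (cq.pow 2)
      (continuousOn_finsetSum _ fun k _ => (cd k).pow 2),
      ← slab_add hρ.1 ((cq.pow 2).add (continuousOn_finsetSum _ fun k _ => (cd k).pow 2))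
      (cp.pow 2)]
    refine slab_congr hρ.1 fun r hr ω => ?_
    have hr0 := hR.trans_le hr.1
    rw [h.bottom_rot_radial hr0, h.bottom_rot hr0]
    simp only [h.bottom_rot_tangent hr0]
  have src := intervalIntegral_le_const hρ.1
    (fun a ha => slab_nonneg ha.1.le fun _ _ _ => sq_nonneg _)
    fun a ha => h.slab_rot_source_le (θ := θ) hb hC0 hC hρ ha l
  rw [left]
  refine (mul_le_mul_of_nonneg_left left_le (exp_pos _).le).trans (en.trans ?_)
  exact add_le_add right.le (mul_le_mul_of_nonneg_left src zero_le_two)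

lemma sq_second_fderiv_le {r : ℝ} (hr : R ≤ r) (k l : Fin 3) (ω : S2) :
    (r * fderiv ℝ (fderiv ℝ (pfun q)) (r • (ω : E3)) (gen l ω) (gen k ω) +
      fderiv ℝ (pfun q) (r • (ω : E3)) (gen l (gen k ω))) ^ 2 ≤
      4 * R⁻¹ ^ 2 * den q (r • (ω : E3)) := by
  have hr0 := h.pos.trans_le hr
  obtain ⟨m, s, hs, hm⟩ := gen_commutator k l
  have e1 := rotd_rotd h.diff_pfun k l (smul_S2_ne_zero hr0 ω)
  have e2 : rotd m (pfun q) (r • (ω : E3)) = r * fderiv ℝ (pfun q) (r • (ω : E3)) (gen m ω) := by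
    rw [rotd, map_smul, map_smul, smul_eq_mul]
  have e3 := congrArg (fderiv ℝ (pfun q) (r • (ω : E3))) (hm ω)
  simp only [map_smul, map_sub, smul_apply, smul_eq_mul] at e1 e3
  have e4 : r * fderiv ℝ (fderiv ℝ (pfun q)) (r • (ω : E3)) (gen l ω) (gen k ω) +
      fderiv ℝ (pfun q) (r • (ω : E3)) (gen l (gen k ω)) =
      r⁻¹ * (rotd l (rotd k (pfun q)) (r • (ω : E3)) + s * rotd m (pfun q) (r • (ω : E3))) := by
    rw [e1, e2]
    field_simp
    linear_combination e3
  have i1 : r⁻¹ ^ 2 ≤ R⁻¹ ^ 2 := by gcongr; exact h.pos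
  have i2 := sq_rotd_rotd_le_den q (r • (ω : E3)) k l
  have i3 := sq_rotd_pfun_le_den q (r • (ω : E3)) m
  have i4 : (s * rotd m (pfun q) (r • (ω : E3))) ^ 2 ≤ den q (r • (ω : E3)) := by
    rw [mul_pow]
    exact (mul_le_of_le_one_left (sq_nonneg _) hs).trans i3
  rw [e4, mul_pow, mul_comm 4, mul_assoc]
  refine mul_le_mul i1 ?_ (sq_nonneg _) (sq_nonneg _)
  exact add_sq_le.trans (by linarith)

lemma exists_slab_second_le : ∃ C, 0 ≤ C ∧ ∀ ρ ∈ Icc R ((R + T) / 2), ∀ l,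
    slab R ρ (fun r ω => (r * (r * H (r • (ω : E3), 2 * ρ - r) (gen l ω, 0) (gen l ω, 0) +
        g (r • (ω : E3), 2 * ρ - r) (gen l (gen l ω), 0))) ^ 2) ≤
      C * slab R ρ fun r ω => den q (r • (ω : E3)) := by
  obtain ⟨B, hB, hb⟩ := h.exists_bound
  obtain ⟨C, hC0, hC⟩ := h.exists_slab_sq_le
  have hR := h.pos
  have hT : 0 < T := hR.trans h.lt
  have e0 : 0 < exp (-((B + 2) * T)) := exp_pos _
  have hR2 : 0 < R⁻¹ ^ 2 := by positivity
  refine ⟨(exp (-((B + 2) * T)))⁻¹ * (2 + 3 * (4 * R⁻¹ ^ 2) +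
    2 * (3 * B ^ 2 * (C + (T ^ 2 + T ^ 2)) * T)), by positivity, fun ρ hρ l => ?_⟩
  have hN := slab_den_nonneg q hρ.1
  have cden := continuousOn_smul_S2 (ρ := ρ) hR h.continuousOn_den
  have cp := h.diff_pfun
  have t1 := tendsto_slab_slope_grad hR hρ.1 l h.grad.cont h.jet.cont_hess h.hess
  have t2 := tendsto_slab_slope_fun hR hρ.1 l h.diff.contDiffOn
  have t3 := tendsto_slab_slope_fun hR hρ.1 l (cp.of_le one_le_two)
  have t4 := fun k => tendsto_slab_slope_fderiv hR hρ.1 l cp k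
  have lim := le_of_tendsto_of_tendsto (t1.const_mul (exp (-((B + 2) * T))))
    (((t2.add (tendsto_finsetSum Finset.univ fun k _ => t4 k)).add t3).add
      (((((t2.const_mul (T ^ 2)).add_const _).const_add _).const_mul (3 * B ^ 2)).mul_const
        (ρ - R) |>.const_mul 2))
    (Eventually.of_forall fun θ => h.rot_energy (θ := θ) hB hb hC0 hC hρ l)
  set N := slab R ρ fun r ω => den q (r • (ω : E3)) with hNdef
  have b2 : slab R ρ (fun r ω => rotd l q (r • (ω : E3)) ^ 2) ≤ N :=
    slab_mono hρ.1 ((continuousOn_smul_S2 hR (h.diff.continuous_rotd l).continuousOn).pow 2) cden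
      fun r _ ω => sq_rotd_le_den q _ l
  have b3 : slab R ρ (fun r ω => rotd l (pfun q) (r • (ω : E3)) ^ 2) ≤ N :=
    slab_mono hρ.1 ((continuousOn_smul_S2 hR (continuousOn_rotd cp l)).pow 2) cden
      fun r _ ω => sq_rotd_pfun_le_den q _ l
  have b4 : ∀ k, slab R ρ (fun r ω =>
      (r * fderiv ℝ (fderiv ℝ (pfun q)) (r • (ω : E3)) (gen l ω) (gen k ω) +
        fderiv ℝ (pfun q) (r • (ω : E3)) (gen l (gen k ω))) ^ 2) ≤ 4 * R⁻¹ ^ 2 * N := by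
    intro k
    rw [hNdef, ← slab_const_mul]
    refine slab_mono hρ.1 ?_ (cden.const_mul _) fun r hr ω => h.sq_second_fderiv_le hr.1 k l ω
    have k1 := continuousOn_smul_S2 (ρ := ρ) hR (continuousOn_fderiv_fderiv_compl cp)
    have k2 := continuousOn_smul_S2 (ρ := ρ) hR (contDiffOn_fderiv_compl cp).continuousOn
    have k3 : ∀ k, Continuous fun x : ℝ × S2 => gen k (x.2 : E3) := fun k => by fun_prop
    have k4 : Continuous fun x : ℝ × S2 => gen l (gen k (x.2 : E3)) := by fun_prop
    exact ((continuousOn_fst.mul ((k1.clm_apply (k3 l).continuousOn).clm_apply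
      (k3 k).continuousOn)).add (k2.clm_apply k4.continuousOn)).pow 2
  have b5 := Finset.sum_le_card_nsmul Finset.univ _ _ fun k _ => b4 k
  rw [Finset.card_univ, Fintype.card_fin, nsmul_eq_mul] at b5
  have b6 : 3 * B ^ 2 * (C * N + (T ^ 2 * slab R ρ (fun r ω => rotd l q (r • (ω : E3)) ^ 2) +
      T ^ 2 * N)) * (ρ - R) ≤ 3 * B ^ 2 * (C * N + (T ^ 2 * N + T ^ 2 * N)) * T := by
    have i1 : ρ - R ≤ T := by linarith [hρ.2, h.lt]
    have i2 : 0 ≤ ρ - R := sub_nonneg.2 hρ.1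
    gcongr
  rw [mul_assoc, ← div_eq_inv_mul, le_div_iff₀' e0]
  refine lim.trans ?_
  push_cast at b5
  linarith

end InverseData

lemma sq_intervalIntegral_le {k : ℝ → ℝ} (hk : Continuous k) {a b : ℝ} (h : a ≤ b) :
    (∫ x in a..b, k x) ^ 2 ≤ (b - a) * ∫ x in a..b, k x ^ 2 := by
  rcases h.eq_or_lt with rfl | h
  · simp
  have hL : 0 < b - a := sub_pos.2 h
  set I := ∫ x in a..b, k x with hI
  set m := I / (b - a) with hm
  have h0 : 0 ≤ ∫ x in a..b, (k x - m) ^ 2 :=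
    intervalIntegral.integral_nonneg h.le fun _ _ => sq_nonneg _
  have i1 : IntervalIntegrable (fun x => k x ^ 2) volume a b := (hk.pow 2).intervalIntegrable _ _
  have i2 : IntervalIntegrable (fun x => 2 * m * k x) volume a b :=
    (continuous_const.mul hk).intervalIntegrable _ _
  have i3 : IntervalIntegrable (fun _ => m ^ 2) volume a b :=
    continuous_const.intervalIntegrable _ _
  have e : (∫ x in a..b, (k x - m) ^ 2) = (∫ x in a..b, k x ^ 2) - 2 * m * I + (b - a) * m ^ 2 := by
    rw [hI, ← intervalIntegral.integral_const_mul, ← intervalIntegral.integral_sub i1 i2,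
      ← smul_eq_mul (b - a), ← intervalIntegral.integral_const,
      ← intervalIntegral.integral_add (i1.sub i2) i3]
    exact intervalIntegral.integral_congr fun x _ => by ring
  have e2 : I = m * (b - a) := by rw [hm, div_mul_cancel₀ _ hL.ne']
  rw [e, e2] at h0
  rw [e2]
  nlinarith

lemma integral_sq_intervalIntegral_le {R ρ : ℝ} (h : R ≤ ρ) {k : ℝ → S2 → ℝ}
    (hk : ContinuousOn (fun x : ℝ × S2 => k x.1 x.2) (Icc R ρ ×ˢ univ)) :
    ∫ ω, (∫ r in R..ρ, k r ω) ^ 2 ∂sph ≤ (ρ - R) * slab R ρ fun r ω => k r ω ^ 2 := by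
  obtain ⟨k', ck, ek⟩ := exists_continuous_eqOn_Icc h (k := fun ω r => k r ω)
    (hk.comp (f := fun x : S2 × ℝ => (x.2, x.1)) (by fun_prop) fun x hx => ⟨hx.2, hx.1⟩)
  have e1 : ∀ ω, ∫ r in R..ρ, k r ω = ∫ r in R..ρ, k' ω r := fun ω =>
    intervalIntegral.integral_congr fun r hr => by
      rw [uIcc_of_le h] at hr
      exact (ek ω r hr.1 hr.2).symm
  have e2 : slab R ρ (fun r ω => k r ω ^ 2) = slab R ρ fun r ω => k' ω r ^ 2 :=
    slab_congr h fun r hr ω => by rw [ek ω r hr.1 hr.2]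
  have c1 : Continuous fun ω => ∫ r in R..ρ, k' ω r :=
    intervalIntegral.continuous_parametric_intervalIntegral_of_continuous' ck _ _
  have c2 : Continuous fun x : S2 × ℝ => k' x.1 x.2 ^ 2 := ck.pow 2
  have c3 : Continuous fun ω => ∫ r in R..ρ, k' ω r ^ 2 :=
    intervalIntegral.continuous_parametric_intervalIntegral_of_continuous'
      (f := fun ω r => k' ω r ^ 2) c2 _ _
  simp only [e1]
  rw [e2, slab, ← integral_sph_intervalIntegral_swap (k := fun ω r => k' ω r ^ 2) c2,
    ← integral_const_mul]
  refine integral_mono (integrable_sph (c1.pow 2)) (integrable_sph (c3.const_mul (ρ - R)))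
    fun ω => ?_
  exact sq_intervalIntegral_le (ck.comp (by fun_prop : Continuous fun r => (ω, r))) h

lemma IsWaveJet.hasDerivAt_radial {c f v : E3 × ℝ → ℝ} {g : E3 × ℝ → E3 × ℝ →L[ℝ] ℝ}
    {H : E3 × ℝ → E3 × ℝ →L[ℝ] E3 × ℝ →L[ℝ] ℝ} (hj : IsWaveJet c f v g H) {R r ρ : ℝ}
    (hR : 0 < R) (h1 : R ≤ r) (h2 : r < ρ) (ω : S2) :
    HasDerivAt (fun r => v (r • (ω : E3), 2 * ρ - r) +
        r * g (r • (ω : E3), 2 * ρ - r) ((ω : E3), 1))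
      (-(∑ k, (r * H (r • (ω : E3), 2 * ρ - r) (gen k ω, 0) (gen k ω, 0) +
          g (r • (ω : E3), 2 * ρ - r) (gen k (gen k ω), 0)) +
        r * (c (r • (ω : E3), 2 * ρ - r) * v (r • (ω : E3), 2 * ρ - r) +
          f (r • (ω : E3), 2 * ρ - r)))) r := by
  have hi := coneMap_interior hR h1 h2 ω
  have hz := hasDerivAt_coneMap_left ω r ρ
  have d1 := hj.hasDerivAt_fun hz hi
  have d2 := hj.hasDerivAt_grad hz hi ((ω : E3), 1)
  refine (d1.add ((hasDerivAt_id r).mul d2)).congr_deriv ?_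
  have htr := sum_bilin_gen ((H (coneMap ω r ρ)).bilinearComp
    (ContinuousLinearMap.inl ℝ E3 ℝ) (ContinuousLinearMap.inl ℝ E3 ℝ)) (ω : E3)
  simp only [ContinuousLinearMap.bilinearComp_apply, ContinuousLinearMap.inl_apply,
    norm_S2, one_pow, one_mul] at htr
  have hpde := hj.pde _ hi
  have hs := hj.symm _ hi ((ω : E3), 0) (0, 1)
  have hgg : ∑ k, g (coneMap ω r ρ) (gen k (gen k (ω : E3)), 0) =
      -2 * g (coneMap ω r ρ) ((ω : E3), 0) := by
    rw [← map_sum, ← smul_eq_mul, ← map_smul]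
    congr 1
    have := sum_gen_gen (ω : E3)
    ext1
    · simpa [Prod.fst_sum] using this
    · simp [Prod.snd_sum]
  have e : (((ω : E3), 1) : E3 × ℝ) = ((ω : E3), 0) + (0, 1) := by simp
  change g (coneMap ω r ρ) (((ω : E3), (0:ℝ)) - (0, 1)) + (1 * g (coneMap ω r ρ) ((ω : E3), 1) +
    r * H (coneMap ω r ρ) (((ω : E3), (0:ℝ)) - (0, 1)) ((ω : E3), 1)) =
    -(∑ k, (r * H (coneMap ω r ρ) (gen k ω, 0) (gen k ω, 0) +
      g (coneMap ω r ρ) (gen k (gen k ω), 0)) +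
      r * (c (coneMap ω r ρ) * v (coneMap ω r ρ) + f (coneMap ω r ρ)))
  rw [Finset.sum_add_distrib, hgg, ← Finset.mul_sum, ← hpde, e]
  simp only [map_sub, map_add, sub_apply, hs]
  linear_combination r * htr

namespace InverseData
variable {R T : ℝ} {q q1 : E3 → ℝ} {u2 u : E3 × ℝ → ℝ}
    {g2 g : E3 × ℝ → E3 × ℝ →L[ℝ] ℝ} {H : E3 × ℝ → E3 × ℝ →L[ℝ] E3 × ℝ →L[ℝ] ℝ}
    (h : InverseData R T q q1 u2 u g2 g H)
include h

lemma radial_eq_zero {t : ℝ} (h1 : R < t) (h2 : t < T) (ω : S2) :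
    u (R • (ω : E3), t) + R * g (R • (ω : E3), t) ((ω : E3), 1) = 0 := by
  have hR := h.pos
  have hn := norm_smul_S2 hR ω
  have e1 := h.zero (R • (ω : E3), t) hn h1.le h2.le
  have e2 := h.zero_grad (R • (ω : E3), t) hn h1 h2
  simp only [hn, inv_smul_smul₀ hR.ne'] at e2
  have d : HasDerivAt (fun t => u (R • (ω : E3), t)) (g (R • (ω : E3), t) (0, 1)) t :=
    h.grad.hasDerivAt ((hasDerivAt_const t _).prodMk (hasDerivAt_id t))
      (by filter_upwards [lt_mem_nhds h1] with s hs using hn.le.trans hs.le)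
  have d0 : HasDerivAt (fun t => u (R • (ω : E3), t)) 0 t := by
    refine (hasDerivAt_const t 0).congr_of_eventuallyEq ?_
    filter_upwards [lt_mem_nhds h1, gt_mem_nhds h2] with s hs hs'
      using h.zero (R • (ω : E3), s) hn hs.le hs'.le
  have e3 := d.unique d0
  have e : (((ω : E3), 1) : E3 × ℝ) = ((ω : E3), 0) + (0, 1) := by simp
  rw [e1, e, map_add, e2, e3]
  simp

lemma continuousOn_second {ρ : ℝ} (k : Fin 3) : ContinuousOn (fun x : ℝ × S2 =>
    x.1 * H (x.1 • (x.2 : E3), 2 * ρ - x.1) (gen k x.2, 0) (gen k x.2, 0) +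
      g (x.1 • (x.2 : E3), 2 * ρ - x.1) (gen k (gen k x.2), 0)) (Icc R ρ ×ˢ univ) := by
  have c1 := continuousOn_cone_top (ρ := ρ) h.pos h.jet.cont_hess
  have c2 := continuousOn_cone_top (ρ := ρ) h.pos h.grad.cont
  have c3 : Continuous fun x : ℝ × S2 => ((gen k (x.2 : E3), 0) : E3 × ℝ) := by fun_prop
  have c4 : Continuous fun x : ℝ × S2 => ((gen k (gen k (x.2 : E3)), 0) : E3 × ℝ) := by fun_prop
  exact (continuousOn_fst.mul ((c1.clm_apply c3.continuousOn).clm_apply c3.continuousOn)).add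
    (c2.clm_apply c4.continuousOn)

lemma continuousOn_radial_deriv {ρ : ℝ} : ContinuousOn (fun x : ℝ × S2 =>
    ∑ k, (x.1 * H (x.1 • (x.2 : E3), 2 * ρ - x.1) (gen k x.2, 0) (gen k x.2, 0) +
      g (x.1 • (x.2 : E3), 2 * ρ - x.1) (gen k (gen k x.2), 0)) +
    x.1 * (q1 (x.1 • (x.2 : E3)) * u (x.1 • (x.2 : E3), 2 * ρ - x.1) +
      q (x.1 • (x.2 : E3)) * u2 (x.1 • (x.2 : E3), 2 * ρ - x.1))) (Icc R ρ ×ˢ univ) := by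
  have c1 := continuousOn_cone_top (ρ := ρ) h.pos h.grad.continuousOn
  have c2 := continuousOn_cone_top (ρ := ρ) h.pos h.grad_two.continuousOn
  have c3 := continuousOn_smul_S2 (ρ := ρ) h.pos (h.diff_one.continuous.continuousOn)
  have c4 := continuousOn_smul_S2 (ρ := ρ) h.pos (h.diff.continuous.continuousOn)
  exact (continuousOn_finsetSum _ fun k _ => h.continuousOn_second k).add
    (continuousOn_fst.mul ((c3.mul c1).add (c4.mul c2)))

lemma eq_integral {ρ : ℝ} (hρ : ρ ∈ Ioo R ((R + T) / 2)) (ω : S2) : q (ρ • (ω : E3)) =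
    -∫ r in R..ρ, (∑ k, (r * H (r • (ω : E3), 2 * ρ - r) (gen k ω, 0) (gen k ω, 0) +
          g (r • (ω : E3), 2 * ρ - r) (gen k (gen k ω), 0)) +
        r * (q1 (r • (ω : E3)) * u (r • (ω : E3), 2 * ρ - r) +
          q (r • (ω : E3)) * u2 (r • (ω : E3), 2 * ρ - r))) := by
  have hs : ContinuousOn (fun r : ℝ => (r, ω)) (Icc R ρ) := by fun_prop
  have hm : MapsTo (fun r : ℝ => (r, ω)) (Icc R ρ) (Icc R ρ ×ˢ univ) := fun r hr => ⟨hr, mem_univ _⟩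
  have c1 := continuousOn_cone_top (ρ := ρ) h.pos h.grad.continuousOn
  have c2 := continuousOn_cone_top (ρ := ρ) h.pos h.grad.cont
  have c3 : Continuous fun x : ℝ × S2 => (((x.2 : E3), 1) : E3 × ℝ) := by fun_prop
  have c4 : ContinuousOn (fun r => u (r • (ω : E3), 2 * ρ - r) +
      r * g (r • (ω : E3), 2 * ρ - r) ((ω : E3), 1)) (Icc R ρ) :=
    (c1.add (continuousOn_fst.mul (c2.clm_apply c3.continuousOn))).comp hs hm
  have c5 := (h.continuousOn_radial_deriv (ρ := ρ)).comp hs hm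
  have key := intervalIntegral.integral_eq_sub_of_hasDerivAt_of_le hρ.1.le c4
    (fun r hr => h.jet.hasDerivAt_radial h.pos hr.1.le hr.2 ω)
    (ContinuousOn.intervalIntegrable (by rw [uIcc_of_le hρ.1.le]; exact c5.neg))
  rw [intervalIntegral.integral_neg] at key
  rw [key, h.radial_eq_zero (by linarith [hρ.1]) (by linarith [hρ.2]), sub_zero,
    show 2 * ρ - ρ = ρ by ring, h.bottom_radial (h.pos.trans hρ.1)]

lemma exists_integral_sq_le : ∃ C, 0 ≤ C ∧ ∀ ρ ∈ Ioo R ((R + T) / 2),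
    ∫ ω : S2, q (ρ • (ω : E3)) ^ 2 ∂sph ≤ C * slab R ρ fun r ω => den q (r • (ω : E3)) := by
  obtain ⟨B, hB, hb⟩ := h.exists_bound
  obtain ⟨C, hC0, hC⟩ := h.exists_slab_sq_le
  obtain ⟨C', hC0', hC'⟩ := h.exists_slab_second_le
  have hR := h.pos
  have hT : 0 < T := hR.trans h.lt
  have hR2 : 0 < R⁻¹ ^ 2 := by positivity
  refine ⟨T * (6 * R⁻¹ ^ 2 * (3 * C') + 6 * B ^ 2 * (C + T ^ 2)), by positivity, fun ρ hρ => ?_⟩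
  have hρ' : ρ ∈ Icc R ((R + T) / 2) := Ioo_subset_Icc_self hρ
  have hN := slab_den_nonneg q hρ'.1
  have cden := continuousOn_smul_S2 (ρ := ρ) hR h.continuousOn_den
  have c1 := continuousOn_cone_top (ρ := ρ) h.pos h.grad.continuousOn
  have c2 := fun k => h.continuousOn_second (ρ := ρ) k
  simp only [h.eq_integral hρ, neg_sq]
  refine (integral_sq_intervalIntegral_le hρ'.1 h.continuousOn_radial_deriv).trans ?_
  have i1 : ρ - R ≤ T := by linarith [hρ'.2, h.lt]
  rw [mul_assoc]
  refine mul_le_mul i1 ?_ (slab_nonneg hρ'.1 fun _ _ _ => sq_nonneg _) hT.le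
  calc _ ≤ slab R ρ fun r ω => 6 * R⁻¹ ^ 2 * (∑ k,
        (r * (r * H (r • (ω : E3), 2 * ρ - r) (gen k ω, 0) (gen k ω, 0) +
          g (r • (ω : E3), 2 * ρ - r) (gen k (gen k ω), 0))) ^ 2) +
        6 * B ^ 2 * ((r * u (r • (ω : E3), 2 * ρ - r)) ^ 2 + T ^ 2 * den q (r • (ω : E3))) := by
        refine slab_mono hρ'.1 (h.continuousOn_radial_deriv.pow 2)
          (((continuousOn_finsetSum _ fun k _ => (continuousOn_fst.mul (c2 k)).pow 2).const_mul
            _).add ((((continuousOn_fst.mul c1).pow 2).add (cden.const_mul _)).const_mul _))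
          fun r hr ω => ?_
        have hr0 := hR.trans_le hr.1
        have hm := coneMap_mem (ρ := ρ) hR ⟨hr.1, hr.2, le_rfl⟩ ω
        obtain ⟨b1, b2, -⟩ := hb _ hm (by change 2 * ρ - r ≤ T; linarith [hr.1, hρ'.2])
        have hrT : r ≤ T := by linarith [hr.2, hρ'.2, h.lt]
        have hq := sq_le_den q (r • (ω : E3))
        simp only [Fin.sum_univ_three]
        generalize r * H (r • (ω : E3), 2 * ρ - r) (gen 0 ω, 0) (gen 0 ω, 0) +
          g (r • (ω : E3), 2 * ρ - r) (gen 0 (gen 0 ω), 0) = x0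
        generalize r * H (r • (ω : E3), 2 * ρ - r) (gen 1 ω, 0) (gen 1 ω, 0) +
          g (r • (ω : E3), 2 * ρ - r) (gen 1 (gen 1 ω), 0) = x1
        generalize r * H (r • (ω : E3), 2 * ρ - r) (gen 2 ω, 0) (gen 2 ω, 0) +
          g (r • (ω : E3), 2 * ρ - r) (gen 2 (gen 2 ω), 0) = x2
        have s1 := sq_rot_source_le (b := u (r • (ω : E3), 2 * ρ - r)) (d := q (r • (ω : E3)))
          (s := 0) (e := 0) hr0.le hrT b1 b2 (by simpa using hB)
        have s2 : ∀ x : ℝ, x ^ 2 ≤ R⁻¹ ^ 2 * (r * x) ^ 2 := fun x => by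
          have e : x ^ 2 = r⁻¹ ^ 2 * (r * x) ^ 2 := by field_simp
          rw [e]
          gcongr
          exact hr.1
        have s3 := add_add_sq_le x0 x1 x2
        have s4 := add_sq_le (a := x0 + x1 + x2) (b := r * (q1 (r • (ω : E3)) *
          u (r • (ω : E3), 2 * ρ - r) + q (r • (ω : E3)) * u2 (r • (ω : E3), 2 * ρ - r)))
        have s5 := mul_le_mul_of_nonneg_left hq (by positivity : 0 ≤ 6 * B ^ 2 * T ^ 2)
        have s6 : q1 (r • (ω : E3)) * u (r • (ω : E3), 2 * ρ - r) +
            (q (r • (ω : E3)) * u2 (r • (ω : E3), 2 * ρ - r) + 0 * 0) =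
            q1 (r • (ω : E3)) * u (r • (ω : E3), 2 * ρ - r) +
            q (r • (ω : E3)) * u2 (r • (ω : E3), 2 * ρ - r) := by ring
        rw [s6] at s1
        linarith [s2 x0, s2 x1, s2 x2]
    _ = 6 * R⁻¹ ^ 2 * (∑ k, slab R ρ fun r ω =>
        (r * (r * H (r • (ω : E3), 2 * ρ - r) (gen k ω, 0) (gen k ω, 0) +
          g (r • (ω : E3), 2 * ρ - r) (gen k (gen k ω), 0))) ^ 2) +
        6 * B ^ 2 * (slab R ρ (fun r ω => (r * u (r • (ω : E3), 2 * ρ - r)) ^ 2) +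
          T ^ 2 * slab R ρ fun r ω => den q (r • (ω : E3))) := by
        rw [slab_add hρ'.1 ((continuousOn_finsetSum _ fun k _ =>
            (continuousOn_fst.mul (c2 k)).pow 2).const_mul _)
          ((((continuousOn_fst.mul c1).pow 2).add (cden.const_mul _)).const_mul _),
          slab_const_mul, slab_const_mul, slab_sum hρ'.1 fun k =>
            (continuousOn_fst.mul (c2 k)).pow 2, slab_add hρ'.1 ((continuousOn_fst.mul c1).pow 2)
              (cden.const_mul _), slab_const_mul]
    _ ≤ _ := by
        have b5 := Finset.sum_le_card_nsmul Finset.univ _ _ fun k _ => hC' ρ hρ' k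
        rw [Finset.card_univ, Fintype.card_fin, nsmul_eq_mul] at b5
        push_cast at b5
        have b6 := hC ρ hρ'
        rw [add_mul]
        refine add_le_add ?_ ?_
        · rw [mul_assoc (6 * R⁻¹ ^ 2), mul_assoc 3]
          gcongr
        · rw [mul_assoc (6 * B ^ 2), add_mul]
          gcongr

end InverseData

lemma HasFDerivAt.hasDerivAt_smul_rot {Y : Type*} [NormedAddCommGroup Y] [NormedSpace ℝ Y]
    {F : E3 → Y} {F' : E3 →L[ℝ] Y} {r : ℝ} {ω : S2} (hF : HasFDerivAt F F' (r • (ω : E3)))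
    (k : Fin 3) : HasDerivAt (fun θ => F (r • rot k θ (ω : E3))) (F' (r • gen k (ω : E3))) 0 := by
  have h := _root_.hasDerivAt_smul_rot k r 0 ω
  have e : r • rot k 0 (ω : E3) = r • (ω : E3) := by rw [rot_zero]
  rw [rot_zero] at h
  rw [← e] at hF
  exact hF.comp_hasDerivAt 0 h

lemma hasDerivAt_rotd_pfun {q : E3 → ℝ} (hq : ContDiff ℝ 1 q)
    (hp : ContDiffOn ℝ 2 (pfun q) {0}ᶜ) (k : Fin 3) {r : ℝ} (hr : 0 < r) (ω : S2) :
    HasDerivAt (fun r => rotd k (pfun q) (r • (ω : E3))) (rotd k q (r • (ω : E3))) r := by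
  have hx := smul_S2_ne_zero hr ω
  have h1 : HasDerivAt (fun r : ℝ => r • (ω : E3)) (ω : E3) r := by
    simpa using (hasDerivAt_id r).smul_const (ω : E3)
  have h2 : HasDerivAt (fun r : ℝ => gen k (r • (ω : E3))) (gen k (ω : E3)) r :=
    (gen k).hasFDerivAt.comp_hasDerivAt r h1
  have hF := hasFDerivAt_fderiv_compl hp hx
  have h0 : HasDerivAt (fun r : ℝ => fderiv ℝ (pfun q) (r • (ω : E3)))
      (fderiv ℝ (fderiv ℝ (pfun q)) (r • (ω : E3)) (ω : E3)) r := hF.comp_hasDerivAt r h1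
  have h9 : HasDerivAt (fun r : ℝ => fderiv ℝ (pfun q) (r • (ω : E3)) (gen k (r • (ω : E3)))) _ r :=
    h0.clm_apply h2
  refine h9.congr_deriv ?_
  clear h9 h0 h2 h1
  have h4 : HasDerivAt (fun θ => rot k θ (ω : E3)) (gen k (ω : E3)) 0 := by
    have := hasDerivAt_rot k 0 (ω : E3)
    rwa [rot_zero] at this
  have h5 := (hF.hasDerivAt_smul_rot k).clm_apply h4
  have h6 := (hq.differentiable one_ne_zero (r • (ω : E3))).hasFDerivAt.hasDerivAt_smul_rot k
  have h7 : (fun θ => fderiv ℝ (pfun q) (r • rot k θ (ω : E3)) (rot k θ (ω : E3))) =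
      fun θ => q (r • rot k θ (ω : E3)) :=
    funext fun θ => by
      rw [← coe_sphMap_rotIso]
      exact fderiv_pfun_radial hq.continuous hp hr _
  rw [h7] at h5
  have h8 := h5.unique h6
  rw [rot_zero] at h8
  rw [rotd, map_smul (gen k) r, ← h8, fderiv_fderiv_symm_compl hp hx (ω : E3)]

/-- The squares of `p = pfun q`, of its angular derivatives and of `q`. -/
def lowDen (q : E3 → ℝ) (x : E3) : ℝ :=
  pfun q x ^ 2 + ∑ k, rotd k (pfun q) x ^ 2 + q x ^ 2

lemma lowDen_nonneg (q : E3 → ℝ) (x : E3) : 0 ≤ lowDen q x := by unfold lowDen; positivity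

namespace InverseData
variable {R T : ℝ} {q q1 : E3 → ℝ} {u2 u : E3 × ℝ → ℝ}
    {g2 g : E3 × ℝ → E3 × ℝ →L[ℝ] ℝ} {H : E3 × ℝ → E3 × ℝ →L[ℝ] E3 × ℝ →L[ℝ] ℝ}
    (h : InverseData R T q q1 u2 u g2 g H)
include h

lemma pfun_inner (ω : S2) : pfun q (R • (ω : E3)) = 0 := by
  have e : u (R • (ω : E3), R) = 0 := h.zero _ (norm_smul_S2 h.pos ω) le_rfl h.lt.le
  rw [← h.bottom_smul h.pos, e, mul_zero]

lemma rotd_pfun_inner (k : Fin 3) (ω : S2) : rotd k (pfun q) (R • (ω : E3)) = 0 := by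
  have h6 := (hasFDerivAt_of_contDiffOn_compl h.diff_pfun
    (smul_S2_ne_zero h.pos ω)).hasDerivAt_smul_rot k
  have h7 : (fun θ => pfun q (R • rot k θ (ω : E3))) = fun _ => 0 :=
    funext fun θ => by
      rw [← coe_sphMap_rotIso]
      exact h.pfun_inner _
  rw [h7] at h6
  rw [rotd, map_smul (gen k) R]
  exact h6.unique (hasDerivAt_const 0 0)

lemma pfun_eq_integral {ρ : ℝ} (hρ : R ≤ ρ) (ω : S2) :
    pfun q (ρ • (ω : E3)) = ∫ r in R..ρ, q (r • (ω : E3)) := by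
  have c : Continuous fun r : ℝ => q (r • (ω : E3)) :=
    h.diff.continuous.comp (by fun_prop)
  rw [intervalIntegral.integral_eq_sub_of_hasDerivAt (f := fun r => pfun q (r • (ω : E3)))
    (fun r hr => hasDerivAt_pfun_smul h.diff.continuous
      (h.pos.trans_le (by rw [uIcc_of_le hρ] at hr; exact hr.1)) ω)
    (c.intervalIntegrable _ _), h.pfun_inner, sub_zero]

lemma rotd_pfun_eq_integral {ρ : ℝ} (hρ : R ≤ ρ) (k : Fin 3) (ω : S2) :
    rotd k (pfun q) (ρ • (ω : E3)) = ∫ r in R..ρ, rotd k q (r • (ω : E3)) := by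
  have c : Continuous fun r : ℝ => rotd k q (r • (ω : E3)) :=
    (h.diff.continuous_rotd k).comp (by fun_prop)
  rw [intervalIntegral.integral_eq_sub_of_hasDerivAt
    (f := fun r => rotd k (pfun q) (r • (ω : E3)))
    (fun r hr => hasDerivAt_rotd_pfun h.diff h.diff_pfun k
      (h.pos.trans_le (by rw [uIcc_of_le hρ] at hr; exact hr.1)) ω)
    (c.intervalIntegrable _ _), h.rotd_pfun_inner, sub_zero]

lemma integral_sq_le_of_eq_integral {f F : E3 → ℝ} (hf : Continuous f)
    (hF : ∀ ρ, R ≤ ρ → ∀ ω : S2, F (ρ • (ω : E3)) = ∫ r in R..ρ, f (r • (ω : E3)))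
    (hle : ∀ x, f x ^ 2 ≤ den q x) {ρ : ℝ} (hρ : ρ ∈ Icc R ((R + T) / 2)) :
    ∫ ω : S2, F (ρ • (ω : E3)) ^ 2 ∂sph ≤ T * slab R ρ fun r ω => den q (r • (ω : E3)) := by
  have c := continuousOn_smul_S2 (ρ := ρ) h.pos (hf.continuousOn (s := {0}ᶜ))
  have cden := continuousOn_smul_S2 (ρ := ρ) h.pos h.continuousOn_den
  simp only [hF ρ hρ.1]
  refine (integral_sq_intervalIntegral_le hρ.1 c).trans ?_
  refine mul_le_mul (by linarith [hρ.2, h.pos, h.lt])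
    (slab_mono hρ.1 (c.pow 2) cden fun r _ ω => hle _)
    (slab_nonneg hρ.1 fun _ _ _ => sq_nonneg _) (h.pos.trans h.lt).le

lemma continuousOn_lowDen : ContinuousOn (lowDen q) {0}ᶜ := by
  have h1 := h.diff_pfun.continuousOn
  have h2 := fun k => continuousOn_rotd h.diff_pfun k
  have h4 := h.diff.continuous.continuousOn (s := ({0}ᶜ : Set E3))
  exact ((h1.pow 2).add (continuousOn_finsetSum _ fun k _ => (h2 k).pow 2)).add (h4.pow 2)

lemma continuousOn_slab_den (b : ℝ) :
    ContinuousOn (fun ρ => slab R ρ fun r ω => den q (r • (ω : E3))) (Icc R b) := by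
  rcases lt_or_ge b R with hb | hb
  · simp [Icc_eq_empty_of_lt hb]
  have c := continuousOn_integral_slab (f := fun r ω => den q (r • (ω : E3)))
    (continuousOn_smul_S2 (ρ := b) h.pos h.continuousOn_den)
  rw [← uIcc_of_le hb]
  rw [← uIcc_of_le hb] at c
  exact intervalIntegral.continuousOn_primitive_interval (c.integrableOn_compact isCompact_uIcc)

lemma exists_integral_lowDen_le : ∃ C, 0 ≤ C ∧ ∀ ρ ∈ Icc R ((R + T) / 2),
    ∫ ω : S2, lowDen q (ρ • (ω : E3)) ∂sph ≤ C * slab R ρ fun r ω => den q (r • (ω : E3)) := by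
  obtain ⟨C, hC, hle⟩ := h.exists_integral_sq_le
  have hT : 0 < T := h.pos.trans h.lt
  refine ⟨T + 3 * T + C, by positivity, fun ρ hρ => ?_⟩
  have hRT : R < (R + T) / 2 := by linarith [h.lt]
  have hcl : ρ ∈ closure (Ioo R ((R + T) / 2)) := by rwa [closure_Ioo hRT.ne]
  have c1 := continuousOn_integral_slab (ρ := (R + T) / 2)
    (f := fun r ω => lowDen q (r • (ω : E3)))
    (continuousOn_smul_S2 h.pos h.continuousOn_lowDen)
  have c2 := (h.continuousOn_slab_den ((R + T) / 2)).const_mul (T + 3 * T + C)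
  refine ContinuousWithinAt.closure_le hcl ((c1 ρ hρ).mono Ioo_subset_Icc_self)
    ((c2 ρ hρ).mono Ioo_subset_Icc_self) fun ρ hρ => ?_
  have hρ' := Ioo_subset_Icc_self hρ
  have hρ0 := h.pos.trans hρ.1
  have hc : Continuous fun ω : S2 => ρ • (ω : E3) := by fun_prop
  have hm : ∀ ω : S2, ρ • (ω : E3) ∈ ({0}ᶜ : Set E3) := smul_S2_ne_zero hρ0
  have i1 : Integrable (fun ω : S2 => pfun q (ρ • (ω : E3)) ^ 2) sph :=
    integrable_sph ((h.diff_pfun.continuousOn.comp_continuous hc hm).pow 2)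
  have i2 : ∀ k, Integrable (fun ω : S2 => rotd k (pfun q) (ρ • (ω : E3)) ^ 2) sph :=
    fun k => integrable_sph (((continuousOn_rotd h.diff_pfun k).comp_continuous hc hm).pow 2)
  have i3 : Integrable (fun ω : S2 => q (ρ • (ω : E3)) ^ 2) sph :=
    integrable_sph ((h.diff.continuous.comp hc).pow 2)
  have e : ∫ ω : S2, lowDen q (ρ • (ω : E3)) ∂sph = ∫ ω : S2, pfun q (ρ • (ω : E3)) ^ 2 ∂sph +
      ∑ k, ∫ ω : S2, rotd k (pfun q) (ρ • (ω : E3)) ^ 2 ∂sph +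
      ∫ ω : S2, q (ρ • (ω : E3)) ^ 2 ∂sph := by
    rw [← integral_finsetSum _ fun k _ => i2 k,
      ← integral_add i1 (integrable_finsetSum _ fun k _ => i2 k)]
    exact integral_add (i1.add (integrable_finsetSum _ fun k _ => i2 k)) i3
  have b1 := h.integral_sq_le_of_eq_integral h.diff.continuous
    (fun ρ hρ ω => h.pfun_eq_integral hρ ω) (sq_le_den q) hρ'
  have b2 := fun k => h.integral_sq_le_of_eq_integral (h.diff.continuous_rotd k)
    (fun ρ hρ ω => h.rotd_pfun_eq_integral hρ k ω) (fun x => sq_rotd_le_den q x k) hρ'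
  have b3 := hle ρ hρ
  rw [e, Fin.sum_univ_three]
  linarith [b2 0, b2 1, b2 2]

end InverseData

lemma add_le_of_sqrt_add_sqrt_le {X Y Z W γ : ℝ} (hX : 0 ≤ X) (hY : 0 ≤ Y) (hZ : 0 ≤ Z)
    (hW : 0 ≤ W) (h : √X + √Y ≤ γ * (√Z + √W)) : X + Y ≤ 2 * γ ^ 2 * (Z + W) := by
  have h1 : (√X + √Y) ^ 2 ≤ (γ * (√Z + √W)) ^ 2 := by gcongr
  rw [mul_pow] at h1
  have h2 := add_sq_le (a := √Z) (b := √W)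
  rw [sq_sqrt hZ, sq_sqrt hW] at h2
  have h3 : (√X + √Y) ^ 2 = X + Y + 2 * (√X * √Y) := by
    rw [add_sq, sq_sqrt hX, sq_sqrt hY]; ring
  have h4 : 0 ≤ √X * √Y := by positivity
  have h5 := mul_le_mul_of_nonneg_left h2 (sq_nonneg γ)
  linarith

lemma angsq_eq_rotd (f : E3 → ℝ) (x : E3) : angsq f x = ∑ k, rotd k f x ^ 2 := by
  simp only [angsq_eq, ang_eq_rotd]

lemma angsq2_eq_rotd (f : E3 → ℝ) (x : E3) :
    angsq2 f x = ∑ k, ∑ l, rotd l (rotd k f) x ^ 2 := by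
  simp only [angsq2_eq, ang_eq_rotd]

namespace InverseData
variable {R T : ℝ} {q q1 : E3 → ℝ} {u2 u : E3 × ℝ → ℝ}
    {g2 g : E3 × ℝ → E3 × ℝ →L[ℝ] ℝ} {H : E3 × ℝ → E3 × ℝ →L[ℝ] E3 × ℝ →L[ℝ] ℝ}
    (h : InverseData R T q q1 u2 u g2 g H)
include h

lemma rotd_pdr_pfun (k : Fin 3) {x : E3} (hx : x ≠ 0) :
    rotd k (pdr (pfun q)) x = rotd k q x := by
  have e : pdr (pfun q) =ᶠ[𝓝 x] q := by
    filter_upwards [isOpen_compl_singleton.mem_nhds hx] with y hy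
      using pdr_pfun h.diff.continuous h.diff_pfun hy
  rw [rotd, rotd, e.fderiv_eq]

lemma integral_den_le {γ : ℝ} (hQ : memQ R T γ q) {r : ℝ} (hr : r ∈ Icc R ((R + T) / 2)) :
    ∫ ω : S2, den q (r • (ω : E3)) ∂sph ≤ (1 + T ^ 2 + T ^ 4) * (2 * γ ^ 2) * (1 + R⁻¹ ^ 2) *
      ∫ ω : S2, lowDen q (r • (ω : E3)) ∂sph := by
  have hR := h.pos
  have hr0 : 0 < r := hR.trans_le hr.1
  have hrT : r ≤ T := by linarith [hr.2, h.lt]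
  have hT : 0 < T := hr0.trans_le hrT
  have hc : Continuous fun ω : S2 => r • (ω : E3) := by fun_prop
  have hm : ∀ ω : S2, r • (ω : E3) ∈ ({0}ᶜ : Set E3) := smul_S2_ne_zero hr0
  have cp := h.diff_pfun.continuousOn.comp_continuous hc hm
  have cr := fun k => (continuousOn_rotd h.diff_pfun k).comp_continuous hc hm
  have crr := fun k l => (continuousOn_rotd_rotd h.diff_pfun k l).comp_continuous hc hm
  have cq := h.diff.continuous.comp hc
  have crq := fun k => (h.diff.continuous_rotd k).comp hc
  set F1 : S2 → ℝ := fun ω => pfun q (r • (ω : E3)) ^ 2 +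
    (r ^ 2)⁻¹ * ∑ k, rotd k (pfun q) (r • (ω : E3)) ^ 2 with hF1
  set F2 : S2 → ℝ := fun ω => (r ^ 4)⁻¹ * ∑ k, ∑ l, rotd l (rotd k (pfun q)) (r • (ω : E3)) ^ 2
    with hF2
  set F3 : S2 → ℝ := fun ω => q (r • (ω : E3)) ^ 2 +
    (r ^ 2)⁻¹ * ∑ k, rotd k q (r • (ω : E3)) ^ 2 with hF3
  set F4 : S2 → ℝ := fun ω => q (r • (ω : E3)) ^ 2 with hF4
  have i1 : Integrable F1 sph := integrable_sph ((cp.pow 2).add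
    ((continuous_finsetSum _ fun k _ => (cr k).pow 2).const_mul _))
  have i2 : Integrable F2 sph := integrable_sph ((continuous_finsetSum _ fun k _ =>
    continuous_finsetSum _ fun l _ => (crr k l).pow 2).const_mul _)
  have i3 : Integrable F3 sph := integrable_sph ((cq.pow 2).add
    ((continuous_finsetSum _ fun k _ => (crq k).pow 2).const_mul _))
  have i4 : Integrable F4 sph := integrable_sph (cq.pow 2)
  have iden : Integrable (fun ω : S2 => den q (r • (ω : E3))) sph :=
    integrable_sph (h.continuousOn_den.comp_continuous hc hm)
  have ilow : Integrable (fun ω : S2 => lowDen q (r • (ω : E3))) sph :=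
    integrable_sph (h.continuousOn_lowDen.comp_continuous hc hm)
  have n1 : 0 ≤ ∫ ω, F1 ω ∂sph :=
    integral_nonneg fun ω => by simp only [hF1, Pi.zero_apply]; positivity
  have n2 : 0 ≤ ∫ ω, F2 ω ∂sph :=
    integral_nonneg fun ω => by simp only [hF2, Pi.zero_apply]; positivity
  have n3 : 0 ≤ ∫ ω, F3 ω ∂sph :=
    integral_nonneg fun ω => by simp only [hF3, Pi.zero_apply]; positivity
  have n4 : 0 ≤ ∫ ω, F4 ω ∂sph :=
    integral_nonneg fun ω => by simp only [hF4, Pi.zero_apply]; positivity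
  have e1 : H1sq (pfun q) r = r ^ 2 * ∫ ω, F1 ω ∂sph := by
    rw [H1sq, sphInt_eq hr0]
    simp only [angsq_eq_rotd, hF1]
  have e2 : H2sq (pfun q) r = r ^ 2 * ∫ ω, F1 ω ∂sph + r ^ 2 * ∫ ω, F2 ω ∂sph := by
    rw [H2sq, e1, sphInt_eq hr0]
    simp only [angsq2_eq_rotd, hF2]
  have epdr : ∀ ω : S2, pdr (pfun q) (r • (ω : E3)) = q (r • (ω : E3)) := fun ω =>
    pdr_pfun h.diff.continuous h.diff_pfun (hm ω)
  have e3 : H1sq (pdr (pfun q)) r = r ^ 2 * ∫ ω, F3 ω ∂sph := by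
    rw [H1sq, sphInt_eq hr0]
    have e : ∀ ω : S2, ∀ k, rotd k (pdr (pfun q)) (r • (ω : E3)) = rotd k q (r • (ω : E3)) :=
      fun ω k => h.rotd_pdr_pfun k (hm ω)
    simp only [angsq_eq_rotd, hF3, e, epdr]
  have e4 : L2sq (pdr (pfun q)) r = r ^ 2 * ∫ ω, F4 ω ∂sph := by
    rw [L2sq, sphInt_eq hr0]
    simp only [hF4, epdr]
  have key := hQ r hr
  rw [e1, e2, e3, e4] at key
  replace key := add_le_of_sqrt_add_sqrt_le (by positivity) (by positivity) (by positivity)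
    (by positivity) key
  have key' : ∫ ω, F1 ω ∂sph + ∫ ω, F2 ω ∂sph + ∫ ω, F3 ω ∂sph ≤
      2 * γ ^ 2 * (∫ ω, F1 ω ∂sph + ∫ ω, F4 ω ∂sph) := by
    refine le_of_mul_le_mul_left ?_ (by positivity : 0 < r ^ 2)
    linarith
  have b1 : ∫ ω : S2, den q (r • (ω : E3)) ∂sph ≤
      (1 + T ^ 2 + T ^ 4) * (∫ ω, F1 ω ∂sph + ∫ ω, F2 ω ∂sph + ∫ ω, F3 ω ∂sph) := by
    rw [← integral_add i1 i2, ← integral_add (f := fun ω => F1 ω + F2 ω) (i1.add i2) i3,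
      ← integral_const_mul]
    refine integral_mono iden (((i1.add i2).add i3).const_mul _) fun ω => ?_
    simp only [hF1, hF2, hF3, den]
    have s1 : 0 ≤ ∑ k, rotd k (pfun q) (r • (ω : E3)) ^ 2 := by positivity
    have s2 : 0 ≤ ∑ k, ∑ l, rotd l (rotd k (pfun q)) (r • (ω : E3)) ^ 2 := by positivity
    have s3 : 0 ≤ ∑ k, rotd k q (r • (ω : E3)) ^ 2 := by positivity
    have s4 := sq_nonneg (pfun q (r • (ω : E3)))
    have s5 := sq_nonneg (q (r • (ω : E3)))
    have t2 : 1 ≤ (1 + T ^ 2 + T ^ 4) * (r ^ 2)⁻¹ := by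
      rw [← div_eq_mul_inv, one_le_div (by positivity)]
      have : r ^ 2 ≤ T ^ 2 := by gcongr
      linarith [pow_pos hT 4]
    have t4 : 1 ≤ (1 + T ^ 2 + T ^ 4) * (r ^ 4)⁻¹ := by
      rw [← div_eq_mul_inv, one_le_div (by positivity)]
      have : r ^ 4 ≤ T ^ 4 := by gcongr
      linarith [pow_pos hT 2]
    have t0 : 1 ≤ 1 + T ^ 2 + T ^ 4 := by linarith [pow_pos hT 2, pow_pos hT 4]
    have r1 := mul_le_mul_of_nonneg_right t2 s1
    have r2 := mul_le_mul_of_nonneg_right t4 s2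
    have r3 := mul_le_mul_of_nonneg_right t2 s3
    have r4 := mul_le_mul_of_nonneg_right t0 s4
    have r5 := mul_le_mul_of_nonneg_right t0 s5
    linarith
  have b2 : ∫ ω, F1 ω ∂sph + ∫ ω, F4 ω ∂sph ≤
      (1 + R⁻¹ ^ 2) * ∫ ω : S2, lowDen q (r • (ω : E3)) ∂sph := by
    rw [← integral_add i1 i4, ← integral_const_mul]
    refine integral_mono (i1.add i4) (ilow.const_mul _) fun ω => ?_
    simp only [hF1, hF4, lowDen]
    have s1 : 0 ≤ ∑ k, rotd k (pfun q) (r • (ω : E3)) ^ 2 := by positivity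
    have s4 := sq_nonneg (pfun q (r • (ω : E3)))
    have s5 := sq_nonneg (q (r • (ω : E3)))
    have t0 : 0 ≤ R⁻¹ ^ 2 := sq_nonneg _
    have t1 : (r ^ 2)⁻¹ ≤ R⁻¹ ^ 2 := by
      rw [← inv_pow]
      gcongr
      exact hr.1
    linarith [mul_le_mul_of_nonneg_right t1 s1, mul_nonneg t0 s4, mul_nonneg t0 s5]
  refine b1.trans ?_
  rw [mul_assoc, mul_assoc]
  refine mul_le_mul_of_nonneg_left ?_ (by positivity)
  exact key'.trans (mul_le_mul_of_nonneg_left b2 (by positivity))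

theorem eq_zero {γ : ℝ} (hQ : memQ R T γ q) {r : ℝ} (hr : r ∈ Icc R ((R + T) / 2)) (ω : S2) :
    q (r • (ω : E3)) = 0 := by
  obtain ⟨C, hC, hlow⟩ := h.exists_integral_lowDen_le
  set K := (1 + T ^ 2 + T ^ 4) * (2 * γ ^ 2) * (1 + R⁻¹ ^ 2) with hK
  have hK0 : 0 ≤ K := by positivity
  have cl := continuousOn_integral_slab (ρ := (R + T) / 2)
    (f := fun r ω => lowDen q (r • (ω : E3))) (continuousOn_smul_S2 h.pos h.continuousOn_lowDen)
  have cd := continuousOn_integral_slab (ρ := (R + T) / 2)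
    (f := fun r ω => den q (r • (ω : E3))) (continuousOn_smul_S2 h.pos h.continuousOn_den)
  have hzero := eq_zero_of_le_integral (C := C * K) (mul_nonneg hC hK0) cl
    (fun ρ _ => integral_nonneg fun ω => lowDen_nonneg _ _) (fun ρ hρ => by
      have hsub : uIcc R ρ ⊆ Icc R ((R + T) / 2) := by
        rw [uIcc_of_le hρ.1]; exact Icc_subset_Icc_right hρ.2
      refine (hlow ρ hρ).trans ?_
      rw [mul_assoc, ← intervalIntegral.integral_const_mul]
      refine mul_le_mul_of_nonneg_left ?_ hC
      exact intervalIntegral.integral_mono_on hρ.1 (cd.mono hsub).intervalIntegrable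
        ((cl.mono hsub).const_mul K).intervalIntegrable fun r hr =>
          h.integral_den_le hQ ⟨hr.1, hr.2.trans hρ.2⟩) r hr
  have cω : Continuous fun ω : S2 => lowDen q (r • (ω : E3)) :=
    h.continuousOn_lowDen.comp_continuous (by fun_prop) (smul_S2_ne_zero (h.pos.trans_le hr.1))
  have hae := (integral_eq_zero_iff_of_nonneg (fun ω => lowDen_nonneg _ _)
    (integrable_sph cω)).1 hzero
  have h0 : lowDen q (r • (ω : E3)) = 0 :=
    congrFun ((cω.ae_eq_iff_eq sph continuous_const).1 hae) ω
  rw [lowDen] at h0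
  have s1 : 0 ≤ ∑ k, rotd k (pfun q) (r • (ω : E3)) ^ 2 := by positivity
  refine pow_eq_zero_iff two_ne_zero |>.1 (le_antisymm ?_ (sq_nonneg _))
  linarith [sq_nonneg (pfun q (r • (ω : E3)))]

end InverseData

lemma GoursatSol.inverseData {R T : ℝ} (hR : 0 < R) (hRT : R < T) {q1 q2 : E3 → ℝ}
    (hq1 : ContDiff ℝ 1 q1) (hq2 : ContDiff ℝ 1 q2) {u1 u2 : E3 × ℝ → ℝ}
    (hu1 : GoursatSol q1 u1) (hu2 : GoursatSol q2 u2)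
    (hC : ∀ p : E3 × ℝ, ‖p.1‖ = R → R ≤ p.2 → p.2 ≤ T → u1 p = u2 p ∧ pdrX u1 p = pdrX u2 p) :
    ∃ g2 g H, InverseData R T (q1 - q2) q1 u2 (u1 - u2) g2 g H := by
  obtain ⟨g1, H1, j1, c1, d1⟩ := hu1.exists_jet
  obtain ⟨g2, H2, j2, c2, d2⟩ := hu2.exists_jet
  have hb : ∀ x, pfun (q1 - q2) x = ‖x‖ * (u1 - u2) (x, ‖x‖) := fun x => by
    have k1 : Continuous fun σ : ℝ => q1 (σ • x) := hq1.continuous.comp (by fun_prop)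
    have k2 : Continuous fun σ : ℝ => q2 (σ • x) := hq2.continuous.comp (by fun_prop)
    rw [pfun_eq, Pi.sub_apply, hu1.2.2, hu2.2.2,
      ← intervalIntegral.integral_sub (k1.intervalIntegrable _ _) (k2.intervalIntegrable _ _)]
    rfl
  refine ⟨g2, g1 - g2, H1 - H2, ?_⟩
  exact {
    pos := hR
    lt := hRT
    diff := hq1.sub hq2
    diff_one := hq1
    grad_two := c2
    jet := j1.sub_potential j2
    grad := c1.sub c2
    hess := fun z hz => (d1 z hz).sub (d2 z hz)
    diff_pfun := contDiffOn_of_eq_norm_mul (hu1.1.sub hu2.1) hb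
    bottom := hb
    zero := fun z h1 h2 h3 => sub_eq_zero.2 (hC z h1 h2 h3).1
    zero_grad := fun z h1 h2 h3 => by
      have hn : cone ∈ 𝓝 z := cone_mem_nhds (h1.trans_lt h2)
      have hz : z ∈ cone := mem_of_mem_nhds hn
      have e := (hC z h1 h2.le h3.le).2
      rw [pdrX_eq ((c1.hasGrad z hz).hasFDerivAt hn),
        pdrX_eq ((c2.hasGrad z hz).hasFDerivAt hn)] at e
      exact sub_eq_zero.2 e }

/-- **Theorem 1.2.** Uniqueness for the hyperbolic inverse problem with
angular control on the coefficients: if the Cauchy data of `u₁` and `u₂` agree on the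
cylinder `|x| = R`, `R ≤ t ≤ T`, and `q₁ − q₂ ∈ Q_γ(R,T)`, then `q₁ = q₂` on the annulus
`R ≤ |x| ≤ (R+T)/2`. -/
theorem stmt2 (R T : ℝ) (hR : 0 < R) (hRT : R < T)
    (q1 q2 : E3 → ℝ) (hq1 : ContDiff ℝ 8 q1) (hq2 : ContDiff ℝ 8 q2)
    (u1 u2 : E3 × ℝ → ℝ) (hu1 : GoursatSol q1 u1) (hu2 : GoursatSol q2 u2)
    (hC : ∀ p : E3 × ℝ, ‖p.1‖ = R → R ≤ p.2 → p.2 ≤ T →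
      u1 p = u2 p ∧ pdrX u1 p = pdrX u2 p)
    (γ : ℝ) (hγ : 0 < γ) (hQ : memQ R T γ (q1 - q2)) :
    ∀ x : E3, R ≤ ‖x‖ → ‖x‖ ≤ (R + T) / 2 → q1 x = q2 x := by

  intro x h1 h2
  have hx : x ≠ 0 := norm_pos_iff.1 (hR.trans_le h1)
  obtain ⟨_, _, _, h⟩ := hu1.inverseData hR hRT (hq1.of_le (by norm_num))
    (hq2.of_le (by norm_num)) hu2 hC
  obtain ⟨ω, hω⟩ := smul_S2_surj hx
  have h0 := h.eq_zero hQ ⟨h1, h2⟩ ω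
  rw [← hω] at h0
  exact sub_eq_zero.1 h0
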